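/- For every x ∈ Σ_2' there exists r_x > 0 such that A ∩ B_{r_x}(x) is a smooth curve: there exist orthonormal vectors e_1, e_2 ∈ ℝ² and a C^∞ function g : ℝ → ℝ with A ∩ B_{r_x}(x) = {x + t·e_1 + g(t)·e_2 : t ∈ ℝ} ∩ B_{r_x}(x). -/

import Mathlib

open MeasureTheory Metric Set
open scoped NNReal ENNReal RealInnerProductSpace

noncomputable section

abbrev E2 : Type := EuclideanSpace ℝ (Fin 2)

/-- The subdifferential of a convex function `w` at a point `x`. -/
def subdiff (w : E2 → ℝ) (x : E2) : Set E2 :=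
  {p : E2 | ∀ z : E2, w x + ⟪p, z - x⟫ ≤ w z}

/-- The closed upper half disc of radius `ρ` centred at the origin. -/
def closedHalfDisc (ρ : ℝ) : Set ℂ := {z | ‖z‖ ≤ ρ ∧ 0 ≤ z.im}

/-- The open upper half disc of radius `ρ` centred at the origin. -/
def openHalfDisc (ρ : ℝ) : Set ℂ := {z | ‖z‖ < ρ ∧ 0 < z.im}

lemma isOpen_openHalfDisc (ρ : ℝ) : IsOpen (openHalfDisc ρ) :=
  (isOpen_lt continuous_norm continuous_const).inter
    (isOpen_lt continuous_const Complex.continuous_im)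

lemma isClosed_closedHalfDisc (ρ : ℝ) : IsClosed (closedHalfDisc ρ) :=
  (isClosed_le continuous_norm continuous_const).inter
    (isClosed_le continuous_const Complex.continuous_im)

lemma closure_openHalfDisc_subset (ρ : ℝ) : closure (openHalfDisc ρ) ⊆ closedHalfDisc ρ :=
  closure_minimal (fun _ hz => ⟨hz.1.le, hz.2.le⟩) (isClosed_closedHalfDisc ρ)

lemma openHalfDisc_subset (ρ : ℝ) : openHalfDisc ρ ⊆ closedHalfDisc ρ :=
  fun _ hz => ⟨hz.1.le, hz.2.le⟩

lemma closedHalfDisc_subset_closure {ρ : ℝ} (hρ : 0 < ρ) :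
    closedHalfDisc ρ ⊆ closure (openHalfDisc ρ) := by
  intro z hz
  have h0 : (Complex.I * (ρ / 2 : ℝ)) ∈ openHalfDisc ρ := by
    constructor
    · simp [abs_of_pos hρ]; linarith
    · simp; linarith
  have hcont : Filter.Tendsto (fun t : ℝ => ((1 - t : ℝ) : ℂ) * z + (t : ℂ) * (Complex.I * (ρ / 2 : ℝ)))
      (nhdsWithin 0 (Ioo 0 1)) (nhds z) := by
    have : Continuous (fun t : ℝ => ((1 - t : ℝ) : ℂ) * z + (t : ℂ) * (Complex.I * (ρ / 2 : ℝ))) := by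
      fun_prop
    have h := (this.tendsto 0).mono_left (nhdsWithin_le_nhds (s := Ioo 0 1))
    simpa using h
  have : (nhdsWithin (0 : ℝ) (Ioo 0 1)).NeBot := by
    apply mem_closure_iff_nhdsWithin_neBot.1
    rw [closure_Ioo (by norm_num)]; simp
  refine mem_closure_of_tendsto hcont ?_
  filter_upwards [self_mem_nhdsWithin] with t ht
  constructor
  · calc _ ≤ ‖((1 - t : ℝ) : ℂ) * z‖ + ‖(t : ℂ) * (Complex.I * (ρ / 2 : ℝ))‖ := norm_add_le _ _
      _ = (1 - t) * ‖z‖ + t * (ρ / 2) := by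
        rw [norm_mul, norm_mul, Complex.norm_real, Complex.norm_real, Real.norm_eq_abs,
          Real.norm_eq_abs, abs_of_pos ht.1, abs_of_pos (by linarith [ht.2] : 0 < 1 - t)]
        simp [abs_of_pos hρ]
      _ < ρ := by nlinarith [hz.1, ht.1, ht.2]
  · have := hz.2
    have h1 : 0 ≤ (1 - t) * z.im := mul_nonneg (by linarith [ht.2]) this
    have h2 : 0 < t * (ρ / 2) := mul_pos ht.1 (by linarith)
    simp
    linarith

/-- A barrier estimate: square-root growth on the boundary propagates to the half disc. -/
lemma re_le_of_boundary_sqrt {K : ℂ → ℂ} {ρ N a : ℝ} (hN : 0 ≤ N)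
    (hc : ContinuousOn K (closedHalfDisc ρ)) (hd : DifferentiableOn ℂ K (openHalfDisc ρ))
    (hreal : ∀ t : ℝ, |t| ≤ ρ → (K t).re ≤ N * √|t - a|)
    (harc : ∀ z : ℂ, ‖z‖ = ρ → 0 ≤ z.im → (K z).re ≤ N * √‖z - a‖)
    {z : ℂ} (hz : z ∈ openHalfDisc ρ) : (K z).re ≤ 2 * N * √‖z - a‖ := by
  let w : ℂ → ℂ := fun z => -Complex.I * (z - a)
  have wre : ∀ z, (w z).re = z.im := fun z => by simp [w]
  have wn : ∀ z, ‖w z‖ = ‖z - a‖ := fun z => by simp [w]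
  have wc : Continuous w := by fun_prop
  let f : ℂ → ℂ := fun z => Complex.exp (K z - (√2 * N : ℝ) * (w z) ^ (2⁻¹ : ℂ))
  have fn : ∀ z, ‖f z‖ = Real.exp ((K z).re - √2 * N * √((‖z - a‖ + z.im) / 2)) := by
    intro z
    rw [Complex.norm_exp, Complex.sub_re, Complex.re_ofReal_mul, Complex.cpow_inv_two_re, wre, wn]
  have key : ∀ z : ℂ, 0 ≤ z.im → N * √‖z - a‖ ≤ √2 * N * √((‖z - a‖ + z.im) / 2) := by
    intro z hz
    have h : √‖z - a‖ ≤ √2 * √((‖z - a‖ + z.im) / 2) := by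
      rw [← Real.sqrt_mul (by norm_num)]
      exact Real.sqrt_le_sqrt (by linarith)
    calc _ ≤ N * (√2 * √((‖z - a‖ + z.im) / 2)) := mul_le_mul_of_nonneg_left h hN
      _ = _ := by ring
  have hdc : DiffContOnCl ℂ f (openHalfDisc ρ) := by
    constructor
    · refine DifferentiableOn.cexp (hd.sub ?_)
      intro z hz
      have hw : DifferentiableAt ℂ w z := by fun_prop
      exact ((hw.cpow_const (Or.inl (by rw [wre]; exact hz.2))).const_mul _).differentiableWithinAt
    · refine ContinuousOn.mono ?_ (closure_openHalfDisc_subset ρ)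
      refine ContinuousOn.cexp (hc.sub (continuousOn_const.mul ?_))
      intro z hz
      refine ContinuousAt.continuousWithinAt ?_
      exact ContinuousAt.comp (f := w) (g := fun x => x ^ (2⁻¹ : ℂ))
        (Complex.continuousAt_cpow_const_of_re_pos
        (Or.inl (by rw [wre]; exact hz.2)) (by norm_num)) wc.continuousAt
  have hb : Bornology.IsBounded (openHalfDisc ρ) :=
    isBounded_closedBall.subset (fun z hz => by simpa using hz.1.le : openHalfDisc ρ ⊆ closedBall 0 ρ)
  have hfr : ∀ z ∈ frontier (openHalfDisc ρ), ‖f z‖ ≤ 1 := by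
    intro z hz
    have h1 := closure_openHalfDisc_subset ρ hz.1
    have h2 : z ∉ openHalfDisc ρ := by
      rw [(isOpen_openHalfDisc ρ).frontier_eq] at hz; exact hz.2
    rw [fn, Real.exp_le_one_iff]
    have h3 : (K z).re ≤ N * √‖z - a‖ := by
      rcases h1.1.lt_or_eq with h | h
      · have h0 : z.im = 0 := le_antisymm (not_lt.1 fun h' => h2 ⟨h, h'⟩) h1.2
        have hzr : z = (z.re : ℂ) := Complex.ext (by simp) (by simp [h0])
        have := hreal z.re (by rw [← Real.norm_eq_abs, ← Complex.norm_real, ← hzr]; exact h1.1)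
        rw [← hzr] at this
        convert this using 3
        rw [← Real.norm_eq_abs, ← Complex.norm_real, Complex.ofReal_sub, ← hzr]
      · exact harc z h h1.2
    linarith [key z h1.2]
  have := Complex.norm_le_of_forall_mem_frontier_norm_le hb hdc hfr (subset_closure hz)
  rw [fn, Real.exp_le_one_iff] at this
  have h4 : z.im ≤ ‖z - a‖ := by
    have := (le_abs_self _).trans (Complex.abs_im_le_norm (z - a))
    simpa using this
  have h5 : √((‖z - a‖ + z.im) / 2) ≤ √‖z - a‖ := Real.sqrt_le_sqrt (by linarith)
  have h6 : √2 ≤ 2 := by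
    rw [Real.sqrt_le_left (by norm_num)]; norm_num
  calc (K z).re ≤ √2 * N * √((‖z - a‖ + z.im) / 2) := by linarith
    _ ≤ 2 * N * √‖z - a‖ := by gcongr

/-- Local derivative bound for a holomorphic function with bounded imaginary part. -/
lemma norm_deriv_le_of_abs_im_le {H : ℂ → ℂ} {c : ℂ} {R m y : ℝ} (hR : 0 < R) (hm : 0 < m)
    (hd : DiffContOnCl ℂ H (ball c R)) (hb : ∀ z ∈ closedBall c R, |(H z).im - y| ≤ m) :
    ‖deriv H c‖ ≤ Real.exp 2 * m / R := by
  let f : ℂ → ℂ := fun z => Complex.exp (-Complex.I * (m⁻¹ : ℝ) * (H z - y * Complex.I))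
  have fn : ∀ z, ‖f z‖ = Real.exp (m⁻¹ * ((H z).im - y)) := by
    intro z
    rw [Complex.norm_exp]; congr 1; simp
  have hfd : DiffContOnCl ℂ f (ball c R) := by
    have h1 : DiffContOnCl ℂ (fun z => -Complex.I * (m⁻¹ : ℝ) * (H z - y * Complex.I)) (ball c R) := by
      have := (hd.sub_const (y * Complex.I)).const_smul (-Complex.I * (m⁻¹ : ℝ))
      exact this
    exact ⟨h1.1.cexp, h1.2.cexp⟩
  have hle : ∀ z ∈ sphere c R, ‖f z‖ ≤ Real.exp 1 := by
    intro z hz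
    rw [fn]
    apply Real.exp_le_exp.2
    have := (abs_le.1 (hb z (sphere_subset_closedBall hz))).2
    calc m⁻¹ * ((H z).im - y) ≤ m⁻¹ * m := by gcongr
      _ = 1 := inv_mul_cancel₀ hm.ne'
  have h1 := Complex.norm_deriv_le_of_forall_mem_sphere_norm_le hR hfd hle
  have hHd : DifferentiableAt ℂ H c :=
    hd.differentiableAt isOpen_ball (mem_ball_self hR)
  have hder : HasDerivAt f (f c * (-Complex.I * (m⁻¹ : ℝ) * deriv H c)) c :=
    ((hHd.hasDerivAt.sub_const _).const_mul _).cexp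
  rw [hder.deriv, norm_mul, norm_mul, norm_mul] at h1
  have hfc : Real.exp (-1) ≤ ‖f c‖ := by
    rw [fn]
    apply Real.exp_le_exp.2
    have := (abs_le.1 (hb c (mem_closedBall_self hR.le))).1
    calc (-1 : ℝ) = m⁻¹ * (-m) := by field_simp
      _ ≤ m⁻¹ * ((H c).im - y) := by gcongr
  simp only [norm_neg, Complex.norm_I, one_mul, Complex.norm_real, Real.norm_eq_abs,
    abs_of_pos (inv_pos.2 hm)] at h1
  have h2 : Real.exp (-1) * (m⁻¹ * ‖deriv H c‖) ≤ Real.exp 1 / R :=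
    (mul_le_mul_of_nonneg_right hfc (by positivity)).trans h1
  have h3 : ‖deriv H c‖ = Real.exp 1 * m * (Real.exp (-1) * (m⁻¹ * ‖deriv H c‖)) := by
    have : Real.exp 1 * Real.exp (-1) = 1 := by rw [← Real.exp_add]; simp
    field_simp
    linear_combination (-‖deriv H c‖) * this
  rw [h3]
  calc _ ≤ Real.exp 1 * m * (Real.exp 1 / R) := by gcongr
    _ = _ := by rw [show (2:ℝ) = 1 + 1 by norm_num, Real.exp_add]; ring

/-- Interior derivative bound `|H'| ≤ C / √(Im z)` under a square-root modulus of continuity of the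
imaginary part on the real axis. -/
lemma norm_deriv_le_of_holder_boundary {H : ℂ → ℂ} {ρ N : ℝ} (hρ : 0 < ρ) (hN : 0 < N)
    (hc : ContinuousOn H (closedHalfDisc ρ)) (hd : DifferentiableOn ℂ H (openHalfDisc ρ))
    (hreal : ∀ a t : ℝ, |a| ≤ ρ / 2 → |t| ≤ ρ → |(H t).im - (H a).im| ≤ N * √|t - a|)
    (harc : ∀ z : ℂ, ‖z‖ = ρ → 0 ≤ z.im → |(H z).im| ≤ N * √ρ) :
    ∀ z : ℂ, |z.re| ≤ ρ / 4 → 0 < z.im → z.im ≤ ρ / 4 →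
      ‖deriv H z‖ ≤ Real.exp 2 * 32 * N / √z.im := by
  intro z hzr hz0 hzi
  set a := z.re with ha
  set s := z.im with hs
  have ha2 : |a| ≤ ρ / 2 := by linarith
  have hsq : 0 < √ρ := Real.sqrt_pos.2 hρ
  have hHa : |(H a).im| ≤ 3 * N * √ρ := by
    have h1 := hreal a ρ ha2 (abs_of_pos hρ).le
    have h2 := harc ρ (by simp [abs_of_pos hρ]) (by simp)
    have h3 : √|ρ - a| ≤ 2 * √ρ := by
      rw [Real.sqrt_le_left (by positivity), mul_pow, Real.sq_sqrt hρ.le, abs_le]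
      constructor <;> linarith [(abs_le.1 ha2).1, (abs_le.1 ha2).2]
    have h4 : |(H a).im| ≤ |(H ρ).im - (H a).im| + |(H ρ).im| := by
      have := abs_sub_abs_le_abs_sub (H a).im (H ρ).im
      rw [abs_sub_comm] at this; linarith
    nlinarith
  have harc' : ∀ w : ℂ, ‖w‖ = ρ → 0 ≤ w.im → |(H w).im - (H a).im| ≤ 6 * N * √‖w - a‖ := by
    intro w hw hw0
    have h1 := harc w hw hw0
    have h2 : ρ / 2 ≤ ‖w - a‖ := by
      have := norm_sub_norm_le w (a : ℂ)
      rw [Complex.norm_real, Real.norm_eq_abs, hw] at this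
      linarith
    have h3 : 4 * √ρ ≤ 6 * √‖w - a‖ := by
      rw [← abs_of_nonneg (by positivity : 0 ≤ 4 * √ρ), ← abs_of_nonneg (by positivity : 0 ≤ 6 * √‖w - a‖)]
      rw [← sq_le_sq, mul_pow, mul_pow, Real.sq_sqrt hρ.le, Real.sq_sqrt (norm_nonneg _)]
      linarith
    have h4 := abs_sub (H w).im (H a).im
    nlinarith
  have hreal' : ∀ t : ℝ, |t| ≤ ρ → |(H t).im - (H a).im| ≤ 6 * N * √|t - a| := by
    intro t ht
    refine (hreal a t ha2 ht).trans ?_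
    gcongr; linarith
  have hmain : ∀ w ∈ openHalfDisc ρ, |(H w).im - (H a).im| ≤ 12 * N * √‖w - a‖ := by
    intro w hw
    have h1 := re_le_of_boundary_sqrt (K := fun z => -Complex.I * (H z - H a)) (ρ := ρ) (N := 6 * N) (a := a)
      (by positivity) (continuousOn_const.mul (hc.sub continuousOn_const))
      ((hd.sub_const _).const_mul _)
      (fun t ht => by simpa using (le_abs_self _).trans (hreal' t ht))
      (fun t ht h0 => by simpa using (le_abs_self _).trans (harc' t ht h0)) hw
    have h2 := re_le_of_boundary_sqrt (K := fun z => Complex.I * (H z - H a)) (ρ := ρ) (N := 6 * N) (a := a)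
      (by positivity) (continuousOn_const.mul (hc.sub continuousOn_const))
      ((hd.sub_const _).const_mul _)
      (fun t ht => by simpa using (neg_le_abs _).trans (hreal' t ht))
      (fun t ht h0 => by simpa using (neg_le_abs _).trans (harc' t ht h0)) hw
    simp at h1 h2
    rw [abs_le]; constructor <;> linarith
  have hsub : closedBall z (s / 2) ⊆ openHalfDisc ρ := by
    intro w hw
    rw [mem_closedBall, dist_eq_norm] at hw
    constructor
    · have h1 := norm_add_le (w - z) z
      rw [sub_add_cancel] at h1
      have h2 := Complex.norm_le_abs_re_add_abs_im z
      rw [← ha, ← hs, abs_of_pos hz0] at h2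
      linarith
    · have := (abs_le.1 ((Complex.abs_im_le_norm (w - z)).trans hw)).1
      rw [Complex.sub_im] at this
      show 0 < w.im
      linarith
  have hza : ‖z - a‖ = s := by
    have : z - a = (s : ℂ) * Complex.I := by
      apply Complex.ext <;> simp [ha, hs]
    rw [this]; simp [abs_of_pos hz0]
  have h3 : √(3 / 2 * s) ≤ 4 / 3 * √s := by
    rw [Real.sqrt_le_left (by positivity), mul_pow, Real.sq_sqrt hz0.le]; linarith
  have hss : 0 < √s := Real.sqrt_pos.2 hz0
  have := norm_deriv_le_of_abs_im_le (H := H) (c := z) (R := s / 2) (m := 16 * N * √s) (y := (H a).im)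
    (by linarith) (by positivity)
    ⟨hd.mono (ball_subset_closedBall.trans hsub), (hc.mono (hsub.trans (openHalfDisc_subset ρ))).mono
      closure_ball_subset_closedBall⟩ (by
      intro w hw
      have h1 := hmain w (hsub hw)
      rw [mem_closedBall, dist_eq_norm] at hw
      have h2 : ‖w - a‖ ≤ 3 / 2 * s := by
        have := norm_sub_le_norm_sub_add_norm_sub w z a
        linarith
      have h4 := Real.sqrt_le_sqrt h2
      have h5 : √‖w - a‖ ≤ 4 / 3 * √s := h4.trans h3
      nlinarith)
  refine this.trans (le_of_eq ?_)
  have h6 : √s * √s = s := Real.mul_self_sqrt hz0.le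
  rw [div_eq_div_iff (by linarith) hss.ne']
  linear_combination (16 * N * Real.exp 2) * h6

/-- Hardy-Littlewood: the bound `|G'| ≤ C / √(Im z)` gives a Hölder estimate of exponent `1/2`. -/
lemma norm_sub_le_of_norm_deriv_le_inv_sqrt {G : ℂ → ℂ} {η C : ℝ} (hC : 0 ≤ C)
    (hd : ∀ z : ℂ, |z.re| < η → 0 < z.im → z.im < 4 * η → DifferentiableAt ℂ G z)
    (hb : ∀ z : ℂ, |z.re| < η → 0 < z.im → z.im < 4 * η → ‖deriv G z‖ ≤ C / √z.im)
    {z w : ℂ} (hz : |z.re| < η) (hz0 : 0 < z.im) (hz1 : z.im < η)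
    (hw : |w.re| < η) (hw0 : 0 < w.im) (hw1 : w.im < η) :
    ‖G z - G w‖ ≤ 5 * C * √‖z - w‖ := by
  have hη : 0 < η := hz0.trans hz1
  set d := ‖z - w‖ with hdd
  have hd3 : d < 3 * η := by
    have := Complex.norm_le_abs_re_add_abs_im (z - w)
    rw [Complex.sub_re, Complex.sub_im] at this
    have h1 : |z.re - w.re| < 2 * η := by
      rw [abs_lt] at *; constructor <;> linarith [hz.1, hz.2, hw.1, hw.2]
    have h2 : |z.im - w.im| < η := by
      rw [abs_lt] ; constructor <;> linarith
    linarith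
  have vert : ∀ z : ℂ, |z.re| < η → 0 < z.im → z.im < η → ‖G (z + d * Complex.I) - G z‖ ≤ 2 * C * √d := by
    intro z hz hz0 hz1
    have hder : ∀ σ ∈ Icc (0 : ℝ) d, HasDerivAt (fun σ : ℝ => G (z + σ * Complex.I) - G z)
        (deriv G (z + σ * Complex.I) * Complex.I) σ := by
      intro σ hσ
      have h1 := (hd (z + σ * Complex.I) (by simpa using hz) (by simp; linarith [hσ.1])
        (by simp; linarith [hσ.2])).hasDerivAt
      have h2 : HasDerivAt (fun σ : ℝ => z + σ * Complex.I) Complex.I σ := by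
        simpa using ((Complex.ofRealCLM.hasDerivAt (x := σ)).mul_const Complex.I).const_add z
      exact (HasDerivAt.comp σ h1 h2).sub_const _
    have := image_norm_le_of_norm_deriv_right_le_deriv_boundary'
      (f := fun σ : ℝ => G (z + σ * Complex.I) - G z) (a := 0) (b := d)
      (f' := fun σ => deriv G (z + σ * Complex.I) * Complex.I)
      (B := fun σ => 2 * C * (√(z.im + σ) - √z.im)) (B' := fun σ => C / √(z.im + σ))
      (fun σ hσ => (hder σ hσ).continuousAt.continuousWithinAt)
      (fun σ hσ => (hder σ ⟨hσ.1, hσ.2.le⟩).hasDerivWithinAt) (by simp) (by fun_prop)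
      (fun σ hσ => by
        have hp : z.im + σ ≠ 0 := by linarith [hσ.1]
        have := ((((hasDerivAt_id σ).const_add z.im).sqrt hp).sub_const (√z.im)).const_mul (2 * C)
        refine this.hasDerivWithinAt.congr_deriv ?_
        simp only [id_eq]
        ring)
      (fun σ hσ => by
        have := hb (z + σ * Complex.I) (by simpa using hz) (by simp; linarith [hσ.1])
          (by simp; linarith [hσ.2])
        simpa using this) (right_mem_Icc.2 (norm_nonneg _))
    refine this.trans ?_
    have h5 : √(z.im + d) ≤ √z.im + √d := by
      rw [Real.sqrt_le_left (by positivity), add_sq, Real.sq_sqrt hz0.le, Real.sq_sqrt (norm_nonneg _)]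
      have : 0 ≤ √z.im * √d := by positivity
      linarith
    have : √(z.im + d) - √z.im ≤ √d := by linarith
    gcongr
  rcases (norm_nonneg (z - w)).eq_or_lt with h0 | hdpos
  · have : z = w := by rw [← sub_eq_zero, ← norm_eq_zero, ← h0]
    subst this; simp; positivity
  rw [← hdd] at hdpos
  have hor : ‖G (z + d * Complex.I) - G (w + d * Complex.I)‖ ≤ C / √d * d := by
    let S : Set ℂ := {v | |v.re| < η ∧ d ≤ v.im ∧ v.im < 4 * η}
    have hS : Convex ℝ S := by
      have : S = Complex.reLm ⁻¹' (ball 0 η) ∩ Complex.imLm ⁻¹' (Ico d (4 * η)) := by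
        ext v; simp [S]
      rw [this]
      exact ((convex_ball 0 η).linear_preimage _).inter ((convex_Ico _ _).linear_preimage _)
    have := hS.norm_image_sub_le_of_norm_deriv_le (𝕜 := ℂ) (f := G) (C := C / √d)
      (fun v hv => hd v hv.1 (hdpos.trans_le hv.2.1) hv.2.2)
      (fun v hv => (hb v hv.1 (hdpos.trans_le hv.2.1) hv.2.2).trans (by
        have := Real.sqrt_le_sqrt hv.2.1
        have := Real.sqrt_pos.2 hdpos
        gcongr))
      (x := w + d * Complex.I) (y := z + d * Complex.I)
      ⟨by simpa using hw, by simp; linarith, by simp; linarith⟩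
      ⟨by simpa using hz, by simp; linarith, by simp; linarith⟩
    simpa [hdd] using this
  have h6 : C / √d * d = C * √d := by
    have := Real.sqrt_pos.2 hdpos
    rw [div_mul_eq_mul_div, div_eq_iff this.ne', mul_assoc, Real.mul_self_sqrt hdpos.le]
  have h1 := vert z hz hz0 hz1
  have h2 := vert w hw hw0 hw1
  rw [norm_sub_rev] at h1
  calc ‖G z - G w‖ = ‖(G z - G (z + d * Complex.I)) + (G (z + d * Complex.I) - G (w + d * Complex.I))
        + (G (w + d * Complex.I) - G w)‖ := by congr 1; ring
    _ ≤ _ := norm_add₃_le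
    _ ≤ 5 * C * √d := by linarith

/-- `HolAt k f x`: near `x` the function `f` is `k` times differentiable and its `k`-th derivative is
Hölder continuous of exponent `1/2`. -/
def HolAt : ℕ → (ℝ → ℝ) → ℝ → Prop
  | 0, f, x => ∃ C : ℝ, ∀ᶠ p : ℝ × ℝ in nhds (x, x), |f p.1 - f p.2| ≤ C * √|p.1 - p.2|
  | k + 1, f, x => (∀ᶠ y in nhds x, DifferentiableAt ℝ f y) ∧ HolAt k (deriv f) x

/-- Near `x` the function `f` is differentiable with bounded derivative. -/
def BddDerivAt (f : ℝ → ℝ) (x : ℝ) : Prop :=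
  ∃ M : ℝ, ∀ᶠ y in nhds x, DifferentiableAt ℝ f y ∧ |deriv f y| ≤ M

namespace HolAt

variable {k : ℕ} {f g : ℝ → ℝ} {x : ℝ}

lemma congr (hf : HolAt k f x) (h : f =ᶠ[nhds x] g) : HolAt k g x := by
  induction k generalizing f g with
  | zero =>
    obtain ⟨C, hC⟩ := hf
    refine ⟨C, ?_⟩
    filter_upwards [hC, h.prod_inl_nhds x, h.prod_inr_nhds x] with p h1 h2 h3
    rwa [← h2, ← h3]
  | succ k ih =>
    refine ⟨?_, ih hf.2 h.deriv⟩
    filter_upwards [hf.1, h.eventuallyEq_nhds] with y h1 h2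
    exact h1.congr_of_eventuallyEq h2.symm

lemma continuousAt (hf : HolAt k f x) : ContinuousAt f x := by
  cases k with
  | zero =>
    obtain ⟨C, hC⟩ := hf
    have h1 : ∀ᶠ y in nhds x, |f y - f x| ≤ C * √|y - x| := by
      have : Filter.Tendsto (fun y => (y, x)) (nhds x) (nhds (x, x)) :=
        (continuous_id.prodMk continuous_const).tendsto x
      exact this.eventually hC
    rw [ContinuousAt, tendsto_iff_norm_sub_tendsto_zero]
    have h2 : Filter.Tendsto (fun y => C * √|y - x|) (nhds x) (nhds 0) := by
      have : Continuous (fun y => C * √|y - x|) := by fun_prop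
      simpa using this.tendsto x
    exact squeeze_zero' (Filter.Eventually.of_forall fun _ => norm_nonneg _) h1 h2
  | succ k => exact hf.1.self_of_nhds.continuousAt

end HolAt

namespace BddDerivAt

variable {f : ℝ → ℝ} {x : ℝ}

lemma exists_lipschitz (hf : BddDerivAt f x) :
    ∃ M : ℝ, 0 < M ∧ ∀ᶠ p : ℝ × ℝ in nhds (x, x), |f p.1 - f p.2| ≤ M * |p.1 - p.2| := by
  obtain ⟨M, hM⟩ := hf
  obtain ⟨ε, hε, hb⟩ := Metric.eventually_nhds_iff_ball.1 hM
  refine ⟨max M 1, by positivity, ?_⟩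
  rw [nhds_prod_eq]
  filter_upwards [(ball_mem_nhds x hε |> fun h => Filter.prod_mem_prod h h)] with p hp
  exact (convex_ball x ε).norm_image_sub_le_of_norm_deriv_le (fun y hy => (hb y hy).1)
    (fun y hy => (hb y hy).2.trans (le_max_left _ _)) hp.2 hp.1

lemma tendsto_prod (hf : ContinuousAt f x) :
    Filter.Tendsto (fun p : ℝ × ℝ => (f p.1, f p.2)) (nhds (x, x)) (nhds (f x, f x)) := by
  rw [nhds_prod_eq, nhds_prod_eq]
  exact Filter.Tendsto.prodMap hf hf

lemma holAt (hf : BddDerivAt f x) : HolAt 0 f x := by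
  obtain ⟨M, hM0, hM⟩ := hf.exists_lipschitz
  refine ⟨M, ?_⟩
  have h1 : ∀ᶠ p : ℝ × ℝ in nhds (x, x), |p.1 - p.2| < 1 := by
    have : Continuous (fun p : ℝ × ℝ => |p.1 - p.2|) := by fun_prop
    exact (this.tendsto (x, x)).eventually (gt_mem_nhds (by simp))
  filter_upwards [hM, h1] with p h h1
  refine h.trans (mul_le_mul_of_nonneg_left ?_ hM0.le)
  apply Real.le_sqrt_of_sq_le
  nlinarith [abs_nonneg (p.1 - p.2)]

end BddDerivAt

namespace HolAt

variable {k : ℕ} {f g : ℝ → ℝ} {x : ℝ}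

lemma bddDerivAt (hf : HolAt (k + 1) f x) : BddDerivAt f x := by
  refine ⟨|deriv f x| + 1, hf.1.and ?_⟩
  exact (hf.2.continuousAt.abs.eventually (gt_mem_nhds (lt_add_one _))).mono fun _ h => h.le

lemma of_succ (hf : HolAt (k + 1) f x) : HolAt k f x := by
  induction k generalizing f with
  | zero => exact hf.bddDerivAt.holAt
  | succ k ih => exact ⟨hf.1, ih hf.2⟩

lemma of_le {l : ℕ} (hf : HolAt k f x) (h : l ≤ k) : HolAt l f x := by
  induction k, h using Nat.le_induction with
  | base => exact hf
  | succ n _ ih => exact ih hf.of_succ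

lemma const (k : ℕ) (c x : ℝ) : HolAt k (fun _ => c) x := by
  induction k generalizing c with
  | zero => exact ⟨0, by simp⟩
  | succ k ih =>
    refine ⟨by simp, ?_⟩
    simpa [deriv_const'] using ih 0

lemma id (k : ℕ) (x : ℝ) : HolAt k (fun t => t) x := by
  cases k with
  | zero => exact BddDerivAt.holAt ⟨1, by simp⟩
  | succ k =>
    refine ⟨by simp, ?_⟩
    have : deriv (fun t : ℝ => t) = fun _ => 1 := by ext; simp
    rw [this]; exact const k 1 x

lemma add (hf : HolAt k f x) (hg : HolAt k g x) : HolAt k (fun t => f t + g t) x := by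
  induction k generalizing f g with
  | zero =>
    obtain ⟨C, hC⟩ := hf
    obtain ⟨D, hD⟩ := hg
    refine ⟨C + D, ?_⟩
    filter_upwards [hC, hD] with p h1 h2
    calc _ = |(f p.1 - f p.2) + (g p.1 - g p.2)| := by congr 1; ring
      _ ≤ _ := (abs_add_le _ _).trans (by linarith)
  | succ k ih =>
    refine ⟨by filter_upwards [hf.1, hg.1] with y h1 h2 using h1.add h2, ?_⟩
    refine (ih hf.2 hg.2).congr ?_
    filter_upwards [hf.1, hg.1] with y h1 h2
    exact (deriv_fun_add h1 h2).symm

lemma mul (hf : HolAt k f x) (hg : HolAt k g x) : HolAt k (fun t => f t * g t) x := by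
  induction k generalizing f g with
  | zero =>
    have cf := hf.continuousAt
    have cg := hg.continuousAt
    obtain ⟨C, hC⟩ := hf
    obtain ⟨D, hD⟩ := hg
    refine ⟨(|f x| + 1) * D + C * (|g x| + 1), ?_⟩
    have bf : ∀ᶠ p : ℝ × ℝ in nhds (x, x), |f p.1| < |f x| + 1 :=
      (cf.abs.comp_of_eq continuousAt_fst rfl).eventually (gt_mem_nhds (lt_add_one _))
    have bg : ∀ᶠ p : ℝ × ℝ in nhds (x, x), |g p.2| < |g x| + 1 :=
      (cg.abs.comp_of_eq continuousAt_snd rfl).eventually (gt_mem_nhds (lt_add_one _))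
    filter_upwards [hC, hD, bf, bg] with p h1 h2 h3 h4
    calc _ = |f p.1 * (g p.1 - g p.2) + (f p.1 - f p.2) * g p.2| := by congr 1; ring
      _ ≤ |f p.1| * |g p.1 - g p.2| + |f p.1 - f p.2| * |g p.2| := by
        rw [← abs_mul, ← abs_mul]; exact abs_add_le _ _
      _ ≤ (|f x| + 1) * (D * √|p.1 - p.2|) + (C * √|p.1 - p.2|) * (|g x| + 1) := by
        gcongr
        exact (abs_nonneg _).trans h1
      _ = _ := by ring
  | succ k ih =>
    refine ⟨by filter_upwards [hf.1, hg.1] with y h1 h2 using h1.mul h2, ?_⟩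
    refine ((ih hf.2 hg.of_succ).add (ih hf.of_succ hg.2)).congr ?_
    filter_upwards [hf.1, hg.1] with y h1 h2
    exact (deriv_fun_mul h1 h2).symm

lemma const_mul (c : ℝ) (hf : HolAt k f x) : HolAt k (fun t => c * f t) x :=
  (const k c x).mul hf

lemma inv (hf : HolAt k f x) (h0 : f x ≠ 0) : HolAt k (fun t => (f t)⁻¹) x := by
  induction k with
  | zero =>
    have cf := hf.continuousAt
    obtain ⟨C, hC⟩ := hf
    have hfx : 0 < |f x| := abs_pos.2 h0
    refine ⟨C * (|f x| / 2)⁻¹ ^ 2, ?_⟩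
    have b1 : ∀ᶠ p : ℝ × ℝ in nhds (x, x), |f x| / 2 < |f p.1| :=
      (cf.abs.comp_of_eq continuousAt_fst rfl).eventually (lt_mem_nhds (half_lt_self hfx))
    have b2 : ∀ᶠ p : ℝ × ℝ in nhds (x, x), |f x| / 2 < |f p.2| :=
      (cf.abs.comp_of_eq continuousAt_snd rfl).eventually (lt_mem_nhds (half_lt_self hfx))
    filter_upwards [hC, b1, b2] with p h1 h2 h3
    have n1 : f p.1 ≠ 0 := abs_pos.1 (by linarith)
    have n2 : f p.2 ≠ 0 := abs_pos.1 (by linarith)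
    calc _ = |f p.1 - f p.2| * (|f p.1|⁻¹ * |f p.2|⁻¹) := by
          rw [inv_sub_inv n1 n2, abs_div, abs_mul, abs_sub_comm, div_eq_mul_inv, mul_inv]
      _ ≤ (C * √|p.1 - p.2|) * ((|f x| / 2)⁻¹ * (|f x| / 2)⁻¹) := by
        gcongr
        exact (abs_nonneg _).trans h1
      _ = _ := by ring
  | succ k ih =>
    have hne : ∀ᶠ y in nhds x, f y ≠ 0 := hf.continuousAt.eventually_ne h0
    refine ⟨by filter_upwards [hf.1, hne] with y h1 h2 using h1.inv h2, ?_⟩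
    have hi := ih hf.of_succ
    refine ((hf.2.mul (hi.mul hi)).const_mul (-1)).congr ?_
    filter_upwards [hf.1, hne] with y h1 h2
    rw [(h1.hasDerivAt.fun_inv h2).deriv]
    field_simp

lemma comp_bddDerivAt (hf : HolAt 0 f (g x)) (hg : BddDerivAt g x) :
    HolAt 0 (fun t => f (g t)) x := by
  obtain ⟨M, hM0, hM⟩ := hg.exists_lipschitz
  have cg := hg.holAt.continuousAt
  obtain ⟨C, hC⟩ := hf
  refine ⟨|C| * √M, ?_⟩
  filter_upwards [hM, (BddDerivAt.tendsto_prod cg).eventually hC] with p h1 h2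
  calc _ ≤ C * √|g p.1 - g p.2| := h2
    _ ≤ |C| * √(M * |p.1 - p.2|) := by gcongr; exact le_abs_self C
    _ = _ := by rw [Real.sqrt_mul hM0.le, mul_assoc]

lemma comp_succ (hf : HolAt k f (g x)) (hg : HolAt (k + 1) g x) : HolAt k (fun t => f (g t)) x := by
  induction k generalizing f with
  | zero => exact hf.comp_bddDerivAt hg.bddDerivAt
  | succ k ih =>
    have hfg := hg.continuousAt.eventually hf.1
    refine ⟨by filter_upwards [hfg, hg.1] with y h1 h2 using h1.comp y h2, ?_⟩
    refine ((ih hf.2 hg.of_succ).mul hg.2.of_succ).congr ?_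
    filter_upwards [hfg, hg.1] with y h1 h2
    exact (h1.hasDerivAt.comp y h2.hasDerivAt).deriv.symm

lemma comp (hf : HolAt (k + 1) f (g x)) (hg : HolAt (k + 1) g x) :
    HolAt (k + 1) (fun t => f (g t)) x := by
  have hfg := hg.continuousAt.eventually hf.1
  refine ⟨by filter_upwards [hfg, hg.1] with y h1 h2 using h1.comp y h2, ?_⟩
  refine ((hf.2.comp_succ hg).mul hg.2).congr ?_
  filter_upwards [hfg, hg.1] with y h1 h2
  exact (h1.hasDerivAt.comp y h2.hasDerivAt).deriv.symm

/-- Regularity of a local inverse `g` of `f`. -/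
lemma inverse (hf : HolAt (k + 1) f (g x))
    (hg : ∀ᶠ y in nhds x, HasDerivAt g (deriv f (g y))⁻¹ y) (h0 : deriv f (g x) ≠ 0) :
    HolAt (k + 1) g x := by
  have hcg : ContinuousAt g x := hg.self_of_nhds.continuousAt
  have hdg : ∀ᶠ y in nhds x, DifferentiableAt ℝ g y := hg.mono fun _ h => h.differentiableAt
  have heq : (fun y => (deriv f (g y))⁻¹) =ᶠ[nhds x] deriv g := hg.mono fun _ h => h.deriv.symm
  have hB : BddDerivAt g x := by
    have hc : ContinuousAt (fun y => (deriv f (g y))⁻¹) x :=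
      (hf.2.continuousAt.comp hcg).inv₀ h0
    have hc' : ContinuousAt (deriv g) x := hc.congr heq
    refine ⟨|deriv g x| + 1, hdg.and ?_⟩
    exact (hc'.abs.eventually (gt_mem_nhds (lt_add_one _))).mono fun _ h => h.le
  induction k with
  | zero => exact ⟨hdg, ((hf.2.comp_bddDerivAt hB).inv h0).congr heq⟩
  | succ k ih =>
    have h1 := ih hf.of_succ
    exact ⟨hdg, ((hf.2.comp h1).inv h0).congr heq⟩

lemma comp_add_const (c : ℝ) (hf : HolAt k f (x + c)) : HolAt k (fun t => f (t + c)) x :=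
  HolAt.comp_succ (g := fun t => t + c) hf ((HolAt.id _ x).add (HolAt.const _ c x))

lemma contDiffOn {s : Set ℝ} (hs : IsOpen s) (hf : ∀ y ∈ s, HolAt k f y) :
    ContDiffOn ℝ k f s := by
  induction k generalizing f with
  | zero =>
    rw [Nat.cast_zero, contDiffOn_zero]
    exact fun y hy => (hf y hy).continuousAt.continuousWithinAt
  | succ k ih =>
    rw [Nat.cast_add, Nat.cast_one, contDiffOn_succ_iff_deriv_of_isOpen hs]
    refine ⟨fun y hy => (hf y hy).1.self_of_nhds.differentiableWithinAt, by simp, ?_⟩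
    exact ih fun y hy => (hf y hy).2

end HolAt

/-- `H` is continuous on the closed half disc of radius `ρ` and holomorphic inside. -/
structure HalfDiscHolomorphic (H : ℂ → ℂ) (ρ : ℝ) : Prop where
  pos : 0 < ρ
  cont : ContinuousOn H (closedHalfDisc ρ)
  diff : DifferentiableOn ℂ H (openHalfDisc ρ)

lemma closedHalfDisc_mono {ρ ρ' : ℝ} (h : ρ' ≤ ρ) : closedHalfDisc ρ' ⊆ closedHalfDisc ρ :=
  fun _ hz => ⟨hz.1.trans h, hz.2⟩

lemma openHalfDisc_mono {ρ ρ' : ℝ} (h : ρ' ≤ ρ) : openHalfDisc ρ' ⊆ openHalfDisc ρ :=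
  fun _ hz => ⟨hz.1.trans_le h, hz.2⟩

lemma ofReal_mem_closedHalfDisc {ρ t : ℝ} (h : |t| ≤ ρ) : (t : ℂ) ∈ closedHalfDisc ρ :=
  ⟨by simpa using h, by simp⟩

lemma exists_forall_of_eventually_nhds_prod {P : ℝ × ℝ → Prop} {x : ℝ}
    (h : ∀ᶠ p in nhds (x, x), P p) :
    ∃ ε > 0, ∀ s t : ℝ, |s - x| < ε → |t - x| < ε → P (s, t) := by
  obtain ⟨ε, hε, hb⟩ := Metric.eventually_nhds_iff_ball.1 h
  refine ⟨ε, hε, fun s t hs ht => hb _ ?_⟩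
  rw [mem_ball, Prod.dist_eq]
  exact max_lt hs ht

namespace HalfDiscHolomorphic

variable {H : ℂ → ℂ} {ρ : ℝ}

lemma mono (h : HalfDiscHolomorphic H ρ) {ρ' : ℝ} (hρ' : 0 < ρ') (hle : ρ' ≤ ρ) :
    HalfDiscHolomorphic H ρ' :=
  ⟨hρ', h.cont.mono (closedHalfDisc_mono hle), h.diff.mono (openHalfDisc_mono hle)⟩

lemma differentiableAt (h : HalfDiscHolomorphic H ρ) {z : ℂ} (h1 : ‖z‖ < ρ) (h2 : 0 < z.im) :
    DifferentiableAt ℂ H z :=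
  h.diff.differentiableAt ((isOpen_openHalfDisc ρ).mem_nhds ⟨h1, h2⟩)

lemma exists_norm_le (h : HalfDiscHolomorphic H ρ) : ∃ M, ∀ z ∈ closedHalfDisc ρ, ‖H z‖ ≤ M := by
  have hc : IsCompact (closedHalfDisc ρ) := by
    refine (isCompact_closedBall (0 : ℂ) ρ).of_isClosed_subset (isClosed_closedHalfDisc ρ) ?_
    intro z hz
    simpa using hz.1
  exact hc.exists_bound_of_continuousOn h.cont

lemma exists_norm_deriv_le (h : HalfDiscHolomorphic H ρ)
    (hJ : HolAt 0 (fun t : ℝ => (H t).im) 0) :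
    ∃ r C : ℝ, 0 < r ∧ 0 < C ∧ 16 * r ≤ ρ ∧ ∀ z : ℂ, |z.re| < r → 0 < z.im → z.im < 4 * r →
      DifferentiableAt ℂ H z ∧ ‖deriv H z‖ ≤ C / √z.im := by
  obtain ⟨C₀, hC₀⟩ := hJ
  obtain ⟨ε, hε, hb⟩ := exists_forall_of_eventually_nhds_prod hC₀
  have hρ := h.pos
  set ρ' := min (ρ / 2) (ε / 2) with hρ'
  have hρ'0 : 0 < ρ' := by positivity
  have hρ'1 : ρ' ≤ ρ / 2 := min_le_left _ _
  have hρ'2 : ρ' ≤ ε / 2 := min_le_right _ _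
  have h' := h.mono hρ'0 (by linarith)
  obtain ⟨M, hM⟩ := h'.exists_norm_le
  set N := max (max C₀ (M / √ρ')) 1 with hN
  have hN0 : 0 < N := lt_max_of_lt_right one_pos
  have key := norm_deriv_le_of_holder_boundary hρ'0 hN0 h'.cont h'.diff ?_ ?_
  · refine ⟨ρ' / 16, Real.exp 2 * 32 * N, by positivity, by positivity, by linarith, ?_⟩
    intro z hz1 hz2 hz3
    refine ⟨h.differentiableAt ?_ hz2, key z (by linarith) hz2 (by linarith)⟩
    have := Complex.norm_le_abs_re_add_abs_im z
    rw [abs_of_pos hz2] at this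
    linarith
  · intro a t ha ht
    refine (hb t a ?_ ?_).trans ?_
    · rw [sub_zero]; linarith
    · rw [sub_zero]; linarith
    · exact mul_le_mul_of_nonneg_right ((le_max_left _ _).trans (le_max_left _ _)) (Real.sqrt_nonneg _)
  · intro z hz1 hz2
    calc |(H z).im| ≤ ‖H z‖ := Complex.abs_im_le_norm _
      _ ≤ M := hM z ⟨hz1.le, hz2⟩
      _ = M / √ρ' * √ρ' := by field_simp
      _ ≤ N * √ρ' := mul_le_mul_of_nonneg_right ((le_max_right _ _).trans (le_max_left _ _))
          (Real.sqrt_nonneg _)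

/-- The base case of Privalov's theorem. -/
lemma holAt_zero_re (h : HalfDiscHolomorphic H ρ) (hJ : HolAt 0 (fun t : ℝ => (H t).im) 0) :
    HolAt 0 (fun t : ℝ => (H t).re) 0 := by
  obtain ⟨r, C, hr, hC, hrρ, hb⟩ := h.exists_norm_deriv_le hJ
  have key := fun z w => norm_sub_le_of_norm_deriv_le_inv_sqrt (z := z) (w := w) hC.le
    (fun z h1 h2 h3 => (hb z h1 h2 h3).1) (fun z h1 h2 h3 => (hb z h1 h2 h3).2)
  have hlim : ∀ t : ℝ, |t| < r →
      Filter.Tendsto (fun y : ℝ => H (t + y * Complex.I)) (nhdsWithin 0 (Ioi 0)) (nhds (H t)) := by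
    intro t ht
    have h1 := h.cont t (ofReal_mem_closedHalfDisc (by linarith))
    refine Filter.Tendsto.comp (y := nhdsWithin (t : ℂ) (closedHalfDisc ρ)) h1 ?_
    refine tendsto_nhdsWithin_iff.2 ⟨?_, ?_⟩
    · have : Continuous (fun y : ℝ => (t + y * Complex.I : ℂ)) := by fun_prop
      have := (this.tendsto 0).mono_left (nhdsWithin_le_nhds (s := Ioi 0))
      simpa using this
    · filter_upwards [Ioo_mem_nhdsGT hr] with y hy
      have := Complex.norm_le_abs_re_add_abs_im (t + y * Complex.I : ℂ)
      simp [abs_of_pos hy.1] at this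
      refine ⟨by linarith [hy.2], by simpa using hy.1.le⟩
  refine ⟨5 * C, ?_⟩
  have hU : Ioo (-r) r ×ˢ Ioo (-r) r ∈ nhds ((0 : ℝ), (0 : ℝ)) :=
    prod_mem_nhds (Ioo_mem_nhds (by linarith) hr) (Ioo_mem_nhds (by linarith) hr)
  filter_upwards [hU] with p hp
  have hp1 : |p.1| < r := abs_lt.2 hp.1
  have hp2 : |p.2| < r := abs_lt.2 hp.2
  have h1 := ((hlim _ hp1).sub (hlim _ hp2)).norm
  have h2 : ‖H p.1 - H p.2‖ ≤ 5 * C * √|p.1 - p.2| := by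
    refine le_of_tendsto h1 ?_
    filter_upwards [Ioo_mem_nhdsGT hr] with y hy
    have := key (p.1 + y * Complex.I) (p.2 + y * Complex.I) (by simpa using hp1) (by simpa using hy.1)
      (by simpa using hy.2) (by simpa using hp2) (by simpa using hy.1) (by simpa using hy.2)
    rwa [add_sub_add_right_eq_sub, ← Complex.ofReal_sub, Complex.norm_real] at this
  refine le_trans ?_ h2
  rw [← Complex.sub_re]
  exact Complex.abs_re_le_norm _

end HalfDiscHolomorphic

namespace HalfDiscHolomorphic

variable {H : ℂ → ℂ} {ρ : ℝ}

/-- A Hölder bound for the difference quotients of the boundary values of `Im H`. -/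
lemma _root_.HolAt.exists_slope_holder {J : ℝ → ℝ} (hJ : HolAt 1 J 0) :
    ∃ ε M L : ℝ, 0 < ε ∧ 0 < M ∧ 0 < L ∧ ∀ δ, 0 < δ → δ < ε → ∀ s t : ℝ, |s| < ε → |t| < ε →
      |(J (s + δ) - J s) / δ| ≤ M ∧
      |(J (s + δ) - J s) / δ - (J (t + δ) - J t) / δ| ≤ L * √|s - t| := by
  obtain ⟨M, hM⟩ := hJ.bddDerivAt
  obtain ⟨L, hL⟩ := hJ.2
  obtain ⟨ε₁, h₁, hb₁⟩ := Metric.eventually_nhds_iff_ball.1 hM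
  obtain ⟨ε₂, h₂, hb₂⟩ := exists_forall_of_eventually_nhds_prod hL
  have slope : ∀ (f : ℝ → ℝ) (B s δ : ℝ), 0 < δ → (∀ y ∈ Icc s (s + δ), DifferentiableAt ℝ f y) →
      (∀ y ∈ Icc s (s + δ), |deriv f y| ≤ B) → |f (s + δ) - f s| ≤ B * δ := by
    intro f B s δ hδ hd hB
    have := (convex_Icc s (s + δ)).norm_image_sub_le_of_norm_deriv_le (f := f) (C := B) hd hB
      (left_mem_Icc.2 (by linarith)) (right_mem_Icc.2 (by linarith))
    simpa [abs_of_pos hδ] using this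
  set ε := min ε₁ ε₂ / 2 with hε
  have hε0 : 0 < ε := by positivity
  have hε1 : 2 * ε ≤ ε₁ := by rw [hε]; linarith [min_le_left ε₁ ε₂]
  have hε2 : 2 * ε ≤ ε₂ := by rw [hε]; linarith [min_le_right ε₁ ε₂]
  have hin : ∀ δ s y : ℝ, δ < ε → |s| < ε → y ∈ Icc s (s + δ) → |y| < 2 * ε := by
    intro δ s y hδ hs hy
    rw [abs_lt] at *
    constructor <;> linarith [hs.1, hs.2, hy.1, hy.2]
  refine ⟨ε, max M 1, max L 1, hε0, by positivity, by positivity, ?_⟩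
  intro δ hδ hδε s t hs ht
  constructor
  · rw [abs_div, abs_of_pos hδ, div_le_iff₀ hδ]
    refine slope J _ s δ hδ ?_ ?_
    · intro y hy
      have := hin δ s y hδε hs hy
      exact (hb₁ y (by rw [mem_ball_zero_iff]; exact this.trans_le hε1)).1
    · intro y hy
      have := hin δ s y hδε hs hy
      exact (hb₁ y (by rw [mem_ball_zero_iff]; exact this.trans_le hε1)).2.trans (le_max_left _ _)
  · rw [← sub_div, abs_div, abs_of_pos hδ, div_le_iff₀ hδ]
    have h := slope (fun y => J y - J (y + (t - s))) (max L 1 * √|s - t|) s δ hδ ?_ ?_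
    · have e : J (s + δ) - J s - (J (t + δ) - J t) =
        J (s + δ) - J (s + δ + (t - s)) - (J s - J (s + (t - s))) := by
        rw [show s + δ + (t - s) = t + δ by ring, show s + (t - s) = t by ring]; ring
      rw [e]; exact h
    · intro y hy
      have h1 := hin δ s y hδε hs hy
      have h2 := hin δ t (y + (t - s)) hδε ht ⟨by linarith [hy.1], by linarith [hy.2]⟩
      have h3 := (hb₁ y (by rw [mem_ball_zero_iff]; exact h1.trans_le hε1)).1
      have h4 := (hb₁ (y + (t - s)) (by rw [mem_ball_zero_iff]; exact h2.trans_le hε1)).1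
      exact h3.sub (differentiableAt_comp_add_const.2 h4)
    · intro y hy
      have h1 := hin δ s y hδε hs hy
      have h2 := hin δ t (y + (t - s)) hδε ht ⟨by linarith [hy.1], by linarith [hy.2]⟩
      have h3 := (hb₁ y (by rw [mem_ball_zero_iff]; exact h1.trans_le hε1)).1
      have h4 := (hb₁ (y + (t - s)) (by rw [mem_ball_zero_iff]; exact h2.trans_le hε1)).1
      have h5 := hb₂ y (y + (t - s)) (by rw [sub_zero]; linarith) (by rw [sub_zero]; linarith)
      have e : deriv (fun y => J y - J (y + (t - s))) y = deriv J y - deriv J (y + (t - s)) := by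
        rw [deriv_fun_sub h3 (differentiableAt_comp_add_const.2 h4), deriv_comp_add_const]
      rw [e]
      refine h5.trans ?_
      rw [show y - (y + (t - s)) = s - t by ring]
      exact mul_le_mul_of_nonneg_right (le_max_left _ _) (Real.sqrt_nonneg _)

/-- An interior bound for the derivative of `(z ^ 2 - ρ₂ ^ 2) H'`. -/
lemma exists_norm_deriv_mul_deriv_le (h : HalfDiscHolomorphic H ρ)
    (hJ : HolAt 1 (fun t : ℝ => (H t).im) 0) :
    ∃ r C : ℝ, 0 < r ∧ 0 ≤ C ∧ 2 * r < ρ ∧ ∀ z : ℂ, |z.re| < r / 4 → 0 < z.im → z.im ≤ r / 4 →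
      ‖deriv (fun z => (z ^ 2 - (r : ℂ) ^ 2) * deriv H z) z‖ ≤ C / √z.im := by
  obtain ⟨r₁, C₁, hr₁, hC₁, hrρ, hb⟩ := h.exists_norm_deriv_le (hJ.of_le (by norm_num))
  obtain ⟨ε, M, L, hε, hM, hL, hs⟩ := hJ.exists_slope_holder
  set r := min r₁ ε / 2 with hr
  have hr0 : 0 < r := by positivity
  have hr1 : 2 * r ≤ r₁ := by rw [hr]; linarith [min_le_left r₁ ε]
  have hr2 : 2 * r ≤ ε := by rw [hr]; linarith [min_le_right r₁ ε]
  set N := max (2 * r * √(2 * r) * M + r ^ 2 * L) (2 * r * C₁) with hN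
  have hN0 : 0 < N := lt_max_of_lt_right (by positivity)
  have hH : ∀ z : ℂ, ‖z‖ < 16 * r₁ → 0 < z.im → DifferentiableAt ℂ H z := fun z h1 h2 =>
    h.differentiableAt (h1.trans_le hrρ) h2
  have bound : ∀ δ : ℝ, 0 < δ → δ < r → ∀ z : ℂ, |z.re| ≤ r / 4 → 0 < z.im → z.im ≤ r / 4 →
      ‖deriv (fun z => (z ^ 2 - (r : ℂ) ^ 2) * ((H (z + δ) - H z) / δ)) z‖ ≤
        Real.exp 2 * 32 * N / √z.im := by
    intro δ hδ hδr
    have hadd : ∀ z : ℂ, ‖z‖ ≤ r → ‖z + δ‖ ≤ 2 * r := by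
      intro z hz
      calc ‖z + δ‖ ≤ ‖z‖ + ‖(δ : ℂ)‖ := norm_add_le _ _
        _ ≤ 2 * r := by rw [Complex.norm_real, Real.norm_eq_abs, abs_of_pos hδ]; linarith
    refine norm_deriv_le_of_holder_boundary hr0 hN0 ?_ ?_ ?_ ?_
    · refine ContinuousOn.mul (by fun_prop) (ContinuousOn.div_const (ContinuousOn.sub ?_ ?_) _)
      · refine h.cont.comp (by fun_prop) ?_
        intro z hz
        refine ⟨(hadd z hz.1).trans (by linarith), by simpa using hz.2⟩
      · exact h.cont.mono (closedHalfDisc_mono (by linarith))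
    · intro z hz
      have h1 := hH z (by linarith [hz.1]) hz.2
      have h2 := hH (z + δ) (by linarith [hadd z hz.1.le]) (by simpa using hz.2)
      have h3 : DifferentiableAt ℂ (fun z => H (z + δ)) z := differentiableAt_comp_add_const.2 h2
      exact (((by fun_prop : DifferentiableAt ℂ (fun z : ℂ => z ^ 2 - (r : ℂ) ^ 2) z)).mul
        ((h3.sub h1).div_const _)).differentiableWithinAt
    · intro a t ha ht
      have him : ∀ t : ℝ, (((t : ℂ) ^ 2 - (r : ℂ) ^ 2) * ((H (t + δ) - H t) / δ)).im =
          (t ^ 2 - r ^ 2) * (((H (t + δ : ℝ)).im - (H t).im) / δ) := by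
        intro t
        rw [show ((t : ℂ) ^ 2 - (r : ℂ) ^ 2) = ((t ^ 2 - r ^ 2 : ℝ) : ℂ) by push_cast; ring,
          Complex.im_ofReal_mul, Complex.div_ofReal_im]
        simp
      rw [him, him]
      have ha' : |a| ≤ r := by linarith
      obtain ⟨s1, s2⟩ := hs δ hδ (by linarith) t a (by linarith) (by linarith)
      set Dt := ((H (t + δ : ℝ)).im - (H t).im) / δ with hDt
      set Da := ((H (a + δ : ℝ)).im - (H a).im) / δ with hDa
      set q := √|t - a| with hq
      have hq0 : 0 ≤ q := Real.sqrt_nonneg _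
      have hqq : |t - a| = q * q := (Real.mul_self_sqrt (abs_nonneg _)).symm
      have hq1 : q ≤ √(2 * r) := Real.sqrt_le_sqrt ((abs_sub _ _).trans (by linarith))
      have e : (t ^ 2 - r ^ 2) * Dt - (a ^ 2 - r ^ 2) * Da =
        (t + a) * (t - a) * Dt + (a ^ 2 - r ^ 2) * (Dt - Da) := by ring
      have a1 : |t + a| ≤ 2 * r := (abs_add_le _ _).trans (by linarith)
      have a2 : |a ^ 2 - r ^ 2| ≤ r ^ 2 := by
        have : a ^ 2 ≤ r ^ 2 := by rw [← sq_abs a]; exact pow_le_pow_left₀ (abs_nonneg _) ha' 2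
        rw [abs_le]; constructor <;> nlinarith [sq_nonneg a]
      rw [e]
      calc _ ≤ |t + a| * |t - a| * |Dt| + |a ^ 2 - r ^ 2| * |Dt - Da| := by
            refine (abs_add_le _ _).trans ?_
            rw [abs_mul, abs_mul, abs_mul]
        _ ≤ (2 * r) * (√(2 * r) * q) * M + r ^ 2 * (L * q) := by
            rw [hqq]
            gcongr
        _ = (2 * r * √(2 * r) * M + r ^ 2 * L) * q := by ring
        _ ≤ N * q := mul_le_mul_of_nonneg_right (le_max_left _ _) hq0
    · intro z hz hz0
      refine (Complex.abs_im_le_norm _).trans ?_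
      have e : z ^ 2 - (r : ℂ) ^ 2 = z * (2 * Complex.I * z.im) := by
        have h1 : (r : ℂ) ^ 2 = z * (starRingEnd ℂ) z := by
          rw [Complex.mul_conj, Complex.normSq_eq_norm_sq, hz]; push_cast; ring
        have h2 : z - (starRingEnd ℂ) z = 2 * Complex.I * z.im := by
          rw [Complex.sub_conj]; push_cast; ring
        rw [h1, ← h2]; ring
      have e2 : ‖z ^ 2 - (r : ℂ) ^ 2‖ = 2 * r * z.im := by
        rw [e]; simp [hz, abs_of_nonneg hz0]; ring
      rw [norm_mul, e2]
      rcases hz0.eq_or_lt with h0 | h0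
      · rw [← h0]; simp; positivity
      have hder : ‖H (z + δ) - H z‖ ≤ C₁ / √z.im * δ := by
        have hseg : ∀ w ∈ segment ℝ z (z + δ), w.im = z.im ∧ |w.re| < r₁ := by
          intro w hw
          rw [segment_eq_image'] at hw
          obtain ⟨θ, hθ, rfl⟩ := hw
          have h1 : |z.re| ≤ r := (Complex.abs_re_le_norm z).trans hz.le
          have h2 : 0 ≤ θ * δ := mul_nonneg hθ.1 hδ.le
          have h3 : θ * δ ≤ δ := mul_le_of_le_one_left hδ.le hθ.2
          refine ⟨by simp, ?_⟩
          simp only [add_sub_cancel_left, Complex.add_re, Complex.real_smul, Complex.re_ofReal_mul,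
            Complex.ofReal_re]
          rw [abs_le] at h1
          rw [abs_lt]
          constructor <;> linarith [h1.1, h1.2]
        have hzi : z.im ≤ r := (le_abs_self _).trans ((Complex.abs_im_le_norm z).trans hz.le)
        have := (convex_segment z (z + δ)).norm_image_sub_le_of_norm_deriv_le (𝕜 := ℂ) (f := H)
          (C := C₁ / √z.im) (x := z) (y := z + δ) ?_ ?_ (left_mem_segment _ _ _)
          (right_mem_segment _ _ _)
        · simpa [abs_of_pos hδ] using this
        · intro w hw
          obtain ⟨h1, h2⟩ := hseg w hw
          exact (hb w h2 (by rwa [h1]) (by rw [h1]; linarith)).1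
        · intro w hw
          obtain ⟨h1, h2⟩ := hseg w hw
          have := (hb w h2 (by rwa [h1]) (by rw [h1]; linarith)).2
          rwa [h1] at this
      have hsq : z.im = √z.im * √z.im := (Real.mul_self_sqrt hz0).symm
      have hsq0 : 0 < √z.im := Real.sqrt_pos.2 h0
      calc 2 * r * z.im * ‖(H (z + δ) - H z) / δ‖ ≤ 2 * r * z.im * (C₁ / √z.im) := by
            rw [norm_div, Complex.norm_real, Real.norm_eq_abs, abs_of_pos hδ]
            refine mul_le_mul_of_nonneg_left ?_ (by positivity)
            rwa [div_le_iff₀ hδ]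
        _ = 2 * r * C₁ * √z.im := by
            nth_rewrite 1 [hsq]; field_simp
        _ ≤ N * √r := by
            refine mul_le_mul (le_max_right _ _) (Real.sqrt_le_sqrt ?_) hsq0.le hN0.le
            exact (le_abs_self _).trans ((Complex.abs_im_le_norm z).trans hz.le)
  refine ⟨r, Real.exp 2 * 32 * N, hr0, by positivity, by linarith, ?_⟩
  intro z hz1 hz2 hz3
  have hzn : ‖z‖ < r := by
    have := Complex.norm_le_abs_re_add_abs_im z
    rw [abs_of_pos hz2] at this
    linarith
  have hopen : IsOpen {w : ℂ | 0 < w.im ∧ ‖w‖ < 16 * r₁} :=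
    (isOpen_lt continuous_const Complex.continuous_im).inter (isOpen_lt continuous_norm continuous_const)
  have hdo : DifferentiableOn ℂ H {w : ℂ | 0 < w.im ∧ ‖w‖ < 16 * r₁} := fun w hw =>
    (hH w hw.2 hw.1).differentiableWithinAt
  have hz : z ∈ {w : ℂ | 0 < w.im ∧ ‖w‖ < 16 * r₁} := ⟨hz2, by linarith⟩
  have hd1 := hdo.deriv hopen
  have hd1z := hd1.differentiableAt (hopen.mem_nhds hz)
  have hdz := hdo.differentiableAt (hopen.mem_nhds hz)
  have hpoly : HasDerivAt (fun z : ℂ => z ^ 2 - (r : ℂ) ^ 2) (2 * z) z := by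
    simpa using (hasDerivAt_pow 2 z).sub_const ((r : ℂ) ^ 2)
  have hG : deriv (fun z => (z ^ 2 - (r : ℂ) ^ 2) * deriv H z) z =
      2 * z * deriv H z + (z ^ 2 - (r : ℂ) ^ 2) * deriv (deriv H) z :=
    (hpoly.mul hd1z.hasDerivAt).deriv
  have hslope : ∀ f : ℂ → ℂ, DifferentiableAt ℂ f z →
      Filter.Tendsto (fun δ : ℝ => (f (z + δ) - f z) / δ) (nhdsWithin 0 (Ioi 0)) (nhds (deriv f z)) := by
    intro f hf
    have h1 := hf.hasDerivAt.tendsto_slope_zero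
    have h2 : Filter.Tendsto (fun δ : ℝ => (δ : ℂ)) (nhdsWithin 0 (Ioi 0)) (nhdsWithin 0 {0}ᶜ) := by
      refine tendsto_nhdsWithin_iff.2 ⟨?_, ?_⟩
      · have := (Complex.continuous_ofReal.tendsto 0).mono_left (nhdsWithin_le_nhds (s := Ioi 0))
        simpa using this
      · filter_upwards [self_mem_nhdsWithin] with δ hδ
        simpa using (ne_of_gt hδ)
    refine (h1.comp h2).congr fun δ => ?_
    simp [div_eq_inv_mul]
  have htend := ((hslope H hdz).const_mul (2 * z)).add
    ((hslope (deriv H) hd1z).const_mul (z ^ 2 - (r : ℂ) ^ 2))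
  rw [hG]
  refine le_of_tendsto htend.norm ?_
  filter_upwards [Ioo_mem_nhdsGT hr0] with δ hδ
  have hzδ : z + δ ∈ {w : ℂ | 0 < w.im ∧ ‖w‖ < 16 * r₁} := by
    refine ⟨by simpa using hz2, ?_⟩
    have : ‖z + δ‖ ≤ ‖z‖ + ‖(δ : ℂ)‖ := norm_add_le _ _
    rw [Complex.norm_real, Real.norm_eq_abs, abs_of_pos hδ.1] at this
    linarith [hδ.2]
  have hdδ : HasDerivAt (fun z => H (z + δ)) (deriv H (z + δ)) z :=
    (hdo.differentiableAt (hopen.mem_nhds hzδ)).hasDerivAt.comp_add_const _ _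
  have := bound δ hδ.1 hδ.2 z hz1.le hz2 hz3
  have e : deriv (fun z => (z ^ 2 - (r : ℂ) ^ 2) * ((H (z + δ) - H z) / δ)) z =
      2 * z * ((H (z + δ) - H z) / δ) +
        (z ^ 2 - (r : ℂ) ^ 2) * ((deriv H (z + δ) - deriv H z) / δ) :=
    (hpoly.mul ((hdδ.sub hdz.hasDerivAt).div_const (δ : ℂ))).deriv
  rwa [e] at this

end HalfDiscHolomorphic

namespace HalfDiscHolomorphic

variable {H : ℂ → ℂ} {ρ : ℝ}

lemma _root_.convex_openHalfDisc (ρ : ℝ) : Convex ℝ (openHalfDisc ρ) := by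
  have h1 : openHalfDisc ρ = ball 0 ρ ∩ {z : ℂ | 0 < z.im} := by
    ext z; simp [openHalfDisc]
  rw [h1]
  exact (convex_ball _ _).inter (convex_halfSpace_im_gt 0)

/-- If `Im H` is `C^{1,1/2}` on the real line then `H'` extends continuously to it. -/
lemma exists_derivative (h : HalfDiscHolomorphic H ρ) (hJ : HolAt 1 (fun t : ℝ => (H t).im) 0) :
    ∃ (H₁ : ℂ → ℂ) (η : ℝ), HalfDiscHolomorphic H₁ η ∧
      ∀ t : ℝ, |t| < η → HasDerivAt (fun s : ℝ => H s) (H₁ t) t := by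
  obtain ⟨r, C, hr, hC, hrρ, hb⟩ := h.exists_norm_deriv_mul_deriv_le hJ
  set η := r / 16 with hη
  have hη0 : 0 < η := by positivity
  set B := openHalfDisc η with hB
  have hBo : IsOpen B := isOpen_openHalfDisc η
  have hcl : closure B = closedHalfDisc η :=
    (closure_openHalfDisc_subset η).antisymm (closedHalfDisc_subset_closure hη0)
  have hdo : DifferentiableOn ℂ H B := h.diff.mono (openHalfDisc_mono (by linarith))
  have hd1 : DifferentiableOn ℂ (deriv H) (openHalfDisc ρ) := h.diff.deriv (isOpen_openHalfDisc ρ)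
  set G := fun z => (z ^ 2 - (r : ℂ) ^ 2) * deriv H z with hG
  have hGd : ∀ z : ℂ, |z.re| < η → 0 < z.im → z.im < 4 * η → DifferentiableAt ℂ G z := by
    intro z h1 h2 h3
    have hz : z ∈ openHalfDisc ρ := by
      have := Complex.norm_le_abs_re_add_abs_im z
      rw [abs_of_pos h2] at this
      exact ⟨by linarith, h2⟩
    exact (by fun_prop : DifferentiableAt ℂ (fun z : ℂ => z ^ 2 - (r : ℂ) ^ 2) z).mul
      (hd1.differentiableAt ((isOpen_openHalfDisc ρ).mem_nhds hz))
  have hbox : ∀ z ∈ B, |z.re| < η ∧ 0 < z.im ∧ z.im < η := fun z hz =>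
    ⟨(Complex.abs_re_le_norm z).trans_lt hz.1, hz.2,
      (le_abs_self _).trans_lt ((Complex.abs_im_le_norm z).trans_lt hz.1)⟩
  have hhol : ∀ z ∈ B, ∀ w ∈ B, ‖G z - G w‖ ≤ 5 * C * √‖z - w‖ := by
    intro z hz w hw
    obtain ⟨z1, z2, z3⟩ := hbox z hz
    obtain ⟨w1, w2, w3⟩ := hbox w hw
    refine norm_sub_le_of_norm_deriv_le_inv_sqrt hC hGd ?_ z1 z2 z3 w1 w2 w3
    intro z h1 h2 h3
    exact hb z (by linarith) h2 (by linarith)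
  have huc : UniformContinuousOn G B := by
    rw [Metric.uniformContinuousOn_iff]
    intro ε hε
    refine ⟨(ε / (5 * C + 1)) ^ 2, by positivity, fun z hz w hw hzw => ?_⟩
    rw [dist_eq_norm] at *
    refine (hhol z hz w hw).trans_lt ?_
    have h1 : √‖z - w‖ < ε / (5 * C + 1) := by
      rw [Real.sqrt_lt' (by positivity)]; exact hzw
    calc 5 * C * √‖z - w‖ ≤ (5 * C + 1) * √‖z - w‖ := by
          have := Real.sqrt_nonneg ‖z - w‖; linarith
      _ < (5 * C + 1) * (ε / (5 * C + 1)) := mul_lt_mul_of_pos_left h1 (by positivity)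
      _ = ε := by field_simp
  have hlim : ∀ x ∈ closedHalfDisc η, ∃ y, Filter.Tendsto (deriv H) (nhdsWithin x B) (nhds y) := by
    intro x hx
    have hne : (nhdsWithin x B).NeBot := mem_closure_iff_nhdsWithin_neBot.1 (by rwa [hcl])
    have hca : Cauchy (Filter.map G (nhdsWithin x B)) :=
      (cauchy_nhds.mono nhdsWithin_le_nhds).map_of_le huc
        (Filter.le_principal_iff.2 self_mem_nhdsWithin)
    obtain ⟨y, hy⟩ := CompleteSpace.complete hca
    have hne0 : ∀ z : ℂ, ‖z‖ ≤ η → z ^ 2 - (r : ℂ) ^ 2 ≠ 0 := by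
      intro z hz h0
      have h1 : ‖z‖ ^ 2 = r ^ 2 := by
        rw [← norm_pow, sub_eq_zero.1 h0, norm_pow, Complex.norm_real, Real.norm_eq_abs, sq_abs]
      nlinarith [norm_nonneg z]
    have hc : ContinuousAt (fun z : ℂ => (z ^ 2 - (r : ℂ) ^ 2)⁻¹) x :=
      ContinuousAt.inv₀ (by fun_prop) (hne0 x hx.1)
    refine ⟨(x ^ 2 - (r : ℂ) ^ 2)⁻¹ * y, ?_⟩
    refine ((hc.mono_left nhdsWithin_le_nhds).mul hy).congr' ?_
    filter_upwards [self_mem_nhdsWithin] with z hz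
    rw [hG]
    exact inv_mul_cancel_left₀ (hne0 z hz.1.le) _
  have hH₁ : ∀ z ∈ B, extendFrom B (deriv H) z = deriv H z := by
    intro z hz
    refine extendFrom_eq (subset_closure hz) ?_
    exact (hd1.differentiableAt ((isOpen_openHalfDisc ρ).mem_nhds
      (openHalfDisc_mono (by linarith) hz))).continuousAt.mono_left nhdsWithin_le_nhds
  refine ⟨extendFrom B (deriv H), η, ⟨hη0, ?_, ?_⟩, ?_⟩
  · exact continuousOn_extendFrom hcl.ge hlim
  · exact (hd1.mono (openHalfDisc_mono (by linarith))).congr hH₁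
  · intro t ht
    have htm : (t : ℂ) ∈ closedHalfDisc η := ofReal_mem_closedHalfDisc ht.le
    have h1 : Filter.Tendsto (deriv H) (nhdsWithin (t : ℂ) B) (nhds (extendFrom B (deriv H) t)) :=
      tendsto_extendFrom (hlim t htm)
    have hfd : ∀ z ∈ B, HasFDerivAt H (deriv H z • (1 : ℂ →L[ℝ] ℂ)) z := fun z hz =>
      (hdo.differentiableAt (hBo.mem_nhds hz)).hasDerivAt.complexToReal_fderiv
    have h2 : HasFDerivWithinAt H (extendFrom B (deriv H) t • (1 : ℂ →L[ℝ] ℂ)) (closure B) t := by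
      refine hasFDerivWithinAt_closure_of_tendsto_fderiv
        (fun z hz => (hfd z hz).differentiableAt.differentiableWithinAt)
        (convex_openHalfDisc η) hBo ?_ ?_
      · intro y hy
        rw [hcl] at hy
        exact (h.cont y (closedHalfDisc_mono (by linarith) hy)).mono
          ((openHalfDisc_mono (by linarith)).trans (openHalfDisc_subset ρ))
      · refine Filter.Tendsto.congr' ?_ (h1.smul_const (1 : ℂ →L[ℝ] ℂ))
        filter_upwards [self_mem_nhdsWithin] with z hz
        exact (hfd z hz).fderiv.symm
    have h3 : HasDerivWithinAt (fun s : ℝ => (s : ℂ)) 1 (Ioo (-η) η) t :=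
      (Complex.ofRealCLM.hasDerivAt (x := t)).hasDerivWithinAt
    have h4 := h2.comp_hasDerivWithinAt t h3 (fun s hs => by
      rw [hcl]; exact ofReal_mem_closedHalfDisc (abs_lt.2 hs).le)
    have h5 := h4.hasDerivAt (Ioo_mem_nhds (abs_lt.1 ht).1 (abs_lt.1 ht).2)
    simp only [smul_apply, one_apply_eq_self, smul_eq_mul,
      mul_one] at h5
    exact h5

/-- Privalov's theorem: regularity of the imaginary part on the real line gives regularity of the
real part. -/
theorem holAt_re {k : ℕ} (h : HalfDiscHolomorphic H ρ)
    (hJ : HolAt k (fun t : ℝ => (H t).im) 0) : HolAt k (fun t : ℝ => (H t).re) 0 := by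
  induction k generalizing H ρ with
  | zero => exact h.holAt_zero_re hJ
  | succ k ih =>
    obtain ⟨H₁, η, h₁, hder⟩ := h.exists_derivative (hJ.of_le (by omega))
    have hre : ∀ t : ℝ, |t| < η → HasDerivAt (fun s : ℝ => (H s).re) (H₁ t).re t := fun t ht =>
      (Complex.reCLM.hasFDerivAt.comp_hasDerivAt t (hder t ht))
    have him : ∀ t : ℝ, |t| < η → HasDerivAt (fun s : ℝ => (H s).im) (H₁ t).im t := fun t ht =>
      (Complex.imCLM.hasFDerivAt.comp_hasDerivAt t (hder t ht))
    have hev : ∀ᶠ t : ℝ in nhds 0, |t| < η := by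
      filter_upwards [ball_mem_nhds (0 : ℝ) h₁.pos] with t ht
      simpa using ht
    have hJ₁ : HolAt k (fun t : ℝ => (H₁ t).im) 0 := by
      refine hJ.2.congr ?_
      filter_upwards [hev] with t ht
      exact (him t ht).deriv
    refine ⟨?_, (ih h₁ hJ₁).congr ?_⟩
    · filter_upwards [hev] with t ht
      exact (hre t ht).differentiableAt
    · filter_upwards [hev] with t ht
      exact (hre t ht).deriv.symm

end HalfDiscHolomorphic

/-- Orthonormal frames of the plane. -/
abbrev Frame : Type := OrthonormalBasis (Fin 2) ℝ E2

namespace Frame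

lemma exists_snd_eq {v : E2} (hv : ‖v‖ = 1) : ∃ e : Frame, e 1 = v := by
  obtain ⟨b, hb⟩ := Orthonormal.exists_orthonormalBasis_extension_of_card_eq (𝕜 := ℝ) (E := E2)
    (ι := Fin 2) (by simp) (v := fun _ => v) (s := {1}) (by
      constructor
      · intro i; simpa using hv
      · intro i j hij
        exact absurd (Subsingleton.elim i j) hij)
  exact ⟨b, hb 1 rfl⟩

lemma exists_fst_eq {v : E2} (hv : ‖v‖ = 1) : ∃ e : Frame, e 0 = v := by
  obtain ⟨b, hb⟩ := exists_snd_eq hv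
  exact ⟨b.reindex (Equiv.swap 0 1), by simpa using hb⟩

lemma exists_eq {v w : E2} (hv : ‖v‖ = 1) (hw : ‖w‖ = 1) (hvw : ⟪v, w⟫ = 0) :
    ∃ e : Frame, e 0 = v ∧ e 1 = w := by
  have ho : Orthonormal ℝ ![v, w] := by
    rw [orthonormal_iff_ite]
    intro i j
    have := real_inner_comm v w
    fin_cases i <;> fin_cases j <;> (simp [hv, hw, hvw]; try linarith)
  obtain ⟨b, hb⟩ := Orthonormal.exists_orthonormalBasis_extension_of_card_eq (𝕜 := ℝ) (E := E2)
    (ι := Fin 2) (by simp) (v := ![v, w]) (s := univ) (ho.comp _ Subtype.val_injective)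
  exact ⟨b, hb 0 trivial, hb 1 trivial⟩

lemma exists_neg_snd (e : Frame) : ∃ e' : Frame, e' 0 = e 0 ∧ e' 1 = -e 1 :=
  exists_eq (by simp) (by simp) (by simp)

variable (e : Frame)

@[simp] lemma inner_fst_fst : ⟪e 0, e 0⟫ = 1 := by simp
@[simp] lemma inner_snd_snd : ⟪e 1, e 1⟫ = 1 := by simp
@[simp] lemma inner_fst_snd : ⟪e 0, e 1⟫ = 0 := by simp
@[simp] lemma inner_snd_fst : ⟪e 1, e 0⟫ = 0 := by simp

lemma inner_eq (x y : E2) : ⟪x, y⟫ = ⟪e 0, x⟫ * ⟪e 0, y⟫ + ⟪e 1, x⟫ * ⟪e 1, y⟫ := by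
  have := e.sum_inner_mul_inner x y
  rw [Fin.sum_univ_two, real_inner_comm (e 0) x, real_inner_comm (e 1) x] at this
  exact this.symm

lemma eq_smul_add_smul (x : E2) : x = ⟪e 0, x⟫ • e 0 + ⟪e 1, x⟫ • e 1 := by
  have := e.sum_repr' x
  rw [Fin.sum_univ_two] at this
  exact this.symm

lemma ext_inner {x y : E2} (h0 : ⟪e 0, x⟫ = ⟪e 0, y⟫) (h1 : ⟪e 1, x⟫ = ⟪e 1, y⟫) : x = y := by
  rw [e.eq_smul_add_smul x, e.eq_smul_add_smul y, h0, h1]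

lemma norm_sq_eq (x : E2) : ‖x‖ ^ 2 = ⟪e 0, x⟫ ^ 2 + ⟪e 1, x⟫ ^ 2 := by
  rw [← real_inner_self_eq_norm_sq, e.inner_eq]; ring

lemma norm_le_add_abs (x : E2) : ‖x‖ ≤ |⟪e 0, x⟫| + |⟪e 1, x⟫| := by
  refine abs_le_of_sq_le_sq' ?_ (by positivity) |>.2
  rw [e.norm_sq_eq, ← sq_abs ⟪e 0, x⟫, ← sq_abs ⟪e 1, x⟫]
  nlinarith [abs_nonneg ⟪e 0, x⟫, abs_nonneg ⟪e 1, x⟫]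

lemma abs_inner_le (i : Fin 2) (x : E2) : |⟪e i, x⟫| ≤ ‖x‖ := by
  simpa using abs_real_inner_le_norm (e i) x

/-- Coordinates of a point in a frame. -/
def coord (x : E2) : ℝ × ℝ := (⟪e 0, x⟫, ⟪e 1, x⟫)

lemma measurePreserving_coord : MeasurePreserving e.coord := by
  have h := ((volume_preserving_finTwoArrow ℝ).comp
    (PiLp.volume_preserving_ofLp (Fin 2))).comp e.measurePreserving_repr
  have hc : e.coord = (MeasurableEquiv.finTwoArrow ∘ WithLp.ofLp) ∘ e.repr := by
    funext x
    simp [coord, MeasurableEquiv.finTwoArrow, e.repr_apply_apply]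
  rw [hc]
  exact h

lemma continuous_coord : Continuous e.coord := by unfold coord; fun_prop

lemma volume_coord_preimage {S : Set (ℝ × ℝ)} (hS : MeasurableSet S) :
    volume (e.coord ⁻¹' S) = volume S :=
  e.measurePreserving_coord.measure_preimage hS.nullMeasurableSet

lemma volume_box {X₀ : E2} {a b c d : ℝ} :
    volume {X : E2 | ⟪e 0, X - X₀⟫ ∈ Icc a b ∧ ⟪e 1, X - X₀⟫ ∈ Icc c d} =
      ENNReal.ofReal (b - a) * ENNReal.ofReal (d - c) := by
  have h : {X : E2 | ⟪e 0, X - X₀⟫ ∈ Icc a b ∧ ⟪e 1, X - X₀⟫ ∈ Icc c d} =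
      (fun X => X - X₀) ⁻¹' (e.coord ⁻¹' (Icc a b ×ˢ Icc c d)) := by
    rfl
  rw [h, measurePreserving_sub_right volume X₀ |>.measure_preimage ((e.continuous_coord.measurable (by measurability)).nullMeasurableSet), e.volume_coord_preimage (by measurability),
    Measure.volume_eq_prod, Measure.prod_prod, Real.volume_Icc, Real.volume_Icc]

lemma isCompact_box {X₀ : E2} {a b c d : ℝ} :
    IsCompact {X : E2 | ⟪e 0, X - X₀⟫ ∈ Icc a b ∧ ⟪e 1, X - X₀⟫ ∈ Icc c d} := by
  refine Metric.isCompact_of_isClosed_isBounded ?_ ?_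
  · exact (isClosed_Icc.preimage (by fun_prop)).inter (isClosed_Icc.preimage (by fun_prop))
  · refine (Metric.isBounded_closedBall (x := X₀) (r := max |a| |b| + max |c| |d|)).subset ?_
    intro X hX
    rw [mem_closedBall, dist_eq_norm]
    refine (e.norm_le_add_abs _).trans (add_le_add ?_ ?_)
    · exact abs_le_max_abs_abs hX.1.1 hX.1.2
    · exact abs_le_max_abs_abs hX.2.1 hX.2.2

end Frame

/-- A monotone, closed, bounded relation between points of the plane cannot relate one point to a
segment with the measure of thin boxes along the segment not being decreased (Alexandrov). -/
lemma false_of_volume_box_le {Γ : Set (E2 × E2)} {R : ℝ}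
    (hmono : ∀ q ∈ Γ, ∀ q' ∈ Γ, 0 ≤ ⟪q.1 - q'.1, q.2 - q'.2⟫) (hclosed : IsClosed Γ)
    (hbdd : ∀ q ∈ Γ, ‖q.2‖ ≤ R) (e : Frame) {X₀ p₀ : E2} {ℓ : ℝ} (hℓ : 0 < ℓ)
    (hp₀ : ∀ s : ℝ, |s| ≤ ℓ → (X₀ + s • e 0, p₀) ∈ Γ)
    (hshare : ∀ (p : E2) (s s' : ℝ), |s| ≤ ℓ → |s'| ≤ ℓ → (X₀ + s • e 0, p) ∈ Γ →
      ⟪e 0, p - p₀⟫ = 0 → (X₀ + s' • e 0, p) ∈ Γ)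
    {h₀ : ℝ} (hh₀ : 0 < h₀)
    (hvol : ∀ h, 0 < h → h < h₀ →
      volume {X : E2 | ⟪e 0, X - X₀⟫ ∈ Icc (-(ℓ / 2)) (ℓ / 2) ∧ ⟪e 1, X - X₀⟫ ∈ Icc (h / 2) h} ≤
      volume {p : E2 | ∃ X : E2, (⟪e 0, X - X₀⟫ ∈ Icc (-(ℓ / 2)) (ℓ / 2) ∧
        ⟪e 1, X - X₀⟫ ∈ Icc (h / 2) h) ∧ (X, p) ∈ Γ}) : False := by
  have hR : 0 ≤ R := (norm_nonneg _).trans (hbdd (X₀ + (0 : ℝ) • e 0, p₀) (hp₀ 0 (by simpa using hℓ.le)))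
  -- the points shared by the segment
  let Sh : Set E2 := {p | ∀ s : ℝ, |s| ≤ ℓ → (X₀ + s • e 0, p) ∈ Γ}
  have hShc : IsCompact Sh := by
    refine Metric.isCompact_of_isClosed_isBounded ?_ ?_
    · have : Sh = ⋂ (s : ℝ) (_ : |s| ≤ ℓ), (fun p => (X₀ + s • e 0, p)) ⁻¹' Γ := by
        ext p; simp [Sh]
      rw [this]
      refine isClosed_iInter fun s => isClosed_iInter fun _ => ?_
      exact hclosed.preimage (continuous_const.prodMk continuous_id)
    · refine (Metric.isBounded_closedBall (x := (0 : E2)) (r := R)).subset fun p hp => ?_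
      rw [mem_closedBall_zero_iff]
      exact hbdd (X₀ + (0 : ℝ) • e 0, p) (hp 0 (by simpa using hℓ.le))
  obtain ⟨p₁, hp₁, hmax⟩ := hShc.exists_isMaxOn ⟨p₀, hp₀⟩
    (f := fun p => ⟪e 1, p⟫) (continuous_const.inner continuous_id).continuousOn
  -- the monotonicity of the relation
  have hm : ∀ X p q : E2, (X, p) ∈ Γ → q ∈ Sh → |⟪e 0, X - X₀⟫| ≤ ℓ / 2 →
      |⟪e 0, p - q⟫| * (ℓ / 2) ≤ ⟪e 1, X - X₀⟫ * ⟪e 1, p - q⟫ := by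
    intro X p q hX hq hs
    have key : ∀ σ : ℝ, |σ| ≤ ℓ / 2 → 0 ≤ σ * ⟪e 0, p - q⟫ + ⟪e 1, X - X₀⟫ * ⟪e 1, p - q⟫ := by
      intro σ hσ
      have := hmono _ hX _ (hq (⟪e 0, X - X₀⟫ - σ) ((abs_sub _ _).trans (by linarith)))
      simp only at this
      rw [e.inner_eq] at this
      simp only [inner_sub_right, inner_add_right, inner_smul_right, e.inner_fst_fst,
        e.inner_snd_fst] at this ⊢
      linarith
    rcases abs_cases ⟪e 0, p - q⟫ with ⟨h1, _⟩ | ⟨h1, _⟩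
    · have := key (-(ℓ / 2)) (by rw [abs_neg, abs_of_pos (by linarith)])
      rw [h1]; linarith
    · have := key (ℓ / 2) (by rw [abs_of_pos (by linarith)])
      rw [h1]; linarith
  -- image points are close to `p₁`
  set ω := ℓ / 8 with hω
  have hω0 : 0 < ω := by positivity
  have hclose : ∃ h, 0 < h ∧ h < h₀ ∧ ∀ X p : E2, (X, p) ∈ Γ → |⟪e 0, X - X₀⟫| ≤ ℓ / 2 →
      ⟪e 1, X - X₀⟫ ∈ Icc (h / 2) h → ⟪e 1, p - p₁⟫ ≤ ω := by
    by_contra! hcon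
    have hseq : ∀ n : ℕ, ∃ Xp : E2 × E2, Xp ∈ Γ ∧ |⟪e 0, Xp.1 - X₀⟫| ≤ ℓ / 2 ∧
        ⟪e 1, Xp.1 - X₀⟫ ∈ Icc 0 (h₀ / (n + 2)) ∧ ω < ⟪e 1, Xp.2 - p₁⟫ := by
      intro n
      have hn : (0 : ℝ) < n + 2 := by positivity
      obtain ⟨X, p, h1, h2, h3, h4⟩ := hcon (h₀ / (n + 2)) (by positivity)
        (div_lt_self hh₀ (by have : (0 : ℝ) ≤ n := Nat.cast_nonneg n
                             linarith))
      have : (0 : ℝ) ≤ h₀ / (n + 2) / 2 := by positivity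
      exact ⟨(X, p), h1, h2, ⟨this.trans h3.1, h3.2⟩, h4⟩
    choose Z hZΓ hZ0 hZ1 hZω using hseq
    have hcpt : IsCompact ({X : E2 | ⟪e 0, X - X₀⟫ ∈ Icc (-(ℓ / 2)) (ℓ / 2) ∧
        ⟪e 1, X - X₀⟫ ∈ Icc 0 h₀} ×ˢ closedBall (0 : E2) R) :=
      e.isCompact_box.prod (isCompact_closedBall _ _)
    obtain ⟨⟨X, p⟩, -, φ, hφ, hlim⟩ := hcpt.tendsto_subseq (x := Z) (fun n => by
      refine ⟨⟨abs_le.1 (hZ0 n), (hZ1 n).1, (hZ1 n).2.trans ?_⟩, ?_⟩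
      · exact div_le_self hh₀.le (by have : (0 : ℝ) ≤ n := Nat.cast_nonneg n
                                     linarith)
      · rw [mem_closedBall_zero_iff]; exact hbdd (Z n) (hZΓ n))
    have hXp : (X, p) ∈ Γ := hclosed.mem_of_tendsto hlim (Filter.Eventually.of_forall fun n => hZΓ _)
    have hlX : Filter.Tendsto (fun n => (Z (φ n)).1) Filter.atTop (nhds X) :=
      (continuous_fst.tendsto _).comp hlim
    have hlp : Filter.Tendsto (fun n => (Z (φ n)).2) Filter.atTop (nhds p) :=
      (continuous_snd.tendsto _).comp hlim
    have hX0 : |⟪e 0, X - X₀⟫| ≤ ℓ / 2 := by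
      have hc : Continuous fun X : E2 => |⟪e 0, X - X₀⟫| := by fun_prop
      exact le_of_tendsto ((hc.tendsto X).comp hlX) (Filter.Eventually.of_forall fun n => hZ0 _)
    have hc1 : Continuous fun X : E2 => ⟪e 1, X - X₀⟫ := by fun_prop
    have hX1 : ⟪e 1, X - X₀⟫ = 0 := by
      have h1 := (hc1.tendsto X).comp hlX
      refine tendsto_nhds_unique h1 ?_
      have h2 : Filter.Tendsto (fun n : ℕ => h₀ / ((n : ℝ) + 2)) Filter.atTop (nhds 0) :=
        tendsto_const_nhds.div_atTop
          (Filter.tendsto_atTop_add_const_right _ _ tendsto_natCast_atTop_atTop)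
      exact squeeze_zero (fun n => (hZ1 _).1) (fun n => (hZ1 _).2) (h2.comp hφ.tendsto_atTop)
    have hXe : X = X₀ + ⟪e 0, X - X₀⟫ • e 0 := by
      have := e.eq_smul_add_smul (X - X₀)
      rw [hX1, zero_smul, add_zero] at this
      rw [← this]; abel
    have hp0 : ⟪e 0, p - p₀⟫ = 0 := by
      have := hm X p p₀ hXp hp₀ hX0
      rw [hX1, zero_mul] at this
      have h2 : |⟪e 0, p - p₀⟫| ≤ 0 := by
        by_contra! h3
        have := mul_pos h3 (by linarith : 0 < ℓ / 2)
        linarith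
      exact abs_nonpos_iff.1 h2
    have hpSh : p ∈ Sh := fun s hs =>
      hshare p ⟪e 0, X - X₀⟫ s (hX0.trans (by linarith)) hs (hXe ▸ hXp) hp0
    have h5 : ω ≤ ⟪e 1, p - p₁⟫ := by
      have hc : Continuous fun p : E2 => ⟪e 1, p - p₁⟫ := by fun_prop
      exact ge_of_tendsto ((hc.tendsto p).comp hlp) (Filter.Eventually.of_forall fun n => (hZω _).le)
    have h6 : ⟪e 1, p⟫ ≤ ⟪e 1, p₁⟫ := hmax hpSh
    rw [inner_sub_right] at h5
    linarith
  obtain ⟨h, hh, hhh, hcl⟩ := hclose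
  have hsub : {p : E2 | ∃ X : E2, (⟪e 0, X - X₀⟫ ∈ Icc (-(ℓ / 2)) (ℓ / 2) ∧
      ⟪e 1, X - X₀⟫ ∈ Icc (h / 2) h) ∧ (X, p) ∈ Γ} ⊆
      {p : E2 | ⟪e 0, p - p₁⟫ ∈ Icc (-(h / 4)) (h / 4) ∧ ⟪e 1, p - p₁⟫ ∈ Icc 0 ω} := by
    rintro p ⟨X, ⟨hX0, hX1⟩, hXp⟩
    have hX0' := abs_le.2 hX0
    have h1 := hm X p p₁ hXp hp₁ hX0'
    have h2 := hcl X p hXp hX0' hX1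
    have hX1p : 0 < ⟪e 1, X - X₀⟫ := by linarith [hX1.1]
    have h3 : 0 ≤ ⟪e 1, p - p₁⟫ := by
      by_contra! h3
      have := mul_neg_of_pos_of_neg hX1p h3
      have := mul_nonneg (abs_nonneg ⟪e 0, p - p₁⟫) (by linarith : 0 ≤ ℓ / 2)
      linarith
    refine ⟨abs_le.1 ?_, h3, h2⟩
    have h4 : ⟪e 1, X - X₀⟫ * ⟪e 1, p - p₁⟫ ≤ h * ω := mul_le_mul hX1.2 h2 h3 hh.le
    have h5 : |⟪e 0, p - p₁⟫| * (ℓ / 2) ≤ h / 4 * (ℓ / 2) := by rw [hω] at h4; linarith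
    exact le_of_mul_le_mul_right h5 (by linarith)
  have hfin := (hvol h hh hhh).trans (measure_mono hsub)
  rw [e.volume_box, e.volume_box, ← ENNReal.ofReal_mul (by linarith), ← ENNReal.ofReal_mul (by linarith),
    ENNReal.ofReal_le_ofReal_iff (mul_nonneg (by linarith) (by linarith))] at hfin
  rw [hω] at hfin
  have := mul_pos hh hℓ
  linarith

section Subdifferential

variable {u : E2 → ℝ} {K : ℝ≥0}

lemma norm_le_of_mem_subdiff (hu : LipschitzWith K u) {x p : E2} (hp : p ∈ subdiff u x) :
    ‖p‖ ≤ K := by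
  have h1 := hp (x + p)
  have h2 := hu.dist_le_mul (x + p) x
  rw [Real.dist_eq, dist_eq_norm, add_sub_cancel_left] at h2
  rw [add_sub_cancel_left, real_inner_self_eq_norm_sq] at h1
  have h3 := le_abs_self (u (x + p) - u x)
  by_contra! h
  have : 0 < ‖p‖ := K.coe_nonneg.trans_lt h
  nlinarith

lemma subdiff_monotone {x y p q : E2} (hp : p ∈ subdiff u x) (hq : q ∈ subdiff u y) :
    0 ≤ ⟪x - y, p - q⟫ := by
  have h1 := hp y
  have h2 := hq x
  rw [inner_sub_right, real_inner_comm p (x - y), real_inner_comm q (x - y)]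
  rw [← neg_sub x y, inner_neg_right] at h1
  linarith

lemma isClosed_graph_subdiff (hu : Continuous u) : IsClosed {q : E2 × E2 | q.2 ∈ subdiff u q.1} := by
  have : {q : E2 × E2 | q.2 ∈ subdiff u q.1} =
      ⋂ z : E2, {q : E2 × E2 | u q.1 + ⟪q.2, z - q.1⟫ ≤ u z} := by
    ext q; simp [subdiff]
  rw [this]
  refine isClosed_iInter fun z => isClosed_le ?_ continuous_const
  exact (hu.comp continuous_fst).add (continuous_snd.inner (continuous_const.sub continuous_fst))

lemma convex_subdiff (x : E2) : Convex ℝ (subdiff u x) := by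
  intro p hp q hq a b ha hb hab z
  have h1 := mul_le_mul_of_nonneg_left (hp z) ha
  have h2 := mul_le_mul_of_nonneg_left (hq z) hb
  rw [inner_add_left, real_inner_smul_left, real_inner_smul_left]
  have h3 : u x = a * u x + b * u x := by rw [← add_mul, hab, one_mul]
  have h4 : u z = a * u z + b * u z := by rw [← add_mul, hab, one_mul]
  rw [h3, h4]; linarith

/-- If two points share a subgradient `p` then `u` is affine with slope `p` between them. -/
lemma mem_subdiff_of_eq {x y p : E2} (hp : p ∈ subdiff u x) (h : u y = u x + ⟪p, y - x⟫) :
    p ∈ subdiff u y := by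
  intro z
  have := hp z
  rw [h, add_assoc, ← inner_add_right]
  simpa using this

lemma eq_of_mem_subdiff_of_mem_subdiff {x y p : E2} (hp : p ∈ subdiff u x) (hq : p ∈ subdiff u y) :
    u y = u x + ⟪p, y - x⟫ := by
  have h1 := hp y
  have h2 := hq x
  rw [← neg_sub y x, inner_neg_right] at h2
  linarith

lemma mem_subdiff_segment (hconv : ConvexOn ℝ univ u) {x y z p : E2} (hp : p ∈ subdiff u x)
    (hq : p ∈ subdiff u y) (hz : z ∈ segment ℝ x y) : p ∈ subdiff u z := by
  obtain ⟨a, b, ha, hb, hab, rfl⟩ := hz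
  refine mem_subdiff_of_eq hp (le_antisymm ?_ (hp _))
  refine (hconv.2 trivial trivial ha hb hab).trans (le_of_eq ?_)
  have h3 : u x = a * u x + b * u x := by rw [← add_mul, hab, one_mul]
  have : a • x + b • y - x = b • (y - x) := by
    rw [show a = 1 - b by linarith]; module
  rw [eq_of_mem_subdiff_of_mem_subdiff hp hq, this, inner_smul_right, smul_eq_mul, smul_eq_mul]
  linear_combination -h3

lemma eq_gradient_of_mem_subdiff {x p : E2} (hd : DifferentiableAt ℝ u x) (hp : p ∈ subdiff u x) :
    p = gradient u x := by
  have h1 : HasGradientAt u (gradient u x) x := hd.hasGradientAt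
  generalize gradient u x = g at h1 ⊢
  have hg : HasFDerivAt u (innerSL ℝ g) x := h1.hasFDerivAt
  have h2 := hg.sub ((innerSL ℝ p).hasFDerivAt (x := x))
  have h3 : IsLocalMin (fun z => u z - innerSL ℝ p z) x := by
    refine Filter.Eventually.of_forall fun z => ?_
    have := hp z
    rw [inner_sub_right] at this
    simp only [innerSL_apply_apply]
    linarith
  have h4 := h3.hasFDerivAt_eq_zero h2
  have h5 : ⟪g - p, g - p⟫ = 0 := by
    have := congrArg (fun L => L (g - p)) h4
    rw [inner_sub_left]
    exact this
  exact (sub_eq_zero.1 (inner_self_eq_zero.1 h5)).symm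

lemma gradient_mem_subdiff (hconv : ConvexOn ℝ univ u) {x : E2} (hd : DifferentiableAt ℝ u x) :
    gradient u x ∈ subdiff u x := by
  intro z
  have hL : HasDerivAt (fun t : ℝ => x + t • (z - x)) (z - x) 0 := by
    simpa using ((hasDerivAt_id (0 : ℝ)).smul_const (z - x)).const_add x
  have h0 : HasGradientAt u (gradient u x) x := hd.hasGradientAt
  generalize gradient u x = g at h0 ⊢
  have h1 : HasFDerivAt u (innerSL ℝ g) (x + (0 : ℝ) • (z - x)) := by
    rw [zero_smul, add_zero]
    exact h0.hasFDerivAt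
  have h2 := h1.comp_hasDerivAt (0 : ℝ) hL
  have h3 : ConvexOn ℝ univ (u ∘ fun t : ℝ => x + t • (z - x)) := by
    have := hconv.comp_affineMap (AffineMap.lineMap x z : ℝ →ᵃ[ℝ] E2)
    simp only [preimage_univ] at this
    have e : (AffineMap.lineMap x z : ℝ → E2) = fun t => x + t • (z - x) := by
      funext t
      simp [AffineMap.lineMap_apply, add_comm]
    rwa [e] at this
  have h4 := h3.le_slope_of_hasDerivAt (x := 0) (y := 1) trivial trivial one_pos h2
  simp only [slope_def_field, innerSL_apply_apply, Function.comp_apply, one_smul, zero_smul,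
    add_zero, add_sub_cancel, sub_zero, div_one] at h4
  linarith

/-- Upper semicontinuity of a closed, bounded relation. -/
lemma eventually_subset_of_isClosed {G : Set (E2 × E2)} (hG : IsClosed G) {R : ℝ}
    (hR : ∀ q ∈ G, ‖q.2‖ ≤ R) {x : E2} {U : Set E2} (hU : IsOpen U)
    (hx : ∀ p, (x, p) ∈ G → p ∈ U) : ∀ᶠ y in nhds x, ∀ p, (y, p) ∈ G → p ∈ U := by
  have hc : IsCompact (closedBall (0 : E2) R \ U) := (isCompact_closedBall _ _).diff hU
  obtain ⟨V, W, hV, -, hxV, hW, hVW⟩ := generalized_tube_lemma (isCompact_singleton (x := x)) hc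
    hG.isOpen_compl (by
      rintro ⟨y, p⟩ ⟨hy, hp⟩ hyp
      obtain rfl : y = x := hy
      exact hp.2 (hx p hyp))
  filter_upwards [hV.mem_nhds (hxV rfl)] with y hy p hp
  by_contra hpU
  exact hVW (mk_mem_prod hy (hW ⟨mem_closedBall_zero_iff.2 (hR (y, p) hp), hpU⟩)) hp

end Subdifferential

/-- The global data: a convex potential `u` whose gradient transports the Lebesgue measure of `Ω`
to the Lebesgue measure of `Ωs`. -/
structure Transport (Ω Ωs : Set E2) (u : E2 → ℝ) (K : ℝ≥0) : Prop where
  isOpen_source : IsOpen Ω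
  isBounded_source : Bornology.IsBounded Ω
  isOpen_target : IsOpen Ωs
  convexOn : ConvexOn ℝ univ u
  lipschitz : LipschitzWith K u
  ae_gradient_mem : ∀ᵐ x : E2, DifferentiableAt ℝ u x ∧ gradient u x ∈ closure Ωs
  volume_preimage : ∀ E : Set E2, MeasurableSet E →
    volume {x ∈ Ω | DifferentiableAt ℝ u x ∧ gradient u x ∈ E} = volume (E ∩ Ωs)

/-- The subgradients in the closure of the target. -/
def targetSubdiff (Ωs : Set E2) (u : E2 → ℝ) (x : E2) : Set E2 := subdiff u x ∩ closure Ωs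

namespace Transport

variable {Ω Ωs : Set E2} {u : E2 → ℝ} {K : ℝ≥0}

lemma continuous (h : Transport Ω Ωs u K) : Continuous u := h.lipschitz.continuous

lemma isClosed_graph (h : Transport Ω Ωs u K) :
    IsClosed {q : E2 × E2 | q.2 ∈ targetSubdiff Ωs u q.1} :=
  (isClosed_graph_subdiff h.continuous).inter (isClosed_closure.preimage continuous_snd)

lemma norm_le (h : Transport Ω Ωs u K) {x p : E2} (hp : p ∈ subdiff u x) : ‖p‖ ≤ K :=
  norm_le_of_mem_subdiff h.lipschitz hp

/-- Subgradients near `x` are close to subgradients at `x`. -/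
lemma eventually_subdiff_subset (h : Transport Ω Ωs u K) {x : E2} {U : Set E2} (hU : IsOpen U)
    (hx : subdiff u x ⊆ U) : ∀ᶠ y in nhds x, subdiff u y ⊆ U :=
  eventually_subset_of_isClosed (isClosed_graph_subdiff h.continuous)
    (fun _ hq => h.norm_le hq) hU hx

lemma eventually_targetSubdiff_subset (h : Transport Ω Ωs u K) {x : E2} {U : Set E2} (hU : IsOpen U)
    (hx : targetSubdiff Ωs u x ⊆ U) : ∀ᶠ y in nhds x, targetSubdiff Ωs u y ⊆ U :=
  eventually_subset_of_isClosed h.isClosed_graph (fun _ hq => h.norm_le hq.1) hU hx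

lemma targetSubdiff_nonempty (h : Transport Ω Ωs u K) (x : E2) :
    (targetSubdiff Ωs u x).Nonempty := by
  by_contra hne
  rw [not_nonempty_iff_eq_empty] at hne
  have h1 := h.eventually_targetSubdiff_subset (x := x) isOpen_empty hne.subset
  obtain ⟨ε, hε, hb⟩ := Metric.eventually_nhds_iff_ball.1 h1
  have h2 : ball x ε ⊆ {y | ¬ (DifferentiableAt ℝ u y ∧ gradient u y ∈ closure Ωs)} :=
    fun y hyb hy => hb y hyb ⟨gradient_mem_subdiff h.convexOn hy.1, hy.2⟩
  exact (measure_ball_pos volume x hε).ne' (measure_mono_null h2 h.ae_gradient_mem)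

/-- In every direction the subdifferential is dominated by its part in the target. -/
lemma exists_targetSubdiff_inner_ge (h : Transport Ω Ωs u K) {x p : E2} (hp : p ∈ subdiff u x)
    (v : E2) : ∃ q ∈ targetSubdiff Ωs u x, ⟪v, p⟫ ≤ ⟪v, q⟫ := by
  by_contra! hcon
  have h1 := h.eventually_targetSubdiff_subset (x := x) (U := {q | ⟪v, q⟫ < ⟪v, p⟫})
    (isOpen_lt (continuous_const.inner continuous_id) continuous_const) hcon
  have h2 : Filter.Tendsto (fun t : ℝ => x + t • v) (nhdsWithin 0 (Ioi 0)) (nhds x) := by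
    have : Continuous fun t : ℝ => x + t • v := by fun_prop
    simpa using (this.tendsto 0).mono_left (nhdsWithin_le_nhds (s := Ioi 0))
  obtain ⟨t, ht, ht0⟩ := ((h2.eventually h1).and self_mem_nhdsWithin).exists
  obtain ⟨q, hq⟩ := h.targetSubdiff_nonempty (x + t • v)
  have h3 := subdiff_monotone hq.1 hp
  rw [add_sub_cancel_left, real_inner_smul_left, inner_sub_right] at h3
  have h4 : ⟪v, q⟫ < ⟪v, p⟫ := ht hq
  have : t * (⟪v, q⟫ - ⟪v, p⟫) < 0 := mul_neg_of_pos_of_neg ht0 (by linarith)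
  linarith

lemma subdiff_subset_of_convex (h : Transport Ω Ωs u K) {x : E2} {S : Set E2} (hS : Convex ℝ S)
    (hSc : IsClosed S) (hx : targetSubdiff Ωs u x ⊆ S) : subdiff u x ⊆ S := by
  intro p hp
  by_contra hcon
  obtain ⟨f, c, h1, h2⟩ := geometric_hahn_banach_closed_point hS hSc hcon
  obtain ⟨v, rfl⟩ : ∃ v : E2, f = innerSL ℝ v :=
    ⟨(InnerProductSpace.toDual ℝ E2).symm f, by ext; simp⟩
  obtain ⟨q, hq, hpq⟩ := h.exists_targetSubdiff_inner_ge hp v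
  have := h1 q (hx hq)
  simp only [innerSL_apply_apply] at this h2
  linarith

lemma differentiableAt_of_subdiff_subset (h : Transport Ω Ωs u K) {x p : E2}
    (hx : subdiff u x ⊆ {p}) : DifferentiableAt ℝ u x := by
  have hp : p ∈ subdiff u x := by
    obtain ⟨q, hq⟩ := h.targetSubdiff_nonempty x
    have hqp : q = p := hx hq.1
    exact hqp ▸ hq.1
  have : HasFDerivAt u (innerSL ℝ p) x := by
    rw [hasFDerivAt_iff_isLittleO, Asymptotics.isLittleO_iff]
    intro c hc
    have h1 := h.eventually_subdiff_subset (x := x) (U := ball p c) isOpen_ball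
      (hx.trans (singleton_subset_iff.2 (mem_ball_self hc)))
    filter_upwards [h1] with y hy
    obtain ⟨q, hq⟩ := h.targetSubdiff_nonempty y
    have h2 := hp y
    have h3 := hq.1 x
    have h4 : ⟪q - p, y - x⟫ ≤ c * ‖y - x‖ := by
      refine (real_inner_le_norm _ _).trans (mul_le_mul_of_nonneg_right ?_ (norm_nonneg _))
      have := hy hq.1
      rw [mem_ball, dist_eq_norm] at this
      exact this.le
    rw [← neg_sub y x, inner_neg_right] at h3
    rw [inner_sub_left] at h4
    rw [innerSL_apply_apply, Real.norm_eq_abs, abs_le]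
    have : 0 ≤ c * ‖y - x‖ := by positivity
    constructor <;> linarith
  exact this.differentiableAt

lemma differentiableAt_of_targetSubdiff_subset (h : Transport Ω Ωs u K) {x p : E2}
    (hx : targetSubdiff Ωs u x ⊆ {p}) : DifferentiableAt ℝ u x :=
  h.differentiableAt_of_subdiff_subset (p := p)
    (h.subdiff_subset_of_convex (convex_singleton p) isClosed_singleton hx)

lemma subdiff_eq_singleton (h : Transport Ω Ωs u K) {x : E2} (hd : DifferentiableAt ℝ u x) :
    subdiff u x = {gradient u x} :=
  Subset.antisymm (fun _ hp => eq_gradient_of_mem_subdiff hd hp)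
    (singleton_subset_iff.2 (gradient_mem_subdiff h.convexOn hd))

/-- The gradient map does not decrease the volume of compact subsets of the source. -/
lemma volume_le_volume_image (h : Transport Ω Ωs u K) {B : Set E2} (hB : IsCompact B) (hBΩ : B ⊆ Ω) :
    volume B ≤ volume {p : E2 | ∃ x ∈ B, p ∈ subdiff u x} := by
  set P := {p : E2 | ∃ x ∈ B, p ∈ subdiff u x} with hP
  have hPc : IsCompact P := by
    have : P = Prod.snd '' ((B ×ˢ closedBall (0 : E2) K) ∩ {q : E2 × E2 | q.2 ∈ subdiff u q.1}) := by
      ext p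
      constructor
      · rintro ⟨x, hx, hp⟩
        exact ⟨(x, p), ⟨⟨hx, mem_closedBall_zero_iff.2 (h.norm_le hp)⟩, hp⟩, rfl⟩
      · rintro ⟨⟨x, p⟩, ⟨⟨hx, -⟩, hp⟩, rfl⟩
        exact ⟨x, hx, hp⟩
    rw [this]
    exact ((hB.prod (isCompact_closedBall _ _)).inter_right
      (isClosed_graph_subdiff h.continuous)).image continuous_snd
  calc volume B ≤ volume {x ∈ Ω | DifferentiableAt ℝ u x ∧ gradient u x ∈ P} := by
        refine measure_mono_ae ?_
        filter_upwards [h.ae_gradient_mem] with x hx hxB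
        exact ⟨hBΩ hxB, hx.1, x, hxB, gradient_mem_subdiff h.convexOn hx.1⟩
    _ = volume (P ∩ Ωs) := h.volume_preimage P hPc.measurableSet
    _ ≤ volume P := measure_mono inter_subset_left

lemma volume_le_volume_preimage (h : Transport Ω Ωs u K) {Q : Set E2} (hQ : MeasurableSet Q)
    (hQΩ : Q ⊆ Ωs) : volume Q ≤ volume {x ∈ Ω | ∃ p ∈ Q, p ∈ subdiff u x} := by
  calc volume Q = volume (Q ∩ Ωs) := by rw [inter_eq_left.2 hQΩ]
    _ = volume {x ∈ Ω | DifferentiableAt ℝ u x ∧ gradient u x ∈ Q} := (h.volume_preimage Q hQ).symm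
    _ ≤ volume {x ∈ Ω | ∃ p ∈ Q, p ∈ subdiff u x} := measure_mono fun x hx =>
      ⟨hx.1, gradient u x, hx.2.2, gradient_mem_subdiff h.convexOn hx.2.1⟩

/-- A point of the source does not share a subgradient with any other point. -/
lemma eq_of_mem_subdiff (h : Transport Ω Ωs u K) {x y p : E2} (hx : x ∈ Ω) (hpx : p ∈ subdiff u x)
    (hpy : p ∈ subdiff u y) : x = y := by
  by_contra hne
  have hyx : y - x ≠ 0 := fun h0 => hne (sub_eq_zero.1 h0).symm
  have hn : 0 < ‖y - x‖ := norm_pos_iff.2 hyx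
  obtain ⟨ε, hε, hb⟩ := Metric.isOpen_iff.1 h.isOpen_source x hx
  obtain ⟨e, he⟩ := Frame.exists_fst_eq (v := (‖y - x‖)⁻¹ • (y - x)) (by
    rw [norm_smul, norm_inv, norm_norm]; field_simp)
  set ℓ := min (‖y - x‖ / 2) (ε / 8) with hℓ
  have hℓ0 : 0 < ℓ := by positivity
  have hℓ1 : ℓ ≤ ‖y - x‖ / 2 := min_le_left _ _
  have hℓ2 : ℓ ≤ ε / 8 := min_le_right _ _
  set X₀ := x + ℓ • e 0 with hX₀
  have hseg : ∀ s : ℝ, |s| ≤ ℓ → X₀ + s • e 0 ∈ segment ℝ x y := by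
    intro s hs
    rw [segment_eq_image']
    refine ⟨(ℓ + s) / ‖y - x‖, ⟨?_, ?_⟩, ?_⟩
    · have := (abs_le.1 hs).1
      exact div_nonneg (by linarith) hn.le
    · have := (abs_le.1 hs).2
      rw [div_le_one hn]; linarith
    · simp only
      rw [hX₀, he, div_eq_mul_inv, mul_smul, add_smul, add_assoc]
  refine false_of_volume_box_le (Γ := {q : E2 × E2 | q.2 ∈ subdiff u q.1}) (R := K)
    (fun q hq q' hq' => subdiff_monotone hq hq') (isClosed_graph_subdiff h.continuous)
    (fun q hq => h.norm_le hq) e (X₀ := X₀) (p₀ := p) hℓ0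
    (fun s hs => mem_subdiff_segment h.convexOn hpx hpy (hseg s hs)) ?_ (h₀ := ε / 8) (by positivity) ?_
  · intro q s s' hs hs' hq h0
    have hps := mem_subdiff_segment h.convexOn hpx hpy (hseg s hs)
    have hps' := mem_subdiff_segment h.convexOn hpx hpy (hseg s' hs')
    refine mem_subdiff_of_eq hq ?_
    rw [eq_of_mem_subdiff_of_mem_subdiff hps hps']
    have : X₀ + s' • e 0 - (X₀ + s • e 0) = (s' - s) • e 0 := by module
    rw [inner_sub_right] at h0
    rw [this, inner_smul_right, inner_smul_right, real_inner_comm, real_inner_comm (e 0) q]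
    have h1 : ⟪e 0, p⟫ = ⟪e 0, q⟫ := by linarith
    rw [h1]
  · intro t ht htε
    refine (h.volume_le_volume_image e.isCompact_box ?_).trans (measure_mono ?_)
    · rintro X ⟨hX0, hX1⟩
      apply hb
      rw [mem_ball, dist_eq_norm]
      have h1 := e.norm_le_add_abs (X - X₀)
      have h2 : ‖X₀ - x‖ = ℓ := by simp [hX₀, norm_smul, abs_of_pos hℓ0]
      have h3 : |⟪e 0, X - X₀⟫| ≤ ℓ / 2 := abs_le.2 hX0
      have h4 : |⟪e 1, X - X₀⟫| ≤ t := abs_le.2 ⟨by linarith [hX1.1], hX1.2⟩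
      have h5 : ‖X - x‖ ≤ ‖X - X₀‖ + ‖X₀ - x‖ := by
        simpa using norm_add_le (X - X₀) (X₀ - x)
      linarith
    · rintro q ⟨X, hX, hq⟩
      exact ⟨X, hX, hq⟩

/-- The subdifferential at a point of the source contains no segment that is adjacent to the
target. -/
lemma false_of_segment_subset (h : Transport Ω Ωs u K) {x P₀ : E2} (hx : x ∈ Ω) (e : Frame)
    {ℓ h₀ : ℝ} (hℓ : 0 < ℓ) (hh₀ : 0 < h₀) (hP : ∀ s : ℝ, |s| ≤ ℓ → P₀ + s • e 0 ∈ subdiff u x)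
    (hbox : ∀ p : E2, |⟪e 0, p - P₀⟫| ≤ ℓ / 2 → 0 < ⟪e 1, p - P₀⟫ → ⟪e 1, p - P₀⟫ < h₀ → p ∈ Ωs) :
    False := by
  obtain ⟨R, hR⟩ := h.isBounded_source.closure.exists_norm_le
  refine false_of_volume_box_le (Γ := {q : E2 × E2 | q.1 ∈ subdiff u q.2 ∧ q.2 ∈ closure Ω}) (R := R)
    (fun q hq q' hq' => ?_) ?_ (fun q hq => hR _ hq.2) e (X₀ := P₀) (p₀ := x) hℓ
    (fun s hs => ⟨hP s hs, subset_closure hx⟩) ?_ hh₀ ?_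
  · rw [real_inner_comm]; exact subdiff_monotone hq.1 hq'.1
  · exact ((isClosed_graph_subdiff h.continuous).preimage continuous_swap).inter
      (isClosed_closure.preimage continuous_snd)
  · intro y s s' hs hs' hy h0
    refine ⟨mem_subdiff_of_eq (hP s' hs') ?_, hy.2⟩
    rw [eq_of_mem_subdiff_of_mem_subdiff (hP s hs) hy.1]
    simp only [inner_add_left, real_inner_smul_left, h0, mul_zero]
  · intro t ht htε
    refine (h.volume_le_volume_preimage e.isCompact_box.measurableSet ?_).trans (measure_mono ?_)
    · rintro X ⟨hX0, hX1⟩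
      exact hbox X (abs_le.2 hX0) (by linarith [hX1.1]) (by linarith [hX1.2])
    · rintro y ⟨hy, X, hX, hq⟩
      exact ⟨X, hX, hq, subset_closure hy⟩

end Transport

lemma convex_halfBall (q v : E2) (ε : ℝ) : Convex ℝ {z ∈ ball q ε | 0 < ⟪v, z - q⟫} := by
  have : {z ∈ ball q ε | 0 < ⟪v, z - q⟫} = ball q ε ∩ {z | ⟪v, q⟫ < innerSL ℝ v z} := by
    ext z; simp [inner_sub_right]
  rw [this]
  exact (convex_ball q ε).inter (convex_halfSpace_gt (innerSL ℝ v).isLinear _)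

/-- A half ball which does not meet the frontier of a set lies on one side of it. -/
lemma halfBall_subset_or_disjoint {S : Set E2} {q v : E2} {ε : ℝ}
    (hS : ∀ z ∈ ball q ε, z ∈ frontier S → ⟪v, z - q⟫ = 0) :
    (∀ z ∈ ball q ε, 0 < ⟪v, z - q⟫ → z ∈ S) ∨ (∀ z ∈ ball q ε, 0 < ⟪v, z - q⟫ → z ∉ S) := by
  by_contra! hcon
  obtain ⟨⟨z, hz, hzv, hzS⟩, ⟨y, hy, hyv, hyS⟩⟩ := hcon
  have hd : ∀ w ∈ {z ∈ ball q ε | 0 < ⟪v, z - q⟫}, w ∉ frontier S :=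
    fun w hw hwS => hw.2.ne' (hS w hw.1 hwS)
  obtain ⟨w, -, hw1, hw2⟩ := (convex_halfBall q v ε).isPreconnected (interior S) (closure S)ᶜ
    isOpen_interior isClosed_closure.isOpen_compl
    (fun w hw => or_iff_not_imp_left.2 fun hi hc => hd w hw ⟨hc, hi⟩)
    ⟨y, ⟨hy, hyv⟩, by_contra fun hi => hd y ⟨hy, hyv⟩ ⟨subset_closure hyS, hi⟩⟩
    ⟨z, ⟨hz, hzv⟩, fun hc => hd z ⟨hz, hzv⟩ ⟨hc, fun hi => hzS (interior_subset hi)⟩⟩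
  exact hw2 (subset_closure (interior_subset hw1))

/-- An open set fills a half ball at a boundary point where the boundary is straight. -/
lemma exists_halfBall_subset {S : Set E2} (hSo : IsOpen S) {q v : E2} (hv : ‖v‖ = 1) {ε : ℝ}
    (hε : 0 < ε) (hq : q ∈ frontier S) (hS : ∀ z ∈ ball q ε, z ∈ frontier S → ⟪v, z - q⟫ = 0) :
    (∀ z ∈ ball q ε, 0 < ⟪v, z - q⟫ → z ∈ S) ∨ (∀ z ∈ ball q ε, 0 < ⟪-v, z - q⟫ → z ∈ S) := by
  rcases halfBall_subset_or_disjoint hS with h1 | h1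
  · exact Or.inl h1
  rcases halfBall_subset_or_disjoint (v := -v)
    (fun z hz hzS => by rw [inner_neg_left, hS z hz hzS, neg_zero]) with h2 | h2
  · exact Or.inr h2
  exfalso
  obtain ⟨y, hy, hyS⟩ := mem_closure_iff_nhds.1 (frontier_subset_closure hq) _ (ball_mem_nhds q hε)
  rcases lt_trichotomy 0 ⟪v, y - q⟫ with h | h | h
  · exact h1 y hy h hyS
  · obtain ⟨δ, hδ, hb⟩ := Metric.isOpen_iff.1 (hSo.inter isOpen_ball) y ⟨hyS, hy⟩
    have hm := hb (show y + (δ / 2) • v ∈ ball y δ by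
      rw [mem_ball, dist_eq_norm, add_sub_cancel_left, norm_smul, hv, Real.norm_of_nonneg] <;>
        linarith)
    refine h1 _ hm.2 ?_ hm.1
    rw [add_sub_right_comm, inner_add_right, ← h, real_inner_smul_right,
      real_inner_self_eq_norm_sq, hv]
    linarith
  · exact h2 y hy (by rw [inner_neg_left]; linarith) hyS

namespace Transport

variable {Ω Ωs : Set E2} {u : E2 → ℝ} {K : ℝ≥0}

lemma false_of_straight (h : Transport Ω Ωs u K) {x q : E2} (hx : x ∈ Ω) (e : Frame) {ε ℓ : ℝ}
    (hε : 0 < ε) (hℓ : 0 < ℓ)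
    (hP : ∀ s : ℝ, |s| ≤ ℓ → q + s • e 0 ∈ subdiff u x)
    (hS : ∀ z ∈ ball q ε, 0 < ⟪e 1, z - q⟫ → z ∈ Ωs) : False := by
  refine h.false_of_segment_subset hx e (P₀ := q) (ℓ := min ℓ ε) (h₀ := ε / 2) (lt_min hℓ hε)
    (by linarith) (fun s hs => hP s (hs.trans (min_le_left _ _))) fun p hp0 hp1 hp2 => ?_
  refine hS p ?_ hp1
  rw [mem_ball, dist_eq_norm]
  have h1 := e.norm_le_add_abs (p - q)
  rw [abs_of_pos hp1] at h1
  have := min_le_right ℓ ε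
  linarith

/-- A point with a subgradient in the target has no other subgradient. -/
lemma subdiff_eq_singleton_of_mem_target (h : Transport Ω Ωs u K) {x p : E2} (hx : x ∈ Ω)
    (hp : p ∈ subdiff u x) (hpΩ : p ∈ Ωs) : subdiff u x = {p} := by
  refine Subset.antisymm (fun p' hp' => ?_) (singleton_subset_iff.2 hp)
  by_contra hne
  have hn : 0 < ‖p' - p‖ := norm_pos_iff.2 (sub_ne_zero.2 hne)
  obtain ⟨ε, hε, hb⟩ := Metric.isOpen_iff.1 h.isOpen_target p hpΩ
  obtain ⟨e, he⟩ := Frame.exists_fst_eq (v := (‖p' - p‖)⁻¹ • (p' - p)) (by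
    rw [norm_smul, norm_inv, norm_norm]; field_simp)
  set s₀ := min (‖p' - p‖) ε / 2
  have hs₀ : 0 < s₀ := half_pos (lt_min hn hε)
  have hs₁ : s₀ ≤ ‖p' - p‖ / 2 := div_le_div_of_nonneg_right (min_le_left _ _) (by norm_num)
  have hs₂ : s₀ ≤ ε / 2 := div_le_div_of_nonneg_right (min_le_right _ _) (by norm_num)
  refine h.false_of_straight hx e (q := p + s₀ • e 0) (ε := ε / 2) (ℓ := s₀) (by linarith) hs₀ ?_ ?_
  · intro s hs
    rw [abs_le] at hs
    have : p + s₀ • e 0 + s • e 0 = (1 - (s₀ + s) / ‖p' - p‖) • p + ((s₀ + s) / ‖p' - p‖) • p' := by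
      rw [he, div_eq_mul_inv]; module
    rw [this]
    refine convex_subdiff x hp hp' ?_ ?_ (by ring)
    · rw [sub_nonneg, div_le_one hn]; linarith
    · exact div_nonneg (by linarith) hn.le
  · intro z hz _
    refine hb ?_
    rw [mem_ball] at hz ⊢
    have : dist (p + s₀ • e 0) p = s₀ := by
      rw [dist_eq_norm, add_sub_cancel_left, norm_smul, Real.norm_of_nonneg hs₀.le]; simp
    linarith [dist_triangle z (p + s₀ • e 0) p]

end Transport

/-- The local picture at a singular point `x₀` whose subdifferential crosses exactly two edges of
the target, at `p` and `p'`; the inner unit normals of these edges are `e 1` and `e' 1`. -/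
structure IsFold (Ω Ωs : Set E2) (u : E2 → ℝ) (K : ℝ≥0) (x₀ p p' : E2) (e e' : Frame) (ε r : ℝ) :
    Prop extends Transport Ω Ωs u K where
  eps_pos : 0 < ε
  r_pos : 0 < r
  left_mem : p ∈ targetSubdiff Ωs u x₀
  right_mem : p' ∈ targetSubdiff Ωs u x₀
  left_inner : ⟪e 1, p' - p⟫ < 0
  right_inner : ⟪e' 1, p - p'⟫ < 0
  left_target : ∀ q ∈ ball p ε, 0 < ⟪e 1, q - p⟫ → q ∈ Ωs
  right_target : ∀ q ∈ ball p' ε, 0 < ⟪e' 1, q - p'⟫ → q ∈ Ωs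
  left_closure : ∀ q ∈ ball p ε, q ∈ closure Ωs → 0 ≤ ⟪e 1, q - p⟫
  right_closure : ∀ q ∈ ball p' ε, q ∈ closure Ωs → 0 ≤ ⟪e' 1, q - p'⟫
  left_far : ∀ q ∈ ball p' ε, ⟪e 1, q - p⟫ < 0
  right_far : ∀ q ∈ ball p ε, ⟪e' 1, q - p'⟫ < 0
  eps_le : 4 * ε ≤ ‖p - p'‖
  mem_source : ∀ x ∈ ball x₀ r, x ∈ Ω
  mem_near : ∀ x ∈ ball x₀ r, ∀ q ∈ targetSubdiff Ωs u x, q ∈ ball p ε ∨ q ∈ ball p' ε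

lemma isClosed_segment_plane (a b : E2) : IsClosed (segment ℝ a b) := by
  rw [segment_eq_image]
  exact (isCompact_Icc.image (by fun_prop)).isClosed

lemma openSegment_straight {a b c : E2} (hc : c ∈ openSegment ℝ a b) (hca : c ≠ a) :
    a ≠ b ∧ ∀ v : E2, (∀ w ∈ segment ℝ a b, ⟪v, w - c⟫ = 0) ↔ ⟪v, b - a⟫ = 0 := by
  obtain ⟨s, t, hs, ht, hst, rfl⟩ := hc
  have hab : a ≠ b := by
    rintro rfl
    exact hca (by rw [← add_smul, hst, one_smul])
  refine ⟨hab, fun v => ⟨fun h => ?_, fun h => ?_⟩⟩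
  · have h1 := h a (left_mem_segment ℝ a b)
    have h2 := h b (right_mem_segment ℝ a b)
    rw [inner_sub_right] at h1 h2 ⊢
    linarith
  · rintro w ⟨s', t', hs', ht', hst', rfl⟩
    have : s' • a + t' • b - (s • a + t • b) = (t' - t) • (b - a) := by
      obtain rfl : s = 1 - t := by linarith
      obtain rfl : s' = 1 - t' := by linarith
      module
    rw [this, real_inner_smul_right, h, mul_zero]

/-- Each point of an open segment can be moved along the segment. -/
lemma exists_add_smul_mem_openSegment {a b c v : E2} {ν : E2} (hν : ‖ν‖ = 1)
    (hc : c ∈ openSegment ℝ a b) (hca : c ≠ a) (hb : ⟪ν, b - a⟫ = 0) (hv : ⟪ν, v⟫ = 0) :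
    ∃ δ > 0, ∀ t : ℝ, |t| ≤ δ → c + t • v ∈ openSegment ℝ a b := by
  have hab := (openSegment_straight hc hca).1
  obtain ⟨e, he⟩ := Frame.exists_snd_eq hν
  have hab0 : b - a ≠ 0 := sub_ne_zero.2 hab.symm
  have h0 : ⟪e 0, b - a⟫ ≠ 0 := by
    intro h
    exact hab0 (e.ext_inner (by simpa using h) (by rw [he, hb]; simp))
  set k := ⟪e 0, v⟫ / ⟪e 0, b - a⟫ with hk
  have hvk : v = k • (b - a) := by
    refine e.ext_inner ?_ ?_
    · rw [real_inner_smul_right, hk]; field_simp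
    · rw [he, real_inner_smul_right, hb, hv, mul_zero]
  obtain ⟨s, t, hs, ht, hst, rfl⟩ := hc
  refine ⟨min s t / (2 * (|k| + 1)), by positivity, fun t' ht' => ?_⟩
  have hk1 : |t' * k| < min s t := by
    rw [le_div_iff₀ (by positivity)] at ht'
    rw [abs_mul]
    have : 0 < min s t := lt_min hs ht
    nlinarith [abs_nonneg t', abs_nonneg k]
  rw [abs_lt] at hk1
  refine ⟨s - t' * k, t + t' * k, ?_, ?_, by linarith, ?_⟩
  · linarith [min_le_left s t]
  · linarith [min_le_right s t]
  · rw [hvk]; module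

lemma subsingleton_segment_inter {a b c v : E2} (h : ¬ ∀ w ∈ segment ℝ a b, ⟪v, w - c⟫ = 0) :
    {w ∈ segment ℝ a b | ⟪v, w - c⟫ = 0}.Subsingleton := by
  rintro w ⟨⟨s, t, hs, ht, hst, rfl⟩, hw⟩ w' ⟨⟨s', t', hs', ht', hst', rfl⟩, hw'⟩
  obtain rfl : s = 1 - t := by linarith
  obtain rfl : s' = 1 - t' := by linarith
  have h1 : ∀ τ : ℝ, ⟪v, (1 - τ) • a + τ • b - c⟫ = ⟪v, a - c⟫ + τ * ⟪v, b - a⟫ := by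
    intro τ
    rw [← real_inner_smul_right, ← inner_add_right]; congr 1; module
  rw [h1] at hw hw'
  have h2 : (t - t') * ⟪v, b - a⟫ = 0 := by linarith
  rcases mul_eq_zero.1 h2 with h3 | h3
  · obtain rfl : t = t' := by linarith
    rfl
  · exfalso
    refine h ?_
    rintro w ⟨s, τ, hs, hτ, hsτ, rfl⟩
    obtain rfl : s = 1 - τ := by linarith
    rw [h1, h3]; rw [h3] at hw; linarith

namespace Transport

variable {Ω Ωs : Set E2} {u : E2 → ℝ} {K : ℝ≥0} {m : ℕ} [NeZero m] {b : Fin m → E2}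

/-- The subdifferential at a point of the source contains no boundary segment of the target. -/
lemma subsingleton_of_subset_frontier (h : Transport Ω Ωs u K)
    (hpoly : frontier Ωs = ⋃ i : Fin m, segment ℝ (b i) (b (i + 1))) {x : E2} (hx : x ∈ Ω)
    {p p' : E2} (hp : p ∈ subdiff u x) (hp' : p' ∈ subdiff u x)
    (hf : segment ℝ p p' ⊆ frontier Ωs) : p = p' := by
  by_contra hne
  have hn : 0 < ‖p' - p‖ := norm_pos_iff.2 (sub_ne_zero.2 (Ne.symm hne))
  obtain ⟨e, he⟩ := Frame.exists_fst_eq (v := (‖p' - p‖)⁻¹ • (p' - p)) (by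
    rw [norm_smul, norm_inv, norm_norm]; field_simp)
  have hpe : p' - p = ‖p' - p‖ • e 0 := by rw [he, smul_smul, mul_inv_cancel₀ hn.ne', one_smul]
  have hline : ∀ t : ℝ, ⟪e 1, p + t • e 0 - p⟫ = 0 := by
    intro t; rw [add_sub_cancel_left, real_inner_smul_right]; simp
  have hseg : ∀ t : ℝ, 0 ≤ t → t ≤ ‖p' - p‖ → p + t • e 0 ∈ segment ℝ p p' := by
    intro t h0 h1
    refine ⟨1 - t / ‖p' - p‖, t / ‖p' - p‖, ?_, by positivity, by ring, ?_⟩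
    · rw [sub_nonneg, div_le_one hn]; exact h1
    · rw [he, div_eq_mul_inv]; module
  set bad : Set E2 := ⋃ i : {i : Fin m // ¬ ∀ w ∈ segment ℝ (b i) (b (i + 1)), ⟪e 1, w - p⟫ = 0},
    {w ∈ segment ℝ (b i) (b (i + 1)) | ⟪e 1, w - p⟫ = 0} with hbad
  have hbadf : bad.Finite := finite_iUnion fun i => (subsingleton_segment_inter i.2).finite
  have hinj : Function.Injective fun t : ℝ => p + t • e 0 := by
    intro s t hst
    have h0 := congrArg (fun w => ⟪e 0, w⟫) hst
    simp only [inner_add_right, real_inner_smul_right, Frame.inner_fst_fst] at h0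
    linarith
  obtain ⟨t, ht, htb⟩ : ∃ t ∈ Ioo 0 ‖p' - p‖, p + t • e 0 ∉ bad := by
    by_contra! hcon
    exact (Ioo_infinite hn).mono (fun t ht => hcon t ht) (Finite.preimage (s := bad) hinj.injOn hbadf)
  set q := p + t • e 0 with hq
  have hqp : ⟪e 1, q - p⟫ = 0 := hline t
  obtain ⟨ε, hε, hball⟩ : ∃ ε > 0, ∀ z ∈ ball q ε, z ∈ frontier Ωs → ⟪e 1, z - q⟫ = 0 := by
    have hcl : IsClosed (⋃ i : {i : Fin m // ¬ ∀ w ∈ segment ℝ (b i) (b (i + 1)), ⟪e 1, w - p⟫ = 0},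
        segment ℝ (b i) (b (i + 1))) :=
      isClosed_iUnion_of_finite fun i => isClosed_segment_plane _ _
    obtain ⟨ε, hε, hb⟩ := Metric.isOpen_iff.1 hcl.isOpen_compl q (by
      intro hmem
      obtain ⟨i, hi⟩ := mem_iUnion.1 hmem
      exact htb (mem_iUnion.2 ⟨i, hi, hqp⟩))
    refine ⟨ε, hε, fun z hz hzf => ?_⟩
    rw [hpoly] at hzf
    obtain ⟨i, hi⟩ := mem_iUnion.1 hzf
    have hgood : ∀ w ∈ segment ℝ (b i) (b (i + 1)), ⟪e 1, w - p⟫ = 0 := by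
      by_contra hcon
      exact hb hz (mem_iUnion.2 ⟨⟨i, hcon⟩, hi⟩)
    have := hgood z hi
    rw [inner_sub_right] at this hqp ⊢
    linarith
  have hP : ∀ s : ℝ, |s| ≤ min t (‖p' - p‖ - t) → q + s • e 0 ∈ subdiff u x := by
    intro s hs
    have h1 := abs_le.1 hs
    have h2 := min_le_left t (‖p' - p‖ - t)
    have h3 := min_le_right t (‖p' - p‖ - t)
    rw [hq, add_assoc, ← add_smul]
    exact (convex_subdiff x).segment_subset hp hp' (hseg _ (by linarith) (by linarith))
  have hℓ : 0 < min t (‖p' - p‖ - t) := lt_min ht.1 (by linarith [ht.2])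
  rcases exists_halfBall_subset h.isOpen_target (by simp) hε (hf (hseg t ht.1.le ht.2.le)) hball
    with h1 | h1
  · exact h.false_of_straight hx e hε hℓ hP h1
  · obtain ⟨e', he0, he1⟩ := e.exists_neg_snd
    exact h.false_of_straight hx e' hε hℓ (by rwa [he0]) (by rwa [he1])

/-- The boundary near a point where the subdifferential crosses an edge. -/
lemma exists_edge_frame (h : Transport Ω Ωs u K)
    (hpoly : frontier Ωs = ⋃ i : Fin m, segment ℝ (b i) (b (i + 1))) {x : E2} (hx : x ∈ Ω)
    (hd : ¬ DifferentiableAt ℝ u x) (hvert : ∀ k, b k ∉ subdiff u x) {i : Fin m} {p p' : E2}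
    (hp : p ∈ subdiff u x) (hpi : p ∈ openSegment ℝ (b i) (b (i + 1))) (hp' : p' ∈ subdiff u x)
    (hpp' : p ≠ p') (hk : ∀ k ≠ i, p ∉ segment ℝ (b k) (b (k + 1))) :
    ∃ (e : Frame) (ε : ℝ), 0 < ε ∧ ⟪e 1, p' - p⟫ < 0 ∧
      (∀ q ∈ ball p ε, 0 < ⟪e 1, q - p⟫ → q ∈ Ωs) ∧
      (∀ q ∈ ball p ε, q ∈ closure Ωs → 0 ≤ ⟪e 1, q - p⟫) := by
  have hpb : p ≠ b i := fun h0 => hvert i (h0 ▸ hp)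
  obtain ⟨hab, hstr⟩ := openSegment_straight hpi hpb
  have hn : 0 < ‖b (i + 1) - b i‖ := norm_pos_iff.2 (sub_ne_zero.2 hab.symm)
  obtain ⟨f, hf⟩ := Frame.exists_fst_eq (v := (‖b (i + 1) - b i‖)⁻¹ • (b (i + 1) - b i)) (by
    rw [norm_smul, norm_inv, norm_norm]; field_simp)
  have hfb : ⟪f 1, b (i + 1) - b i⟫ = 0 := by
    have : b (i + 1) - b i = ‖b (i + 1) - b i‖ • f 0 := by
      rw [hf, smul_smul, mul_inv_cancel₀ hn.ne', one_smul]
    rw [this, real_inner_smul_right, Frame.inner_snd_fst, mul_zero]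
  have hp'0 : ⟪f 1, p' - p⟫ ≠ 0 := by
    intro h0
    obtain ⟨δ, hδ, hδs⟩ := exists_add_smul_mem_openSegment (by simp) hpi hpb hfb h0
    set t := min δ 1
    have ht : 0 < t := lt_min hδ one_pos
    have hm : p + t • (p' - p) ∈ openSegment ℝ (b i) (b (i + 1)) :=
      hδs t (by rw [abs_of_pos ht]; exact min_le_left _ _)
    have hm' : p + t • (p' - p) ∈ subdiff u x := by
      have := convex_subdiff (u := u) x hp hp' (a := 1 - t) (b := t)
        (by linarith [min_le_right δ 1]) ht.le (by ring)
      convert this using 1; module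
    have := h.subsingleton_of_subset_frontier hpoly hx hp hm' (by
      rw [hpoly]
      exact ((convex_segment _ _).segment_subset (openSegment_subset_segment _ _ _ hpi)
        (openSegment_subset_segment _ _ _ hm)).trans
          (subset_iUnion (fun i => segment ℝ (b i) (b (i + 1))) i))
    have h1 : t • (p' - p) = 0 := by simpa using this
    rcases smul_eq_zero.1 h1 with h2 | h2
    · exact ht.ne' h2
    · exact hpp' (sub_eq_zero.1 h2).symm
  obtain ⟨e, he, hp'1⟩ : ∃ e : Frame, (e 1 = f 1 ∨ e 1 = -f 1) ∧ ⟪e 1, p' - p⟫ < 0 := by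
    rcases lt_or_gt_of_ne hp'0 with h1 | h1
    · exact ⟨f, Or.inl rfl, h1⟩
    · obtain ⟨e, -, he⟩ := f.exists_neg_snd
      exact ⟨e, Or.inr he, by rw [he, inner_neg_left]; linarith⟩
  have heb : ⟪e 1, b (i + 1) - b i⟫ = 0 := by
    rcases he with he | he <;> rw [he] <;> simp [hfb]
  obtain ⟨ε, hε, hball⟩ : ∃ ε > 0, ∀ z ∈ ball p ε, z ∈ frontier Ωs → ⟪e 1, z - p⟫ = 0 := by
    have hcl : IsClosed (⋃ k : {k : Fin m // k ≠ i}, segment ℝ (b k) (b (k + 1))) :=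
      isClosed_iUnion_of_finite fun i => isClosed_segment_plane _ _
    obtain ⟨ε, hε, hb⟩ := Metric.isOpen_iff.1 hcl.isOpen_compl p (by
      intro hmem
      obtain ⟨k, hk'⟩ := mem_iUnion.1 hmem
      exact hk k k.2 hk')
    refine ⟨ε, hε, fun z hz hzf => ?_⟩
    rw [hpoly] at hzf
    obtain ⟨k, hk'⟩ := mem_iUnion.1 hzf
    have hki : k = i := by
      by_contra hcon
      exact hb hz (mem_iUnion.2 ⟨⟨k, hcon⟩, hk'⟩)
    subst hki
    exact (hstr (e 1)).2 heb z hk'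
  have hnot : ¬ ∀ z ∈ ball p ε, 0 < ⟪-e 1, z - p⟫ → z ∈ Ωs := by
    intro hall
    set t := min 1 (ε / (2 * ‖p' - p‖))
    have hn' : 0 < ‖p' - p‖ := norm_pos_iff.2 (sub_ne_zero.2 hpp'.symm)
    have ht : 0 < t := lt_min one_pos (by positivity)
    have hm' : p + t • (p' - p) ∈ subdiff u x := by
      have := convex_subdiff (u := u) x hp hp' (a := 1 - t) (b := t)
        (by linarith [min_le_left 1 (ε / (2 * ‖p' - p‖))]) ht.le (by ring)
      convert this using 1; module
    have hmΩ : p + t • (p' - p) ∈ Ωs := by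
      refine hall _ ?_ ?_
      · rw [mem_ball, dist_eq_norm, add_sub_cancel_left, norm_smul, Real.norm_of_nonneg ht.le]
        have := min_le_right 1 (ε / (2 * ‖p' - p‖))
        calc t * ‖p' - p‖ ≤ ε / (2 * ‖p' - p‖) * ‖p' - p‖ := by gcongr
          _ = ε / 2 := by field_simp
          _ < ε := by linarith
      · rw [add_sub_cancel_left, real_inner_smul_right, inner_neg_left]
        nlinarith
    refine hd (h.differentiableAt_of_subdiff_subset
      (h.subdiff_eq_singleton_of_mem_target hx hm' hmΩ).subset)
  have hpf : p ∈ frontier Ωs := by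
    rw [hpoly]; exact mem_iUnion.2 ⟨i, openSegment_subset_segment _ _ _ hpi⟩
  have h1 : ∀ z ∈ ball p ε, 0 < ⟪e 1, z - p⟫ → z ∈ Ωs :=
    (exists_halfBall_subset h.isOpen_target (by simp) hε hpf hball).resolve_right hnot
  have h2 : ∀ z ∈ ball p ε, 0 < ⟪-e 1, z - p⟫ → z ∉ Ωs :=
    (halfBall_subset_or_disjoint (v := -e 1)
      (fun z hz hzS => by rw [inner_neg_left, hball z hz hzS, neg_zero])).resolve_left hnot
  refine ⟨e, ε, hε, hp'1, h1, fun q hq hqc => ?_⟩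
  by_contra! hneg
  have ho : IsOpen (ball p ε ∩ {z | ⟪e 1, z - p⟫ < 0}) :=
    isOpen_ball.inter (isOpen_lt (by fun_prop) continuous_const)
  obtain ⟨z, ⟨hz1, hz2⟩, hz3⟩ := mem_closure_iff.1 hqc _ ho ⟨hq, hneg⟩
  exact h2 z hz1 (by rw [inner_neg_left]; exact neg_pos.2 hz2) hz3

/-- The local picture at a singular point whose subdifferential crosses exactly two edges. -/
theorem exists_isFold (h : Transport Ω Ωs u K)
    (hpoly : frontier Ωs = ⋃ i : Fin m, segment ℝ (b i) (b (i + 1))) {x : E2} (hx : x ∈ Ω)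
    (hd : ¬ DifferentiableAt ℝ u x) (hvert : ∀ k, b k ∉ subdiff u x)
    (htwo : {i : Fin m | (subdiff u x ∩ openSegment ℝ (b i) (b (i + 1))).Nonempty}.ncard = 2) :
    ∃ p p' e e' ε r, IsFold Ω Ωs u K x p p' e e' ε r := by
  obtain ⟨i, j, hij, hset⟩ := Set.ncard_eq_two.1 htwo
  have hmem : ∀ k, (subdiff u x ∩ openSegment ℝ (b k) (b (k + 1))).Nonempty ↔ k = i ∨ k = j := by
    intro k
    have := Set.ext_iff.1 hset k
    simpa using this
  obtain ⟨p, hp, hpi⟩ := (hmem i).2 (Or.inl rfl)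
  obtain ⟨p', hp', hpj⟩ := (hmem j).2 (Or.inr rfl)
  have huniq : ∀ {k : Fin m} {q q' : E2}, q ∈ subdiff u x → q' ∈ subdiff u x →
      q ∈ segment ℝ (b k) (b (k + 1)) → q' ∈ segment ℝ (b k) (b (k + 1)) → q = q' := by
    intro k q q' hq hq' hqk hqk'
    refine h.subsingleton_of_subset_frontier hpoly hx hq hq' ?_
    rw [hpoly]
    exact ((convex_segment _ _).segment_subset hqk hqk').trans
      (subset_iUnion (fun i => segment ℝ (b i) (b (i + 1))) k)
  have hopen : ∀ {k : Fin m} {q : E2}, q ∈ subdiff u x → q ∈ segment ℝ (b k) (b (k + 1)) →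
      q ∈ openSegment ℝ (b k) (b (k + 1)) := by
    intro k q hq hqk
    refine mem_openSegment_of_ne_left_right ?_ ?_ hqk
    · rintro rfl; exact hvert _ hq
    · rintro rfl; exact hvert _ hq
  have hC : targetSubdiff Ωs u x ⊆ {p, p'} := by
    rintro q ⟨hq, hqc⟩
    have hqf : q ∈ frontier Ωs := by
      refine ⟨hqc, fun hqi => hd ?_⟩
      exact h.differentiableAt_of_subdiff_subset
        (h.subdiff_eq_singleton_of_mem_target hx hq (interior_subset hqi)).subset
    rw [hpoly] at hqf
    obtain ⟨k, hk⟩ := mem_iUnion.1 hqf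
    rcases (hmem k).1 ⟨q, hq, hopen hq hk⟩ with rfl | rfl
    · exact Or.inl (huniq hq hp hk (openSegment_subset_segment _ _ _ hpi))
    · exact Or.inr (huniq hq hp' hk (openSegment_subset_segment _ _ _ hpj))
  have hpp' : p ≠ p' := by
    rintro rfl
    exact hd (h.differentiableAt_of_targetSubdiff_subset (p := p) (by simpa using hC))
  have hpk : ∀ k ≠ i, p ∉ segment ℝ (b k) (b (k + 1)) := by
    intro k hki hk
    rcases (hmem k).1 ⟨p, hp, hopen hp hk⟩ with rfl | rfl
    · exact hki rfl
    · exact hpp' (huniq hp hp' hk (openSegment_subset_segment _ _ _ hpj))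
  have hpk' : ∀ k ≠ j, p' ∉ segment ℝ (b k) (b (k + 1)) := by
    intro k hkj hk
    rcases (hmem k).1 ⟨p', hp', hopen hp' hk⟩ with rfl | rfl
    · exact hpp' (huniq hp hp' (openSegment_subset_segment _ _ _ hpi) hk)
    · exact hkj rfl
  obtain ⟨e, ε₁, hε₁, hin₁, htar₁, hclo₁⟩ :=
    h.exists_edge_frame hpoly hx hd hvert hp hpi hp' hpp' hpk
  obtain ⟨e', ε₂, hε₂, hin₂, htar₂, hclo₂⟩ :=
    h.exists_edge_frame hpoly hx hd hvert hp' hpj hp hpp'.symm hpk'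
  have hfar : ∀ {a c v : E2}, ⟪v, c - a⟫ < 0 → ∃ ε > 0, ∀ q ∈ ball c ε, ⟪v, q - a⟫ < 0 := by
    intro a c v hv
    have ho : IsOpen {q : E2 | ⟪v, q - a⟫ < 0} := isOpen_lt (by fun_prop) continuous_const
    exact Metric.isOpen_iff.1 ho c hv
  obtain ⟨ε₃, hε₃, hfar₁⟩ := hfar hin₁
  obtain ⟨ε₄, hε₄, hfar₂⟩ := hfar hin₂
  have hn : 0 < ‖p - p'‖ := norm_pos_iff.2 (sub_ne_zero.2 hpp')
  obtain ⟨ε, hε, h1, h2, h3, h4, h5⟩ : ∃ ε > 0, ε ≤ ε₁ ∧ ε ≤ ε₂ ∧ ε ≤ ε₃ ∧ ε ≤ ε₄ ∧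
      4 * ε ≤ ‖p - p'‖ := by
    refine ⟨min (min ε₁ ε₂) (min (min ε₃ ε₄) (‖p - p'‖ / 4)), by positivity, ?_⟩
    simp only [min_le_iff, le_refl, true_or, or_true, true_and]
    have : min (min ε₁ ε₂) (min (min ε₃ ε₄) (‖p - p'‖ / 4)) ≤ ‖p - p'‖ / 4 := by simp
    linarith
  have hnear := h.eventually_targetSubdiff_subset (x := x) (U := ball p ε ∪ ball p' ε)
    (isOpen_ball.union isOpen_ball) (fun q hq => by
      rcases hC hq with rfl | rfl
      · exact Or.inl (mem_ball_self hε)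
      · exact Or.inr (mem_ball_self hε))
  obtain ⟨r, hr, hb⟩ := Metric.eventually_nhds_iff_ball.1
    (hnear.and (h.isOpen_source.mem_nhds hx))
  have hpc : p ∈ closure Ωs := frontier_subset_closure (by
    rw [hpoly]; exact mem_iUnion.2 ⟨i, openSegment_subset_segment _ _ _ hpi⟩)
  have hpc' : p' ∈ closure Ωs := frontier_subset_closure (by
    rw [hpoly]; exact mem_iUnion.2 ⟨j, openSegment_subset_segment _ _ _ hpj⟩)
  exact ⟨p, p', e, e', ε, r,
    { toTransport := h
      eps_pos := hε
      r_pos := hr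
      left_mem := ⟨hp, hpc⟩
      right_mem := ⟨hp', hpc'⟩
      left_inner := hin₁
      right_inner := hin₂
      left_target := fun q hq => htar₁ q (ball_subset_ball h1 hq)
      right_target := fun q hq => htar₂ q (ball_subset_ball h2 hq)
      left_closure := fun q hq => hclo₁ q (ball_subset_ball h1 hq)
      right_closure := fun q hq => hclo₂ q (ball_subset_ball h2 hq)
      left_far := fun q hq => hfar₁ q (ball_subset_ball h3 hq)
      right_far := fun q hq => hfar₂ q (ball_subset_ball h4 hq)
      eps_le := h5
      mem_source := fun x hx => (hb x hx).2
      mem_near := fun x hx q hq => (hb x hx).1 hq }⟩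

end Transport

lemma mem_subdiff_of_inner_nonpos {u : E2 → ℝ} {x y p q : E2} (hp : p ∈ subdiff u x)
    (hq : q ∈ subdiff u y) (h : ⟪x - y, p - q⟫ ≤ 0) : p ∈ subdiff u y := by
  refine mem_subdiff_of_eq hp (le_antisymm ?_ (hp y))
  have h1 := hq x
  rw [inner_sub_right, real_inner_comm, real_inner_comm q] at h
  rw [← neg_sub x y, inner_neg_right]
  linarith

namespace Transport

variable {Ω Ωs : Set E2} {u : E2 → ℝ} {K : ℝ≥0}

lemma inner_pos (h : Transport Ω Ωs u K) {x y p q : E2} (hx : x ∈ Ω) (hp : p ∈ subdiff u x)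
    (hq : q ∈ subdiff u y) (hxy : x ≠ y) : 0 < ⟪x - y, p - q⟫ := by
  by_contra! hcon
  exact hxy (h.eq_of_mem_subdiff hx hp (mem_subdiff_of_inner_nonpos hp hq hcon))

end Transport

/-- `q` is a subgradient at `x` in the closed target, on the inner side of the line through `p`
with normal `e 1`. -/
def Sheet (Ωs : Set E2) (u : E2 → ℝ) (p : E2) (e : Frame) (x q : E2) : Prop :=
  q ∈ targetSubdiff Ωs u x ∧ 0 ≤ ⟪e 1, q - p⟫

namespace IsFold

variable {Ω Ωs : Set E2} {u : E2 → ℝ} {K : ℝ≥0} {x₀ p p' : E2} {e e' : Frame} {ε r : ℝ}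

lemma symm (h : IsFold Ω Ωs u K x₀ p p' e e' ε r) : IsFold Ω Ωs u K x₀ p' p e' e ε r where
  toTransport := h.toTransport
  eps_pos := h.eps_pos
  r_pos := h.r_pos
  left_mem := h.right_mem
  right_mem := h.left_mem
  left_inner := h.right_inner
  right_inner := h.left_inner
  left_target := h.right_target
  right_target := h.left_target
  left_closure := h.right_closure
  right_closure := h.left_closure
  left_far := h.right_far
  right_far := h.left_far
  eps_le := by rw [← norm_neg, neg_sub]; exact h.eps_le
  mem_source := h.mem_source
  mem_near := fun x hx q hq => (h.mem_near x hx q hq).symm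

lemma mem_ball_of_sheet (h : IsFold Ω Ωs u K x₀ p p' e e' ε r) {x q : E2} (hx : x ∈ ball x₀ r)
    (hq : Sheet Ωs u p e x q) : q ∈ ball p ε :=
  (h.mem_near x hx q hq.1).resolve_right fun h1 => (h.left_far q h1).not_ge hq.2

lemma sheet_or_sheet (h : IsFold Ω Ωs u K x₀ p p' e e' ε r) {x q : E2} (hx : x ∈ ball x₀ r)
    (hq : q ∈ targetSubdiff Ωs u x) : Sheet Ωs u p e x q ∨ Sheet Ωs u p' e' x q := by
  rcases h.mem_near x hx q hq with h1 | h1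
  · exact Or.inl ⟨hq, h.left_closure q h1 hq.2⟩
  · exact Or.inr ⟨hq, h.right_closure q h1 hq.2⟩

lemma subdiff_eq_singleton_of_sheet (h : IsFold Ω Ωs u K x₀ p p' e e' ε r) {x q : E2}
    (hx : x ∈ ball x₀ r) (hq : Sheet Ωs u p e x q) (hpos : 0 < ⟪e 1, q - p⟫) :
    subdiff u x = {q} :=
  h.subdiff_eq_singleton_of_mem_target (h.mem_source x hx) hq.1.1
    (h.left_target q (h.mem_ball_of_sheet hx hq) hpos)

lemma sheet_unique (h : IsFold Ω Ωs u K x₀ p p' e e' ε r) {x q q' : E2} (hx : x ∈ ball x₀ r)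
    (hq : Sheet Ωs u p e x q) (hq' : Sheet Ωs u p e x q') : q = q' := by
  rcases hq.2.eq_or_lt with h1 | h1
  swap
  · have h3 := hq'.1.1
    rw [h.subdiff_eq_singleton_of_sheet hx hq h1] at h3
    exact (mem_singleton_iff.1 h3).symm
  rcases hq'.2.eq_or_lt with h2 | h2
  swap
  · have h3 := hq.1.1
    rw [h.subdiff_eq_singleton_of_sheet hx hq' h2] at h3
    exact mem_singleton_iff.1 h3
  by_contra hne
  have hqb := h.mem_ball_of_sheet hx hq
  have hqb' := h.mem_ball_of_sheet hx hq'
  set c := (⟪e 0, q' - q⟫) / 2 with hc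
  have hdiff : q' - q = (2 * c) • e 0 := by
    refine e.ext_inner ?_ ?_
    · rw [real_inner_smul_right, Frame.inner_fst_fst, hc]; ring
    · rw [real_inner_smul_right, Frame.inner_snd_fst, mul_zero, inner_sub_right]
      rw [inner_sub_right] at h1 h2
      linarith
  have hc0 : 0 < |c| := by
    refine abs_pos.2 fun h0 => hne ?_
    rw [h0, mul_zero, zero_smul, sub_eq_zero] at hdiff
    exact hdiff.symm
  have hseg : ∀ s : ℝ, |s| ≤ |c| → q + c • e 0 + s • e 0 ∈ segment ℝ q q' := by
    intro s hs
    have hcne : c ≠ 0 := abs_pos.1 hc0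
    have h3 : |s / c| ≤ 1 := by rw [abs_div, div_le_one hc0]; exact hs
    rw [abs_le] at h3
    refine ⟨(1 - s / c) / 2, (1 + s / c) / 2, by linarith, by linarith, by ring, ?_⟩
    have h4 : q' = q + (2 * c) • e 0 := by rw [← hdiff]; abel
    have h5 : s = s / c * c := by field_simp
    rw [h4]
    conv_rhs => rw [h5]
    module
  have hmid : q + c • e 0 ∈ ball p ε := by
    have := hseg 0 (by simp)
    rw [zero_smul, add_zero] at this
    exact (convex_ball p ε).segment_subset hqb hqb' this
  obtain ⟨ε', hε', hb⟩ := Metric.isOpen_iff.1 isOpen_ball _ hmid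
  refine h.false_of_straight (h.mem_source x hx) e (q := q + c • e 0) hε' hc0
    (fun s hs => (convex_subdiff x).segment_subset hq.1.1 hq'.1.1 (hseg s hs))
    fun z hz hz1 => h.left_target z (hb hz) ?_
  have h6 : z - p = (z - (q + c • e 0)) + (q - p) + c • e 0 := by abel
  rw [h6, inner_add_right, inner_add_right, real_inner_smul_right, Frame.inner_snd_fst, ← h1]
  linarith

lemma not_differentiableAt_iff (h : IsFold Ω Ωs u K x₀ p p' e e' ε r) {x : E2}
    (hx : x ∈ ball x₀ r) :
    ¬ DifferentiableAt ℝ u x ↔ (∃ q, Sheet Ωs u p e x q) ∧ ∃ q', Sheet Ωs u p' e' x q' := by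
  constructor
  · intro hd
    obtain ⟨q, hq⟩ := h.targetSubdiff_nonempty x
    constructor
    · by_contra! hcon
      have hall : ∀ q ∈ targetSubdiff Ωs u x, Sheet Ωs u p' e' x q := fun q hq =>
        (h.sheet_or_sheet hx hq).resolve_left (hcon q)
      exact hd (h.differentiableAt_of_targetSubdiff_subset (p := q) fun q' hq' =>
        h.symm.sheet_unique hx (hall q' hq') (hall q hq))
    · by_contra! hcon
      have hall : ∀ q ∈ targetSubdiff Ωs u x, Sheet Ωs u p e x q := fun q hq =>
        (h.sheet_or_sheet hx hq).resolve_right (hcon q)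
      exact hd (h.differentiableAt_of_targetSubdiff_subset (p := q) fun q' hq' =>
        h.sheet_unique hx (hall q' hq') (hall q hq))
  · rintro ⟨⟨q, hq⟩, q', hq'⟩ hd
    have h1 := h.subdiff_eq_singleton hd
    have h2 : q = q' := by
      have h3 := h1 ▸ hq.1.1
      have h4 := h1 ▸ hq'.1.1
      exact (mem_singleton_iff.1 h3).trans (mem_singleton_iff.1 h4).symm
    subst h2
    exact (h.left_far q (h.symm.mem_ball_of_sheet hx hq')).not_ge hq.2

lemma inner_eq_zero_of_sheets (h : IsFold Ω Ωs u K x₀ p p' e e' ε r) {x q q' : E2}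
    (hx : x ∈ ball x₀ r) (hq : Sheet Ωs u p e x q) (hq' : Sheet Ωs u p' e' x q') :
    ⟪e 1, q - p⟫ = 0 := by
  refine (hq.2.eq_or_lt.resolve_right fun hpos => ?_).symm
  have h1 := h.subdiff_eq_singleton_of_sheet hx hq hpos
  have h2 : q' = q := mem_singleton_iff.1 (h1.subset hq'.1.1)
  subst h2
  exact (h.left_far q' (h.symm.mem_ball_of_sheet hx hq')).not_ge hq.2

end IsFold

/-- The closed half square of size `δ`. -/
def halfSquare (δ : ℝ) : Set ℂ := {w | |w.re| ≤ δ ∧ 0 ≤ w.im ∧ w.im ≤ δ}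

/-- The point with tangential coordinate `Re w` and normal coordinate `Im (F w)`. -/
def sourcePt (x₀ : E2) (e : Frame) (F : ℂ → ℂ) (w : ℂ) : E2 :=
  x₀ + w.re • e 0 + (F w).im • e 1

/-- The point with tangential coordinate `Re (F w)` and normal coordinate `Im w`. -/
def targetPt (p : E2) (e : Frame) (F : ℂ → ℂ) (w : ℂ) : E2 :=
  p + (F w).re • e 0 + w.im • e 1

/-- `F` is the function obtained from the (multivalued) gradient map on one sheet by exchanging the
normal coordinates in the source and in the target. -/
structure IsChart (Ω Ωs : Set E2) (u : E2 → ℝ) (K : ℝ≥0) (x₀ p : E2) (e : Frame) (F : ℂ → ℂ)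
    (r δ : ℝ) : Prop extends Transport Ω Ωs u K where
  pos : 0 < δ
  continuousOn : ContinuousOn F (halfSquare δ)
  source_mem : ∀ w ∈ halfSquare δ, sourcePt x₀ e F w ∈ Ω
  mem_subdiff : ∀ w ∈ halfSquare δ, targetPt p e F w ∈ subdiff u (sourcePt x₀ e F w)
  target_mem : ∀ w ∈ halfSquare δ, 0 < w.im → targetPt p e F w ∈ Ωs
  apply_eq : ∀ x ∈ closedBall x₀ (r / 2), ∀ q, Sheet Ωs u p e x q →
    F ⟨⟪e 0, x - x₀⟫, ⟪e 1, q - p⟫⟩ = ⟨⟪e 0, q - p⟫, ⟪e 1, x - x₀⟫⟩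

lemma exists_continuousOn_factor {X : Type*} [TopologicalSpace X] {S : Set X} (hS : IsCompact S)
    {z v : X → ℂ} (hz : Continuous z) (hv : Continuous v)
    (hinj : ∀ a ∈ S, ∀ b ∈ S, z a = z b → v a = v b) :
    ∃ F : ℂ → ℂ, ContinuousOn F (z '' S) ∧ ∀ a ∈ S, F (z a) = v a := by
  classical
  obtain ⟨F, hF⟩ : ∃ F : ℂ → ℂ, ∀ a ∈ S, F (z a) = v a := by
    refine ⟨fun w => if hw : ∃ a ∈ S, z a = w then v hw.choose else 0, fun a ha => ?_⟩
    have hw : ∃ b ∈ S, z b = z a := ⟨a, ha, rfl⟩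
    simp only [dif_pos hw]
    exact hinj _ hw.choose_spec.1 _ ha hw.choose_spec.2
  refine ⟨F, ?_, hF⟩
  rw [continuousOn_iff_isClosed]
  intro t ht
  refine ⟨z '' (S ∩ v ⁻¹' t), ((hS.inter_right (ht.preimage hv)).image hz).isClosed, ?_⟩
  ext w
  constructor
  · rintro ⟨hw, a, ha, rfl⟩
    refine ⟨⟨a, ⟨ha, ?_⟩, rfl⟩, a, ha, rfl⟩
    rw [mem_preimage, ← hF a ha]; exact hw
  · rintro ⟨⟨a, ⟨ha, hat⟩, rfl⟩, -⟩
    refine ⟨?_, a, ha, rfl⟩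
    rw [mem_preimage, hF a ha]; exact hat

namespace Transport

variable {Ω Ωs : Set E2} {u : E2 → ℝ} {K : ℝ≥0}

/-- One-sided first order condition at a local minimum along a line. -/
lemma exists_targetSubdiff_inner_ge_of_forall (h : Transport Ω Ωs u K) {x v : E2} {σ η : ℝ}
    (hη : 0 < η) (hmin : ∀ t : ℝ, 0 < t → t < η → u x + t * σ ≤ u (x + t • v)) :
    ∃ q ∈ targetSubdiff Ωs u x, σ ≤ ⟪v, q⟫ := by
  by_contra! hcon
  have h1 := h.eventually_targetSubdiff_subset (x := x) (U := {q | ⟪v, q⟫ < σ})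
    (isOpen_lt (by fun_prop) continuous_const) hcon
  have h2 : Filter.Tendsto (fun t : ℝ => x + t • v) (nhdsWithin 0 (Ioi 0)) (nhds x) := by
    have : Continuous fun t : ℝ => x + t • v := by fun_prop
    simpa using (this.tendsto 0).mono_left (nhdsWithin_le_nhds (s := Ioi 0))
  obtain ⟨t, ht1, ht0, htη⟩ := ((h2.eventually h1).and (Ioo_mem_nhdsGT hη)).exists
  obtain ⟨q, hq⟩ := h.targetSubdiff_nonempty (x + t • v)
  have h3 : ⟪v, q⟫ < σ := ht1 hq
  have h4 := hq.1 x
  rw [sub_add_cancel_left, inner_neg_right, real_inner_smul_right, real_inner_comm] at h4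
  have h5 := hmin t ht0 htη
  nlinarith

end Transport

namespace IsFold

variable {Ω Ωs : Set E2} {u : E2 → ℝ} {K : ℝ≥0} {x₀ p p' : E2} {e e' : Frame} {ε r : ℝ}

/-- Every pair of small coordinates, tangential in the source and normal in the target, is
attained on the sheet. -/
lemma exists_sheet_of_coord (h : IsFold Ω Ωs u K x₀ p p' e e' ε r) :
    ∃ δ > 0, ∀ w ∈ halfSquare δ, ∃ x ∈ closedBall x₀ (r / 2), ∃ q, Sheet Ωs u p e x q ∧
      ⟪e 0, x - x₀⟫ = w.re ∧ ⟪e 1, q - p⟫ = w.im := by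
  have hr := h.r_pos
  have hx₀ : x₀ ∈ Ω := h.mem_source x₀ (mem_ball_self hr)
  set η := r / 4 with hη
  have hη0 : 0 < η := by positivity
  have hstrict : ∀ y : ℝ, y ≠ 0 → u x₀ + y * ⟪e 1, p⟫ < u (x₀ + y • e 1) := by
    intro y hy
    have h1 := h.left_mem.1 (x₀ + y • e 1)
    rw [add_sub_cancel_left, real_inner_smul_right, real_inner_comm] at h1
    refine lt_of_le_of_ne h1 fun h2 => ?_
    have h3 := mem_subdiff_of_eq h.left_mem.1 (y := x₀ + y • e 1) (by
      rw [← h2, add_sub_cancel_left, real_inner_smul_right, real_inner_comm])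
    have h4 := h.eq_of_mem_subdiff hx₀ h.left_mem.1 h3
    have h5 : y • e 1 = 0 := by simpa using h4
    rcases smul_eq_zero.1 h5 with h6 | h6
    · exact hy h6
    · have := e.inner_snd_snd
      rw [h6, inner_zero_left] at this
      exact zero_ne_one this
  set φ : ℝ × ℝ → ℝ → ℝ := fun c y => u (x₀ + c.1 • e 0 + y • e 1) - (⟪e 1, p⟫ + c.2) * y with hφ
  have hu := h.continuous
  have hφc : ∀ y, Continuous fun c => φ c y := fun y => by simp only [hφ]; fun_prop
  have hev : ∀ y ≠ 0, ∀ᶠ c in nhds (0 : ℝ × ℝ), φ c 0 < φ c y := fun y hy => by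
    refine (hφc 0).continuousAt.eventually_lt (hφc y).continuousAt ?_
    have := hstrict y hy
    simp only [hφ, Prod.fst_zero, Prod.snd_zero, zero_smul, add_zero, mul_zero]
    linarith
  obtain ⟨δ₀, hδ₀, hb⟩ := Metric.eventually_nhds_iff_ball.1
    ((hev η hη0.ne').and (hev (-η) (neg_ne_zero.2 hη0.ne')))
  refine ⟨min (δ₀ / 2) (r / 4), lt_min (by linarith) (by linarith), fun w hw => ?_⟩
  obtain ⟨hw1, hw2, hw3⟩ := hw
  have hδ1 := min_le_left (δ₀ / 2) (r / 4)
  have hδ2 := min_le_right (δ₀ / 2) (r / 4)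
  obtain ⟨hlt1, hlt2⟩ := hb (w.re, w.im) (by
    rw [mem_ball_zero_iff, Prod.norm_def, max_lt_iff, Real.norm_eq_abs, Real.norm_eq_abs,
      abs_of_nonneg hw2]
    constructor <;> linarith)
  set c : ℝ × ℝ := (w.re, w.im) with hc
  obtain ⟨y, hy, hymin⟩ := isCompact_Icc.exists_isMinOn (s := Icc (-η) η) ⟨0, by
    constructor <;> linarith⟩ (f := φ c) (by simp only [hφ]; fun_prop)
  have hmin : ∀ t ∈ Icc (-η) η, φ c y ≤ φ c t := fun t ht => hymin ht
  have h0 := hmin 0 (by constructor <;> linarith)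
  have hy1 : y ≠ η := by rintro rfl; linarith
  have hy2 : y ≠ -η := by rintro rfl; linarith
  have hyl : -η < y := lt_of_le_of_ne hy.1 (Ne.symm hy2)
  have hyr : y < η := lt_of_le_of_ne hy.2 hy1
  set x := x₀ + c.1 • e 0 + y • e 1 with hx
  set σ := ⟪e 1, p⟫ + c.2 with hσ
  obtain ⟨q, hq, hqσ⟩ := h.exists_targetSubdiff_inner_ge_of_forall (x := x) (v := e 1) (σ := σ)
    (η := η - y) (by linarith) (fun t ht0 ht1 => by
      have h1 := hmin (y + t) ⟨by linarith, by linarith⟩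
      simp only [hφ, add_smul, ← add_assoc] at h1
      nlinarith)
  obtain ⟨q', hq', hqσ'⟩ := h.exists_targetSubdiff_inner_ge_of_forall (x := x) (v := -e 1)
    (σ := -σ) (η := y + η) (by linarith) (fun t ht0 ht1 => by
      have h1 := hmin (y - t) ⟨by linarith, by linarith⟩
      simp only [hφ, sub_smul, ← add_sub_assoc] at h1
      rw [smul_neg, ← sub_eq_add_neg]
      nlinarith)
  have hxx : x - x₀ = c.1 • e 0 + y • e 1 := by rw [hx]; abel
  have hxin0 : ⟪e 0, x - x₀⟫ = w.re := by
    rw [hxx, inner_add_right, real_inner_smul_right, real_inner_smul_right]; simp [hc]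
  have hxin1 : ⟪e 1, x - x₀⟫ = y := by
    rw [hxx, inner_add_right, real_inner_smul_right, real_inner_smul_right]; simp
  have hxc : x ∈ closedBall x₀ (r / 2) := by
    rw [mem_closedBall, dist_eq_norm]
    refine (e.norm_le_add_abs _).trans ?_
    rw [hxin0, hxin1]
    have := abs_le.2 hy
    linarith
  have hxb : x ∈ ball x₀ r := closedBall_subset_ball (by linarith) hxc
  have hqs : Sheet Ωs u p e x q := by
    refine ⟨hq, ?_⟩
    rw [inner_sub_right]; linarith
  refine ⟨x, hxc, q, hqs, hxin0, ?_⟩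
  have h1 : w.im ≤ ⟪e 1, q - p⟫ := by rw [inner_sub_right]; linarith
  refine le_antisymm ?_ h1
  rcases hqs.2.eq_or_lt with h2 | h2
  · rw [← h2]; exact hw2
  · have h3 := hq'.1
    rw [h.subdiff_eq_singleton_of_sheet hxb hqs h2, mem_singleton_iff] at h3
    subst h3
    rw [inner_neg_left] at hqσ'
    rw [inner_sub_right]; linarith

lemma exists_isChart (h : IsFold Ω Ωs u K x₀ p p' e e' ε r) :
    ∃ F δ, IsChart Ω Ωs u K x₀ p e F r δ := by
  have hr := h.r_pos
  have hball : ∀ x ∈ closedBall x₀ (r / 2), x ∈ ball x₀ r := fun x hx =>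
    closedBall_subset_ball (by linarith) hx
  obtain ⟨S, hS⟩ : ∃ S : Set (E2 × E2), ∀ x q, (x, q) ∈ S ↔
      x ∈ closedBall x₀ (r / 2) ∧ Sheet Ωs u p e x q :=
    ⟨{P | P.1 ∈ closedBall x₀ (r / 2) ∧ Sheet Ωs u p e P.1 P.2}, fun _ _ => Iff.rfl⟩
  have hSc : IsCompact S := by
    have hc : Continuous fun P : E2 × E2 => ⟪e 1, P.2 - p⟫ := by fun_prop
    have hSe : S = (Prod.fst ⁻¹' closedBall x₀ (r / 2)) ∩
        ({P : E2 × E2 | P.2 ∈ targetSubdiff Ωs u P.1} ∩ (fun P : E2 × E2 => ⟪e 1, P.2 - p⟫) ⁻¹' Ici 0) :=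
      Set.ext fun P => hS P.1 P.2
    refine ((isCompact_closedBall x₀ (r / 2)).prod (isCompact_closedBall (0 : E2) K)).of_isClosed_subset
      ?_ ?_
    · rw [hSe]
      exact (isClosed_closedBall.preimage continuous_fst).inter
        (h.isClosed_graph.inter (isClosed_Ici.preimage hc))
    · rintro ⟨x, q⟩ hxq
      obtain ⟨hx, hq⟩ := (hS x q).1 hxq
      exact ⟨hx, mem_closedBall_zero_iff.2 (h.norm_le hq.1.1)⟩
  have hcont : ∀ {f g : E2 × E2 → ℝ}, Continuous f → Continuous g →
      Continuous fun P => (⟨f P, g P⟩ : ℂ) := fun hf hg =>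
    Complex.equivRealProdCLM.symm.continuous.comp (hf.prodMk hg)
  obtain ⟨z, hz⟩ : ∃ z : E2 × E2 → ℂ, ∀ x q, z (x, q) = ⟨⟪e 0, x - x₀⟫, ⟪e 1, q - p⟫⟩ :=
    ⟨fun P => ⟨⟪e 0, P.1 - x₀⟫, ⟪e 1, P.2 - p⟫⟩, fun _ _ => rfl⟩
  obtain ⟨v, hv⟩ : ∃ v : E2 × E2 → ℂ, ∀ x q, v (x, q) = ⟨⟪e 0, q - p⟫, ⟪e 1, x - x₀⟫⟩ :=
    ⟨fun P => ⟨⟪e 0, P.2 - p⟫, ⟪e 1, P.1 - x₀⟫⟩, fun _ _ => rfl⟩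
  have hzc : Continuous z := by
    have : z = fun P => ⟨⟪e 0, P.1 - x₀⟫, ⟪e 1, P.2 - p⟫⟩ := funext fun P => hz P.1 P.2
    rw [this]; exact hcont (by fun_prop) (by fun_prop)
  have hvc : Continuous v := by
    have : v = fun P => ⟨⟪e 0, P.2 - p⟫, ⟪e 1, P.1 - x₀⟫⟩ := funext fun P => hv P.1 P.2
    rw [this]; exact hcont (by fun_prop) (by fun_prop)
  obtain ⟨F, hF, hFv⟩ := exists_continuousOn_factor hSc hzc hvc (by
      rintro ⟨x, q⟩ hxq ⟨y, q'⟩ hyq hzz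
      obtain ⟨hx, hq⟩ := (hS x q).1 hxq
      obtain ⟨hy, hq'⟩ := (hS y q').1 hyq
      rw [hz, hz] at hzz
      have h1 : ⟪e 0, x - x₀⟫ = ⟪e 0, y - x₀⟫ := congrArg Complex.re hzz
      have h2 : ⟪e 1, q - p⟫ = ⟪e 1, q' - p⟫ := congrArg Complex.im hzz
      have hxy : x = y := by
        by_contra hne
        have h3 := h.inner_pos (h.mem_source x (hball x hx)) hq.1.1 hq'.1.1 hne
        rw [e.inner_eq, inner_sub_right, inner_sub_right (e 1) q] at h3
        rw [inner_sub_right, inner_sub_right] at h1 h2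
        rw [show ⟪e 0, x⟫ - ⟪e 0, y⟫ = 0 by linarith, show ⟪e 1, q⟫ - ⟪e 1, q'⟫ = 0 by linarith] at h3
        simp at h3
      subst hxy
      obtain rfl := h.sheet_unique (hball x hx) hq hq'
      rfl)
  obtain ⟨δ, hδ, hsurj⟩ := h.exists_sheet_of_coord
  have hkey : ∀ w ∈ halfSquare δ, w ∈ z '' S ∧ sourcePt x₀ e F w ∈ ball x₀ r ∧
      Sheet Ωs u p e (sourcePt x₀ e F w) (targetPt p e F w) := by
    intro w hw
    obtain ⟨x, hx, q, hq, h1, h2⟩ := hsurj w hw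
    have hzw : z (x, q) = w := by rw [hz]; exact Complex.ext h1 h2
    have hFw : F w = v (x, q) := by rw [← hzw]; exact hFv (x, q) ((hS x q).2 ⟨hx, hq⟩)
    have h3 : sourcePt x₀ e F w = x := by
      unfold sourcePt
      rw [hFw, hv, ← h1, add_assoc, ← e.eq_smul_add_smul (x - x₀)]; abel
    have h4 : targetPt p e F w = q := by
      unfold targetPt
      rw [hFw, hv, ← h2, add_assoc, ← e.eq_smul_add_smul (q - p)]; abel
    rw [h3, h4]
    exact ⟨⟨(x, q), (hS x q).2 ⟨hx, hq⟩, hzw⟩, hball x hx, hq⟩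
  refine ⟨F, δ, ⟨h.toTransport, hδ, hF.mono fun w hw => (hkey w hw).1,
    fun w hw => h.mem_source _ (hkey w hw).2.1, fun w hw => (hkey w hw).2.2.1.1,
    fun w hw hpos => ?_, fun x hx q hq => ?_⟩⟩
  swap
  · rw [← hz, ← hv]
    exact hFv (x, q) ((hS x q).2 ⟨hx, hq⟩)
  obtain ⟨-, h1, h2⟩ := hkey w hw
  refine h.left_target _ (h.mem_ball_of_sheet h1 h2) ?_
  unfold targetPt
  rw [add_assoc, add_sub_cancel_left, inner_add_right, real_inner_smul_right, real_inner_smul_right]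
  simpa using hpos

end IsFold

/-- A function lying above its tangents with continuous slope `g` has derivative `g`. -/
lemma hasDerivAt_of_forall_le {f g : ℝ → ℝ} {a : ℝ} (hg : ContinuousAt g a)
    (h1 : ∀ᶠ b in nhds a, f a + g a * (b - a) ≤ f b)
    (h2 : ∀ᶠ b in nhds a, f b + g b * (a - b) ≤ f a) : HasDerivAt f (g a) a := by
  rw [hasDerivAt_iff_isLittleO, Asymptotics.isLittleO_iff]
  intro c hc
  filter_upwards [h1, h2, Metric.continuousAt_iff'.1 hg c hc] with b hb1 hb2 hb3
  rw [Real.dist_eq] at hb3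
  rw [smul_eq_mul, Real.norm_eq_abs, Real.norm_eq_abs, abs_of_nonneg (by linarith)]
  calc f b - f a - (b - a) * g a ≤ (g b - g a) * (b - a) := by linarith
    _ ≤ |(g b - g a) * (b - a)| := le_abs_self _
    _ = |g b - g a| * |b - a| := abs_mul _ _
    _ ≤ c * |b - a| := by gcongr

namespace Frame

lemma exists_swap (e : Frame) : ∃ f : Frame, f 0 = e 1 ∧ f 1 = e 0 :=
  exists_eq (by simp) (by simp) (by simp)

lemma measurableSet_and_volume_region_of_continuous (e : Frame) {X₀ : E2} {a b : ℝ} {f g : ℝ → ℝ}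
    (hab : a ≤ b) (hf : Continuous f) (hg : Continuous g) (hfg : ∀ t ∈ Icc a b, f t ≤ g t) :
    MeasurableSet {X : E2 | ⟪e 0, X - X₀⟫ ∈ Icc a b ∧
      ⟪e 1, X - X₀⟫ ∈ Icc (f ⟪e 0, X - X₀⟫) (g ⟪e 0, X - X₀⟫)} ∧
    volume {X : E2 | ⟪e 0, X - X₀⟫ ∈ Icc a b ∧
      ⟪e 1, X - X₀⟫ ∈ Icc (f ⟪e 0, X - X₀⟫) (g ⟪e 0, X - X₀⟫)} =
      ENNReal.ofReal (∫ t in a..b, (g t - f t)) := by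
  set S : Set (ℝ × ℝ) := {P | P.1 ∈ Icc a b ∧ P.2 ∈ Icc (f P.1) (g P.1)} with hS
  have hSc : IsClosed S := by
    have h1 : IsClosed {P : ℝ × ℝ | f P.1 ≤ P.2} := isClosed_le (by fun_prop) (by fun_prop)
    have h2 : IsClosed {P : ℝ × ℝ | P.2 ≤ g P.1} := isClosed_le (by fun_prop) (by fun_prop)
    exact (isClosed_Icc.preimage continuous_fst).inter (h1.inter h2)
  have hSm := hSc.measurableSet
  have heq : {X : E2 | ⟪e 0, X - X₀⟫ ∈ Icc a b ∧
      ⟪e 1, X - X₀⟫ ∈ Icc (f ⟪e 0, X - X₀⟫) (g ⟪e 0, X - X₀⟫)} =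
      (fun X => X - X₀) ⁻¹' (e.coord ⁻¹' S) := rfl
  have hm : MeasurableSet (e.coord ⁻¹' S) := (e.continuous_coord.measurable hSm)
  rw [heq]
  refine ⟨(measurePreserving_sub_right volume X₀).measurable hm, ?_⟩
  rw [(measurePreserving_sub_right volume X₀).measure_preimage hm.nullMeasurableSet,
    e.volume_coord_preimage hSm, Measure.volume_eq_prod, Measure.prod_apply hSm]
  have hslice : ∀ t : ℝ, volume (Prod.mk t ⁻¹' S) =
      (Icc a b).indicator (fun t => ENNReal.ofReal (g t - f t)) t := by
    intro t
    by_cases ht : t ∈ Icc a b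
    · rw [indicator_of_mem ht, ← Real.volume_Icc]
      congr 1
      ext y
      exact ⟨fun hy => hy.2, fun hy => ⟨ht, hy⟩⟩
    · rw [indicator_of_notMem ht]
      have : Prod.mk t ⁻¹' S = ∅ := by
        ext y
        exact ⟨fun hy => ht hy.1, fun hy => hy.elim⟩
      rw [this, measure_empty]
  simp_rw [hslice]
  rw [lintegral_indicator measurableSet_Icc, intervalIntegral.integral_of_le hab,
    ← integral_Icc_eq_integral_Ioc, ofReal_integral_eq_lintegral_ofReal]
  · exact (hg.sub hf).integrableOn_Icc
  · exact (ae_restrict_iff' measurableSet_Icc).2 (Filter.Eventually.of_forall fun t ht =>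
      sub_nonneg.2 (hfg t ht))

lemma measurableSet_and_volume_region (e : Frame) {X₀ : E2} {a b : ℝ} {f g : ℝ → ℝ}
    (hab : a ≤ b) (hf : ContinuousOn f (Icc a b)) (hg : ContinuousOn g (Icc a b))
    (hfg : ∀ t ∈ Icc a b, f t ≤ g t) :
    MeasurableSet {X : E2 | ⟪e 0, X - X₀⟫ ∈ Icc a b ∧
      ⟪e 1, X - X₀⟫ ∈ Icc (f ⟪e 0, X - X₀⟫) (g ⟪e 0, X - X₀⟫)} ∧
    volume {X : E2 | ⟪e 0, X - X₀⟫ ∈ Icc a b ∧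
      ⟪e 1, X - X₀⟫ ∈ Icc (f ⟪e 0, X - X₀⟫) (g ⟪e 0, X - X₀⟫)} =
      ENNReal.ofReal (∫ t in a..b, (g t - f t)) := by
  have hext : ∀ {k : ℝ → ℝ}, ContinuousOn k (Icc a b) → ∃ k' : ℝ → ℝ, Continuous k' ∧
      ∀ t ∈ Icc a b, k' t = k t := fun {k} hk =>
    ⟨IccExtend hab ((Icc a b).domRestrict k),
      (continuousOn_iff_continuous_domRestrict.1 hk).Icc_extend', fun t ht => by
        rw [IccExtend_of_mem _ _ ht, domRestrict_apply]⟩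
  obtain ⟨f', hf', hff'⟩ := hext hf
  obtain ⟨g', hg', hgg'⟩ := hext hg
  have hset : {X : E2 | ⟪e 0, X - X₀⟫ ∈ Icc a b ∧
      ⟪e 1, X - X₀⟫ ∈ Icc (f ⟪e 0, X - X₀⟫) (g ⟪e 0, X - X₀⟫)} =
      {X : E2 | ⟪e 0, X - X₀⟫ ∈ Icc a b ∧
      ⟪e 1, X - X₀⟫ ∈ Icc (f' ⟪e 0, X - X₀⟫) (g' ⟪e 0, X - X₀⟫)} := by
    ext X
    refine and_congr_right fun hX => ?_
    rw [hff' _ hX, hgg' _ hX]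
  have hintegral : ∫ t in a..b, (g t - f t) = ∫ t in a..b, (g' t - f' t) := by
    refine intervalIntegral.integral_congr fun t ht => ?_
    rw [uIcc_of_le hab] at ht
    simp only [hff' t ht, hgg' t ht]
  rw [hset, hintegral]
  exact e.measurableSet_and_volume_region_of_continuous hab hf' hg' fun t ht => by
    rw [hff' t ht, hgg' t ht]; exact hfg t ht

end Frame

namespace IsChart

open Complex in
lemma conservative_aux {F : ℂ → ℂ} {a₁ a₂ s₁ s₂ : ℝ} (hF : ContinuousOn F (uIcc a₁ a₂ ×ℂ uIcc s₁ s₂))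
    (hre : (∫ a in a₁..a₂, (F (a + s₁ * I)).re) - (∫ a in a₁..a₂, (F (a + s₂ * I)).re) =
      (∫ s in s₁..s₂, (F (a₂ + s * I)).im) - ∫ s in s₁..s₂, (F (a₁ + s * I)).im)
    (him : (∫ a in a₁..a₂, (F (a + s₂ * I)).im) - (∫ a in a₁..a₂, (F (a + s₁ * I)).im) =
      (∫ s in s₁..s₂, (F (a₂ + s * I)).re) - ∫ s in s₁..s₂, (F (a₁ + s * I)).re) :
    (∫ a in a₁..a₂, F (a + s₁ * I)) - (∫ a in a₁..a₂, F (a + s₂ * I)) +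
      I • (∫ s in s₁..s₂, F (a₂ + s * I)) - I • (∫ s in s₁..s₂, F (a₁ + s * I)) = 0 := by
  have hh : ∀ s ∈ uIcc s₁ s₂, IntervalIntegrable (fun a : ℝ => F (a + s * I)) volume a₁ a₂ :=
    fun s hs => (hF.comp (by fun_prop) fun a ha => by simpa [mem_reProdIm] using ⟨ha, hs⟩).intervalIntegrable
  have hv : ∀ a ∈ uIcc a₁ a₂, IntervalIntegrable (fun s : ℝ => F (a + s * I)) volume s₁ s₂ :=
    fun a ha => (hF.comp (by fun_prop) fun s hs => by simpa [mem_reProdIm] using ⟨ha, hs⟩).intervalIntegrable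
  have r1 := reCLM.intervalIntegral_comp_comm (hh s₁ left_mem_uIcc)
  have r2 := reCLM.intervalIntegral_comp_comm (hh s₂ right_mem_uIcc)
  have r3 := reCLM.intervalIntegral_comp_comm (hv a₁ left_mem_uIcc)
  have r4 := reCLM.intervalIntegral_comp_comm (hv a₂ right_mem_uIcc)
  have i1 := imCLM.intervalIntegral_comp_comm (hh s₁ left_mem_uIcc)
  have i2 := imCLM.intervalIntegral_comp_comm (hh s₂ right_mem_uIcc)
  have i3 := imCLM.intervalIntegral_comp_comm (hv a₁ left_mem_uIcc)
  have i4 := imCLM.intervalIntegral_comp_comm (hv a₂ right_mem_uIcc)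
  simp only [reCLM_apply, imCLM_apply] at r1 r2 r3 r4 i1 i2 i3 i4
  apply Complex.ext
  · simp only [smul_eq_mul, add_re, sub_re, mul_re, I_re, I_im, zero_re]
    linarith
  · simp only [smul_eq_mul, add_im, sub_im, mul_im, I_re, I_im, zero_im]
    linarith

variable {Ω Ωs : Set E2} {u : E2 → ℝ} {K : ℝ≥0} {x₀ p : E2} {e : Frame} {F : ℂ → ℂ} {r δ : ℝ}

lemma sourcePt_sub (w w' : ℂ) : sourcePt x₀ e F w - sourcePt x₀ e F w' =
    (w.re - w'.re) • e 0 + ((F w).im - (F w').im) • e 1 := by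
  unfold sourcePt; module

lemma targetPt_sub (w w' : ℂ) : targetPt p e F w - targetPt p e F w' =
    ((F w).re - (F w').re) • e 0 + (w.im - w'.im) • e 1 := by
  unfold targetPt; module

lemma monotone (h : IsChart Ω Ωs u K x₀ p e F r δ) {w w' : ℂ} (hw : w ∈ halfSquare δ)
    (hw' : w' ∈ halfSquare δ) :
    0 ≤ (w.re - w'.re) * ((F w).re - (F w').re) + ((F w).im - (F w').im) * (w.im - w'.im) := by
  have h1 := subdiff_monotone (h.mem_subdiff w hw) (h.mem_subdiff w' hw')
  rw [e.inner_eq, sourcePt_sub, targetPt_sub] at h1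
  simpa [inner_add_right, real_inner_smul_right] using h1

/-- The partial Legendre transform of `u` in the chart. -/
def potential (u : E2 → ℝ) (x₀ p : E2) (e : Frame) (F : ℂ → ℂ) (w : ℂ) : ℝ :=
  u (sourcePt x₀ e F w) - (w.im + ⟪e 1, p⟫) * (F w).im

lemma potential_le (h : IsChart Ω Ωs u K x₀ p e F r δ) {w : ℂ} (hw : w ∈ halfSquare δ)
    (w' : ℂ) :
    potential u x₀ p e F w + ((F w).re + ⟪e 0, p⟫) * (w'.re - w.re) - (w'.im - w.im) * (F w').im ≤
      potential u x₀ p e F w' := by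
  have h1 := h.mem_subdiff w hw (sourcePt x₀ e F w')
  rw [sourcePt_sub, inner_add_right, real_inner_smul_right, real_inner_smul_right, real_inner_comm,
    real_inner_comm (e 1)] at h1
  have h2 : ⟪e 0, targetPt p e F w⟫ = ⟪e 0, p⟫ + (F w).re := by
    unfold targetPt; simp [inner_add_right, real_inner_smul_right]
  have h3 : ⟪e 1, targetPt p e F w⟫ = ⟪e 1, p⟫ + w.im := by
    unfold targetPt; simp [inner_add_right, real_inner_smul_right]
  rw [h2, h3] at h1
  unfold potential
  linarith

/-- The open half square. -/
def openHalfSquare (δ : ℝ) : Set ℂ := {w | |w.re| < δ ∧ 0 < w.im ∧ w.im < δ}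

lemma isOpen_openHalfSquare (δ : ℝ) : IsOpen (openHalfSquare δ) := by
  have h1 : IsOpen {w : ℂ | |w.re| < δ} := isOpen_lt (by fun_prop) (by fun_prop)
  have h2 : IsOpen {w : ℂ | 0 < w.im} := isOpen_lt (by fun_prop) (by fun_prop)
  have h3 : IsOpen {w : ℂ | w.im < δ} := isOpen_lt (by fun_prop) (by fun_prop)
  exact h1.inter (h2.inter h3)

lemma openHalfSquare_subset (δ : ℝ) : openHalfSquare δ ⊆ halfSquare δ :=
  fun _ hw => ⟨hw.1.le, hw.2.1.le, hw.2.2.le⟩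

lemma continuousAt (h : IsChart Ω Ωs u K x₀ p e F r δ) {w : ℂ} (hw : w ∈ openHalfSquare δ) :
    ContinuousAt F w :=
  h.continuousOn.continuousAt (Filter.mem_of_superset ((isOpen_openHalfSquare δ).mem_nhds hw)
    (openHalfSquare_subset δ))

lemma hasDerivAt_potential_re (h : IsChart Ω Ωs u K x₀ p e F r δ) {a s : ℝ}
    (hw : (a + s * Complex.I : ℂ) ∈ openHalfSquare δ) :
    HasDerivAt (fun a : ℝ => potential u x₀ p e F (a + s * Complex.I))
      ((F (a + s * Complex.I)).re + ⟪e 0, p⟫) a := by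
  have hc : ContinuousAt (fun a : ℝ => (a + s * Complex.I : ℂ)) a := by fun_prop
  have hF : ContinuousAt (fun a : ℝ => F (a + s * Complex.I)) a :=
    (h.continuousAt hw).comp (f := fun a : ℝ => (a + s * Complex.I : ℂ)) hc
  have hev := hc.eventually ((isOpen_openHalfSquare δ).mem_nhds hw)
  refine hasDerivAt_of_forall_le (g := fun a : ℝ => (F (a + s * Complex.I)).re + ⟪e 0, p⟫)
    ((Complex.continuous_re.continuousAt.comp hF).add continuousAt_const) ?_ ?_
  · refine Filter.Eventually.of_forall fun b => ?_
    have := h.potential_le (openHalfSquare_subset δ hw) (b + s * Complex.I)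
    simpa using this
  · filter_upwards [hev] with b hb
    have := h.potential_le (openHalfSquare_subset δ hb) (a + s * Complex.I)
    simpa using this

lemma hasDerivAt_potential_im (h : IsChart Ω Ωs u K x₀ p e F r δ) {a s : ℝ}
    (hw : (a + s * Complex.I : ℂ) ∈ openHalfSquare δ) :
    HasDerivAt (fun s : ℝ => -potential u x₀ p e F (a + s * Complex.I))
      (F (a + s * Complex.I)).im s := by
  have hc : ContinuousAt (fun s : ℝ => (a + s * Complex.I : ℂ)) s := by fun_prop
  have hF : ContinuousAt (fun s : ℝ => F (a + s * Complex.I)) s :=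
    (h.continuousAt hw).comp (f := fun s : ℝ => (a + s * Complex.I : ℂ)) hc
  have hev := hc.eventually ((isOpen_openHalfSquare δ).mem_nhds hw)
  refine hasDerivAt_of_forall_le (g := fun s : ℝ => (F (a + s * Complex.I)).im)
    (Complex.continuous_im.continuousAt.comp hF) ?_ ?_
  · filter_upwards [hev] with b hb
    have := h.potential_le (openHalfSquare_subset δ hb) (a + s * Complex.I)
    simp at this
    linarith
  · refine Filter.Eventually.of_forall fun b => ?_
    have := h.potential_le (openHalfSquare_subset δ hw) (a + b * Complex.I)
    simp at this
    linarith

end IsChart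

namespace IsChart

variable {Ω Ωs : Set E2} {u : E2 → ℝ} {K : ℝ≥0} {x₀ p : E2} {e : Frame} {F : ℂ → ℂ} {r δ : ℝ}

lemma inner_sourcePt (w : ℂ) : ⟪e 0, sourcePt x₀ e F w - x₀⟫ = w.re ∧
    ⟪e 1, sourcePt x₀ e F w - x₀⟫ = (F w).im := by
  unfold sourcePt
  rw [add_assoc, add_sub_cancel_left, inner_add_right, inner_add_right]
  simp [real_inner_smul_right]

lemma inner_targetPt (w : ℂ) : ⟪e 0, targetPt p e F w - p⟫ = (F w).re ∧
    ⟪e 1, targetPt p e F w - p⟫ = w.im := by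
  unfold targetPt
  rw [add_assoc, add_sub_cancel_left, inner_add_right, inner_add_right]
  simp [real_inner_smul_right]

/-- The gradient map preserves the area of coordinate rectangles. -/
lemma integral_im_eq_integral_re (h : IsChart Ω Ωs u K x₀ p e F r δ) {a₁ a₂ s₁ s₂ : ℝ}
    (ha : a₁ ≤ a₂) (hs : s₁ ≤ s₂)
    (hw : ∀ a ∈ Icc a₁ a₂, ∀ s ∈ Icc s₁ s₂, (a + s * Complex.I : ℂ) ∈ openHalfSquare δ) :
    ∫ a in a₁..a₂, ((F (a + s₂ * Complex.I)).im - (F (a + s₁ * Complex.I)).im) =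
      ∫ s in s₁..s₂, ((F (a₂ + s * Complex.I)).re - (F (a₁ + s * Complex.I)).re) := by
  have hw' : ∀ a ∈ Icc a₁ a₂, ∀ s ∈ Icc s₁ s₂, (a + s * Complex.I : ℂ) ∈ halfSquare δ :=
    fun a ha s hs => openHalfSquare_subset δ (hw a ha s hs)
  have hch : ∀ s ∈ Icc s₁ s₂, ContinuousOn (fun a : ℝ => F (a + s * Complex.I)) (Icc a₁ a₂) :=
    fun s hs => h.continuousOn.comp (by fun_prop) fun a ha => hw' a ha s hs
  have hcv : ∀ a ∈ Icc a₁ a₂, ContinuousOn (fun s : ℝ => F (a + s * Complex.I)) (Icc s₁ s₂) :=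
    fun a ha => h.continuousOn.comp (by fun_prop) fun s hs => hw' a ha s hs
  have hmv : ∀ a ∈ Icc a₁ a₂, ∀ s ∈ Icc s₁ s₂, ∀ s' ∈ Icc s₁ s₂, s ≤ s' →
      (F (a + s * Complex.I)).im ≤ (F (a + s' * Complex.I)).im := by
    intro a ha s hs s' hs' hss
    rcases hss.eq_or_lt with rfl | hlt
    · exact le_rfl
    have := h.monotone (hw' a ha s hs) (hw' a ha s' hs')
    simp only [Complex.add_re, Complex.ofReal_re, Complex.mul_re, Complex.I_re, Complex.I_im,
      Complex.add_im, Complex.ofReal_im, Complex.mul_im] at this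
    nlinarith
  have hmh : ∀ s ∈ Icc s₁ s₂, ∀ a ∈ Icc a₁ a₂, ∀ a' ∈ Icc a₁ a₂, a ≤ a' →
      (F (a + s * Complex.I)).re ≤ (F (a' + s * Complex.I)).re := by
    intro s hs a ha a' ha' hss
    rcases hss.eq_or_lt with rfl | hlt
    · exact le_rfl
    have := h.monotone (hw' a ha s hs) (hw' a' ha' s hs)
    simp only [Complex.add_re, Complex.ofReal_re, Complex.mul_re, Complex.I_re, Complex.I_im,
      Complex.add_im, Complex.ofReal_im, Complex.mul_im] at this
    nlinarith
  have hla := left_mem_Icc.2 ha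
  have hra := right_mem_Icc.2 ha
  have hls := left_mem_Icc.2 hs
  have hrs := right_mem_Icc.2 hs
  obtain ⟨f, hf0, hf1⟩ := e.exists_swap
  obtain ⟨hXm, hX⟩ := e.measurableSet_and_volume_region (X₀ := x₀) ha
    (Complex.continuous_im.comp_continuousOn (hch s₁ hls))
    (Complex.continuous_im.comp_continuousOn (hch s₂ hrs))
    (fun a ha => hmv a ha s₁ hls s₂ hrs hs)
  obtain ⟨hPm, hP⟩ := f.measurableSet_and_volume_region (X₀ := p) hs
    (Complex.continuous_re.comp_continuousOn (hcv a₁ hla))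
    (Complex.continuous_re.comp_continuousOn (hcv a₂ hra))
    (fun s hs => hmh s hs a₁ hla a₂ hra ha)
  simp only [hf0, hf1, Function.comp_apply] at hX hP hPm
  have hparam : ∀ q : E2, ⟪e 1, q - p⟫ ∈ Icc s₁ s₂ →
      ⟪e 0, q - p⟫ ∈ Icc (F (a₁ + ⟪e 1, q - p⟫ * Complex.I)).re
        (F (a₂ + ⟪e 1, q - p⟫ * Complex.I)).re →
      ∃ a ∈ Icc a₁ a₂, q = targetPt p e F (a + ⟪e 1, q - p⟫ * Complex.I) := by
    intro q hq1 hq2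
    obtain ⟨a, ha', haq⟩ := intermediate_value_Icc ha
      (Complex.continuous_re.comp_continuousOn (hch _ hq1)) hq2
    refine ⟨a, ha', ?_⟩
    have h1 := inner_targetPt (p := p) (e := e) (F := F) (a + ⟪e 1, q - p⟫ * Complex.I)
    have h2 : q - p = targetPt p e F (a + ⟪e 1, q - p⟫ * Complex.I) - p := by
      refine e.ext_inner ?_ ?_
      · rw [h1.1]; exact haq.symm
      · rw [h1.2]; simp
    exact sub_left_injective h2
  have hpre := h.volume_preimage _ hPm
  rw [inter_eq_left.2 (by
    rintro q ⟨hq1, hq2⟩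
    obtain ⟨a, ha', haq⟩ := hparam q hq1 hq2
    rw [haq]
    have := hw a ha' _ hq1
    exact h.target_mem _ (openHalfSquare_subset δ this) this.2.1), hP] at hpre
  have hset : {x ∈ Ω | DifferentiableAt ℝ u x ∧ gradient u x ∈ {X : E2 | ⟪e 1, X - p⟫ ∈ Icc s₁ s₂ ∧
      ⟪e 0, X - p⟫ ∈ Icc (F (a₁ + ⟪e 1, X - p⟫ * Complex.I)).re
        (F (a₂ + ⟪e 1, X - p⟫ * Complex.I)).re}} =
      {X : E2 | ⟪e 0, X - x₀⟫ ∈ Icc a₁ a₂ ∧ ⟪e 1, X - x₀⟫ ∈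
        Icc (F (⟪e 0, X - x₀⟫ + s₁ * Complex.I)).im (F (⟪e 0, X - x₀⟫ + s₂ * Complex.I)).im} := by
    ext X
    constructor
    · rintro ⟨hXΩ, hd, hq1, hq2⟩
      obtain ⟨a, ha', haq⟩ := hparam _ hq1 hq2
      have hmem := hw' a ha' _ hq1
      have hX : X = sourcePt x₀ e F (a + ⟪e 1, gradient u X - p⟫ * Complex.I) := by
        refine h.eq_of_mem_subdiff hXΩ (gradient_mem_subdiff h.convexOn hd) ?_
        have := h.mem_subdiff _ hmem
        rwa [← haq] at this
      generalize ⟪e 1, gradient u X - p⟫ = s at *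
      have h1 := inner_sourcePt (x₀ := x₀) (e := e) (F := F) (a + s * Complex.I)
      rw [← hX] at h1
      have h2 : ⟪e 0, X - x₀⟫ = a := by rw [h1.1]; simp
      rw [mem_ofPred_eq, h2, h1.2]
      exact ⟨ha', hmv a ha' s₁ hls s hq1 hq1.1, hmv a ha' s hq1 s₂ hrs hq1.2⟩
    · rintro ⟨hX1, hX2⟩
      generalize hagen : ⟪e 0, X - x₀⟫ = a at hX1 hX2
      obtain ⟨s, hs', hsX⟩ := intermediate_value_Icc hs
        (Complex.continuous_im.comp_continuousOn (hcv a hX1)) hX2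
      have hmem := hw a hX1 s hs'
      have hmem' := openHalfSquare_subset δ hmem
      have h1 := inner_sourcePt (x₀ := x₀) (e := e) (F := F) (a + s * Complex.I)
      have hXs : X = sourcePt x₀ e F (a + s * Complex.I) := by
        have h2 : X - x₀ = sourcePt x₀ e F (a + s * Complex.I) - x₀ := by
          refine e.ext_inner ?_ ?_
          · rw [h1.1, hagen]; simp
          · rw [h1.2]; exact hsX.symm
        exact sub_left_injective h2
      have hXΩ : X ∈ Ω := hXs ▸ h.source_mem _ hmem'
      have hsub := h.mem_subdiff _ hmem'
      rw [← hXs] at hsub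
      have hsing := h.subdiff_eq_singleton_of_mem_target hXΩ hsub (h.target_mem _ hmem' hmem.2.1)
      have hd := h.differentiableAt_of_subdiff_subset hsing.subset
      have hgrad : gradient u X = targetPt p e F (a + s * Complex.I) :=
        hsing.subset (gradient_mem_subdiff h.convexOn hd)
      have h3 := inner_targetPt (p := p) (e := e) (F := F) (a + s * Complex.I)
      have h4 : ⟪e 1, targetPt p e F (a + s * Complex.I) - p⟫ = s := by rw [h3.2]; simp
      refine ⟨hXΩ, hd, ?_⟩
      rw [hgrad, mem_ofPred_eq, h4, h3.1]
      exact ⟨hs', hmh s hs' a₁ hla a hX1 hX1.1, hmh s hs' a hX1 a₂ hra hX1.2⟩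
  rw [hset, hX] at hpre
  rw [ENNReal.ofReal_eq_ofReal_iff] at hpre
  · exact hpre
  · exact intervalIntegral.integral_nonneg ha fun a ha =>
      sub_nonneg.2 (hmv a ha s₁ hls s₂ hrs hs)
  · exact intervalIntegral.integral_nonneg hs fun s hs =>
      sub_nonneg.2 (hmh s hs a₁ hla a₂ hra ha)

lemma integral_im_eq_integral_re_uIcc (h : IsChart Ω Ωs u K x₀ p e F r δ) {a₁ a₂ s₁ s₂ : ℝ}
    (hw : ∀ a ∈ uIcc a₁ a₂, ∀ s ∈ uIcc s₁ s₂, (a + s * Complex.I : ℂ) ∈ openHalfSquare δ) :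
    ∫ a in a₁..a₂, ((F (a + s₂ * Complex.I)).im - (F (a + s₁ * Complex.I)).im) =
      ∫ s in s₁..s₂, ((F (a₂ + s * Complex.I)).re - (F (a₁ + s * Complex.I)).re) := by
  wlog ha : a₁ ≤ a₂ generalizing a₁ a₂
  · have := this (a₁ := a₂) (a₂ := a₁) (by rwa [uIcc_comm]) (le_of_not_ge ha)
    rw [intervalIntegral.integral_symm, this, ← intervalIntegral.integral_neg]
    simp
  wlog hs : s₁ ≤ s₂ generalizing s₁ s₂
  · have := this (s₁ := s₂) (s₂ := s₁) (by rwa [uIcc_comm s₂]) (le_of_not_ge hs)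
    rw [intervalIntegral.integral_symm s₂ s₁, ← this, ← intervalIntegral.integral_neg]
    simp
  rw [uIcc_of_le ha, uIcc_of_le hs] at hw
  exact h.integral_im_eq_integral_re ha hs hw

lemma integral_re_sub_eq (h : IsChart Ω Ωs u K x₀ p e F r δ) {a₁ a₂ s : ℝ}
    (hw : ∀ a ∈ uIcc a₁ a₂, (a + s * Complex.I : ℂ) ∈ openHalfSquare δ) :
    ∫ a in a₁..a₂, (F (a + s * Complex.I)).re =
      potential u x₀ p e F (a₂ + s * Complex.I) - potential u x₀ p e F (a₁ + s * Complex.I)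
        - (a₂ - a₁) * ⟪e 0, p⟫ := by
  have hc : ContinuousOn (fun a : ℝ => (F (a + s * Complex.I)).re) (uIcc a₁ a₂) :=
    Complex.continuous_re.comp_continuousOn
      ((h.continuousOn.mono (openHalfSquare_subset δ)).comp (by fun_prop) hw)
  have h1 := intervalIntegral.integral_eq_sub_of_hasDerivAt
    (fun a ha => h.hasDerivAt_potential_re (hw a ha))
    ((hc.add continuousOn_const).intervalIntegrable)
  rw [intervalIntegral.integral_add hc.intervalIntegrable (by simp),
    intervalIntegral.integral_const, smul_eq_mul] at h1
  linarith

lemma integral_im_eq (h : IsChart Ω Ωs u K x₀ p e F r δ) {a s₁ s₂ : ℝ}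
    (hw : ∀ s ∈ uIcc s₁ s₂, (a + s * Complex.I : ℂ) ∈ openHalfSquare δ) :
    ∫ s in s₁..s₂, (F (a + s * Complex.I)).im =
      potential u x₀ p e F (a + s₁ * Complex.I) - potential u x₀ p e F (a + s₂ * Complex.I) := by
  have hc : ContinuousOn (fun s : ℝ => (F (a + s * Complex.I)).im) (uIcc s₁ s₂) :=
    Complex.continuous_im.comp_continuousOn
      ((h.continuousOn.mono (openHalfSquare_subset δ)).comp (by fun_prop) hw)
  rw [intervalIntegral.integral_eq_sub_of_hasDerivAt
    (fun s hs => h.hasDerivAt_potential_im (hw s hs)) hc.intervalIntegrable]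
  ring

lemma differentiableOn (h : IsChart Ω Ωs u K x₀ p e F r δ) :
    DifferentiableOn ℂ F (openHalfSquare δ) := by
  have hcont : ContinuousOn F (openHalfSquare δ) := h.continuousOn.mono (openHalfSquare_subset δ)
  refine (Complex.isConservativeOn_and_continuousOn_iff_isDifferentiableOn
    (isOpen_openHalfSquare δ)).1 ⟨fun z w hzw => ?_, hcont⟩
  have hsub : uIcc z.re w.re ×ℂ uIcc z.im w.im ⊆ openHalfSquare δ := hzw
  have hmem : ∀ a ∈ uIcc z.re w.re, ∀ s ∈ uIcc z.im w.im,
      (a + s * Complex.I : ℂ) ∈ openHalfSquare δ := fun a ha s hs =>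
    hsub (Complex.mem_reProdIm.2 ⟨by simpa using ha, by simpa using hs⟩)
  rw [← add_eq_zero_iff_eq_neg, Complex.wedgeIntegral_add_wedgeIntegral_eq]
  clear hzw
  generalize z.re = a₁, w.re = a₂, z.im = s₁, w.im = s₂ at *
  have hv : ∀ a ∈ uIcc a₁ a₂, ContinuousOn (fun s : ℝ => F (a + s * Complex.I)) (uIcc s₁ s₂) :=
    fun a ha => hcont.comp (by fun_prop) (hmem a ha)
  have hh : ∀ s ∈ uIcc s₁ s₂, ContinuousOn (fun a : ℝ => F (a + s * Complex.I)) (uIcc a₁ a₂) :=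
    fun s hs => hcont.comp (by fun_prop) (fun a ha => hmem a ha s hs)
  refine conservative_aux (hcont.mono hsub) ?_ ?_
  · rw [h.integral_re_sub_eq (fun a ha => hmem a ha s₁ left_mem_uIcc),
      h.integral_re_sub_eq (fun a ha => hmem a ha s₂ right_mem_uIcc),
      h.integral_im_eq (hmem a₁ left_mem_uIcc), h.integral_im_eq (hmem a₂ right_mem_uIcc)]
    ring
  · have := h.integral_im_eq_integral_re_uIcc hmem
    rwa [intervalIntegral.integral_sub, intervalIntegral.integral_sub] at this
    · exact (Complex.continuous_re.comp_continuousOn (hv a₂ right_mem_uIcc)).intervalIntegrable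
    · exact (Complex.continuous_re.comp_continuousOn (hv a₁ left_mem_uIcc)).intervalIntegrable
    · exact (Complex.continuous_im.comp_continuousOn (hh s₂ right_mem_uIcc)).intervalIntegrable
    · exact (Complex.continuous_im.comp_continuousOn (hh s₁ left_mem_uIcc)).intervalIntegrable

end IsChart

namespace IsChart

variable {Ω Ωs : Set E2} {u : E2 → ℝ} {K : ℝ≥0} {x₀ p : E2} {e : Frame} {F : ℂ → ℂ} {r δ : ℝ}

lemma halfDiscHolomorphic (h : IsChart Ω Ωs u K x₀ p e F r δ) {c : ℝ} (hc : |c| < δ) :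
    HalfDiscHolomorphic (fun z => F (z + c)) ((δ - |c|) / 2) := by
  refine ⟨by linarith, h.continuousOn.comp (by fun_prop) fun z hz => ?_,
    h.differentiableOn.comp (by fun_prop) fun z hz => ?_⟩
  · have h1 := Complex.abs_re_le_norm z
    have h2 := (le_abs_self _).trans (Complex.abs_im_le_norm z)
    have h3 := abs_add_le z.re c
    have h4 := abs_nonneg c
    have h5 := hz.1
    refine ⟨?_, ?_, ?_⟩
    · simp only [Complex.add_re, Complex.ofReal_re]; linarith
    · simpa using hz.2
    · simp only [Complex.add_im, Complex.ofReal_im]; linarith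
  · have h1 := Complex.abs_re_le_norm z
    have h2 := (le_abs_self _).trans (Complex.abs_im_le_norm z)
    have h3 := abs_add_le z.re c
    have h4 := abs_nonneg c
    have h5 := hz.1
    refine ⟨?_, ?_, ?_⟩
    · simp only [Complex.add_re, Complex.ofReal_re]; linarith
    · simpa using hz.2
    · simp only [Complex.add_im, Complex.ofReal_im]; linarith

lemma holAt_re (h : IsChart Ω Ωs u K x₀ p e F r δ) {k : ℕ} {c : ℝ} (hc : |c| < δ)
    (hI : HolAt k (fun t : ℝ => (F t).im) c) : HolAt k (fun t : ℝ => (F t).re) c := by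
  have h1 := (h.halfDiscHolomorphic hc).holAt_re (k := k) (by
    have := HolAt.comp_add_const (x := 0) c (by rwa [zero_add])
    simpa using this)
  have h2 := HolAt.comp_add_const (x := c) (-c) (f := fun t : ℝ => (F (t + c : ℂ)).re)
    (by rwa [add_neg_cancel])
  simpa using h2

end IsChart

lemma hasDerivAt_linear_add {g : ℝ → ℝ} {g' t : ℝ} (hg : HasDerivAt g g' t) (α β : ℝ) :
    HasDerivAt (fun t => α * t + β * g t) (α + β * g') t := by
  have := (hasDerivAt_const_mul (x := t) α).fun_add (hg.const_mul β)
  exact this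

lemma exists_local_inverse {f : ℝ → ℝ} {s : ℝ} (hd : ∀ᶠ t in nhds s, DifferentiableAt ℝ f t)
    (hc : ContinuousAt (deriv f) s) (h0 : deriv f s ≠ 0) :
    ∃ b : ℝ → ℝ, b (f s) = s ∧ (∀ᶠ y in nhds (f s), f (b y) = y) ∧
      (∀ᶠ y in nhds (f s), HasDerivAt b (deriv f (b y))⁻¹ y) ∧ BddDerivAt b (f s) := by
  have hs : HasStrictDerivAt f (deriv f s) s :=
    hasStrictDerivAt_of_hasDerivAt_of_continuousAt (hd.mono fun _ h => h.hasDerivAt) hc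
  have hs' := hs.hasStrictFDerivAt_equiv h0
  obtain ⟨φ, hφ⟩ : ∃ φ : OpenPartialHomeomorph ℝ ℝ, φ = hs'.toOpenPartialHomeomorph f := ⟨_, rfl⟩
  have hφf : ∀ t, φ t = f t := fun t => by rw [hφ]; rfl
  have hsrc : s ∈ φ.source := hφ ▸ hs'.mem_toOpenPartialHomeomorph_source
  have htgt : f s ∈ φ.target := hφf s ▸ φ.map_source hsrc
  have hbs : φ.symm (f s) = s := by rw [← hφf]; exact φ.left_inv hsrc
  have hbc : ContinuousAt φ.symm (f s) := φ.continuousAt_symm htgt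
  have hcb : ContinuousAt (fun y => deriv f (φ.symm y)) (f s) :=
    ContinuousAt.comp (g := deriv f) (by rwa [hbs]) hbc
  have hder : ∀ᶠ y in nhds (f s), HasDerivAt φ.symm (deriv f (φ.symm y))⁻¹ y := by
    have h1 : ∀ᶠ y in nhds (f s), DifferentiableAt ℝ f (φ.symm y) :=
      hbc.eventually (by rwa [hbs])
    have h2 : ∀ᶠ y in nhds (f s), deriv f (φ.symm y) ≠ 0 :=
      hcb.eventually (isOpen_ne.mem_nhds (by change deriv f (φ.symm (f s)) ≠ 0; rwa [hbs]))
    filter_upwards [h1, h2, φ.open_target.mem_nhds htgt] with y h1 h2 h3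
    refine h1.hasDerivAt.of_local_left_inverse (φ.continuousAt_symm h3) h2 ?_
    filter_upwards [φ.open_target.mem_nhds h3] with z hz
    rw [← hφf]; exact φ.right_inv hz
  refine ⟨φ.symm, hbs, ?_, hder, |(deriv f (φ.symm (f s)))⁻¹| + 1, ?_⟩
  · filter_upwards [φ.open_target.mem_nhds htgt] with y hy
    rw [← hφf]; exact φ.right_inv hy
  · have hci : ContinuousAt (fun y => (deriv f (φ.symm y))⁻¹) (f s) := hcb.inv₀ (by rwa [hbs])
    filter_upwards [hder, hci.abs.eventually (gt_mem_nhds (lt_add_one _))] with y h1 h2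
    exact ⟨h1.differentiableAt, by rw [h1.deriv]; exact h2.le⟩

namespace HolAt

variable {k : ℕ} {a y R I : ℝ → ℝ} {s : ℝ}

lemma comp_zero_of_comp_eq (ha : ∀ᶠ t in nhds s, DifferentiableAt ℝ a t)
    (hac : ContinuousAt (deriv a) s) (h0 : deriv a s ≠ 0) (hy : BddDerivAt y s)
    (hI : ∀ᶠ t in nhds s, I (a t) = y t) (hR : HolAt 0 I (a s) → HolAt 0 R (a s)) :
    HolAt 0 (fun t => R (a t)) s := by
  obtain ⟨b, hb1, hb2, hb3, hb4⟩ := exists_local_inverse ha hac h0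
  have hba : BddDerivAt a s := by
    refine ⟨|deriv a s| + 1, ha.and ?_⟩
    exact (hac.abs.eventually (gt_mem_nhds (lt_add_one _))).mono fun _ h => h.le
  have hyb : HolAt 0 (fun z => y (b z)) (a s) :=
    HolAt.comp_bddDerivAt (by rw [hb1]; exact hy.holAt) hb4
  refine (hR (hyb.congr ?_)).comp_bddDerivAt hba
  have hcb : ContinuousAt b (a s) := hb4.holAt.continuousAt
  filter_upwards [hb2, hcb.eventually (by rwa [hb1])] with z h1 h2
  rw [← h2, h1]

lemma comp_succ_of_comp_eq (ha : HolAt (k + 1) a s) (h0 : deriv a s ≠ 0) (hy : HolAt (k + 1) y s)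
    (hI : ∀ᶠ t in nhds s, I (a t) = y t) (hR : HolAt (k + 1) I (a s) → HolAt (k + 1) R (a s)) :
    HolAt (k + 1) (fun t => R (a t)) s := by
  obtain ⟨b, hb1, hb2, hb3, hb4⟩ := exists_local_inverse ha.1 ha.2.continuousAt h0
  have hb : HolAt (k + 1) b (a s) :=
    HolAt.inverse (f := a) (by rwa [hb1]) hb3 (by rwa [hb1])
  have hyb : HolAt (k + 1) (fun z => y (b z)) (a s) := HolAt.comp (by rwa [hb1]) hb
  refine (hR (hyb.congr ?_)).comp ha
  filter_upwards [hb2, hb.continuousAt.eventually (by rwa [hb1])] with z h1 h2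
  rw [← h2, h1]

variable {g : ℝ → ℝ} {α β γ ζ : ℝ}

lemma linear_add (hg : HolAt k g s) (α β : ℝ) : HolAt k (fun t => α * t + β * g t) s :=
  ((HolAt.id k s).const_mul α).add (hg.const_mul β)

lemma comp_linear_zero (hg : ∀ᶠ t in nhds s, DifferentiableAt ℝ g t)
    (hgc : ContinuousAt (deriv g) s) (h0 : α + β * deriv g s ≠ 0)
    (hI : ∀ᶠ t in nhds s, I (α * t + β * g t) = γ * t + ζ * g t)
    (hR : HolAt 0 I (α * s + β * g s) → HolAt 0 R (α * s + β * g s)) :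
    HolAt 0 (fun t => R (α * t + β * g t)) s := by
  have hder : ∀ α β : ℝ, ∀ᶠ t in nhds s,
      HasDerivAt (fun t => α * t + β * g t) (α + β * deriv g t) t := fun α β =>
    hg.mono fun t ht => hasDerivAt_linear_add ht.hasDerivAt α β
  have hcont : ∀ α β : ℝ, ContinuousAt (deriv fun t => α * t + β * g t) s := fun α β =>
    ContinuousAt.congr (f := fun t => α + β * deriv g t) (by fun_prop)
      ((hder α β).mono fun t ht => ht.deriv.symm)
  have hdiff := fun α β => (hder α β).mono fun t ht => ht.differentiableAt
  refine comp_zero_of_comp_eq (hdiff α β) (hcont α β) ?_ ?_ hI hR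
  · rwa [(hder α β).self_of_nhds.deriv]
  · exact ⟨_, (hdiff γ ζ).and (((hcont γ ζ).abs.eventually
      (gt_mem_nhds (lt_add_one _))).mono fun _ h => h.le)⟩

lemma comp_linear_succ (hg : HolAt (k + 1) g s) (h0 : α + β * deriv g s ≠ 0)
    (hI : ∀ᶠ t in nhds s, I (α * t + β * g t) = γ * t + ζ * g t)
    (hR : HolAt (k + 1) I (α * s + β * g s) → HolAt (k + 1) R (α * s + β * g s)) :
    HolAt (k + 1) (fun t => R (α * t + β * g t)) s := by
  have hder : HasDerivAt (fun t => α * t + β * g t) (α + β * deriv g s) s := 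
    hasDerivAt_linear_add hg.1.self_of_nhds.hasDerivAt α β
  exact comp_succ_of_comp_eq (hg.linear_add α β) (by rwa [hder.deriv]) (hg.linear_add γ ζ) hI hR

end HolAt

lemma Transport.isClosed_exists_sheet {Ω Ωs : Set E2} {u : E2 → ℝ} {K : ℝ≥0}
    (h : Transport Ω Ωs u K) (p : E2) (e : Frame) : IsClosed {x | ∃ q, Sheet Ωs u p e x q} := by
  have hG : IsClosed {z : E2 × E2 | Sheet Ωs u p e z.1 z.2} := by
    have h1 : IsClosed {z : E2 × E2 | 0 ≤ ⟪e 1, z.2 - p⟫} :=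
      isClosed_le continuous_const (by fun_prop)
    exact h.isClosed_graph.inter h1
  rw [← isOpen_compl_iff, isOpen_iff_mem_nhds]
  intro x hx
  have := eventually_subset_of_isClosed hG (fun z hz => h.norm_le hz.1.1) (x := x) isOpen_empty
    fun q hq => hx ⟨q, hq⟩
  filter_upwards [this] with y hy
  rintro ⟨q, hq⟩
  exact hy q hq

/-- The point over `s` of the graph of `g` in the frame `f` based at `x₀`. -/
def curvePt (x₀ : E2) (f : Frame) (g : ℝ → ℝ) (s : ℝ) : E2 := x₀ + s • f 0 + g s • f 1

lemma inner_curvePt (v x₀ : E2) (f : Frame) (g : ℝ → ℝ) (s : ℝ) :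
    ⟪v, curvePt x₀ f g s - x₀⟫ = ⟪v, f 0⟫ * s + ⟪v, f 1⟫ * g s := by
  have : curvePt x₀ f g s - x₀ = s • f 0 + g s • f 1 := by unfold curvePt; abel
  rw [this, inner_add_right, real_inner_smul_right, real_inner_smul_right]
  ring

lemma inner_curvePt_sub (v x₀ : E2) (f : Frame) (g : ℝ → ℝ) (s t : ℝ) :
    ⟪v, curvePt x₀ f g s - curvePt x₀ f g t⟫ = ⟪v, f 0⟫ * (s - t) + ⟪v, f 1⟫ * (g s - g t) := by
  rw [← sub_sub_sub_cancel_right _ _ x₀, inner_sub_right, inner_curvePt, inner_curvePt]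
  ring

/-- The singular set near `x₀` is the graph of `g` in the frame `f`; the two limit gradients over
`s` are `q s` and `q' s`. -/
structure IsCurve (Ω Ωs : Set E2) (u : E2 → ℝ) (K : ℝ≥0) (x₀ p p' : E2) (e e' : Frame) (ε r : ℝ)
    (f : Frame) (κ η : ℝ) (g : ℝ → ℝ) (q q' : ℝ → E2) : Prop
    extends IsFold Ω Ωs u K x₀ p p' e e' ε r where
  kappa_pos : 0 < κ
  eta_pos : 0 < η
  eta_le : η ≤ r / 2
  bound : ∀ q ∈ ball p ε, ∀ q' ∈ ball p' ε, κ ≤ ⟪f 1, q - q'⟫ ∧ |⟪f 0, q - q'⟫| ≤ κ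
  mem : ∀ s, |s| ≤ η → curvePt x₀ f g s ∈ closedBall x₀ (r / 2)
  left_sheet : ∀ s, |s| ≤ η → Sheet Ωs u p e (curvePt x₀ f g s) (q s)
  right_sheet : ∀ s, |s| ≤ η → Sheet Ωs u p' e' (curvePt x₀ f g s) (q' s)

namespace IsFold

variable {Ω Ωs : Set E2} {u : E2 → ℝ} {K : ℝ≥0} {x₀ p p' : E2} {e e' f : Frame} {ε r κ : ℝ}

lemma exists_frame (h : IsFold Ω Ωs u K x₀ p p' e e' ε r) :
    ∃ (f : Frame) (κ : ℝ), 0 < κ ∧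
      ∀ q ∈ ball p ε, ∀ q' ∈ ball p' ε, κ ≤ ⟪f 1, q - q'⟫ ∧ |⟪f 0, q - q'⟫| ≤ κ := by
  have hε := h.eps_pos
  have hle := h.eps_le
  obtain ⟨d, hd⟩ : ∃ d, d = ‖p - p'‖ := ⟨_, rfl⟩
  rw [← hd] at hle
  have hd0 : 0 < d := by linarith
  obtain ⟨f, hf⟩ := Frame.exists_snd_eq (v := d⁻¹ • (p - p')) (by
    rw [norm_smul, norm_inv, Real.norm_eq_abs, abs_of_pos hd0, ← hd, inv_mul_cancel₀ hd0.ne'])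
  have hpf : p - p' = d • f 1 := by rw [hf, smul_smul, mul_inv_cancel₀ hd0.ne', one_smul]
  refine ⟨f, d / 2, by linarith, fun q hq q' hq' => ?_⟩
  rw [mem_ball_iff_norm] at hq hq'
  obtain ⟨w, hw⟩ : ∃ w, w = (q - p) - (q' - p') := ⟨_, rfl⟩
  have hwn : ‖w‖ ≤ d / 2 := by
    rw [hw]
    exact (norm_sub_le _ _).trans (by linarith)
  have hqq : q - q' = d • f 1 + w := by rw [← hpf, hw]; abel
  have h0 := (f.abs_inner_le 0 w).trans hwn
  have h1 := (f.abs_inner_le 1 w).trans hwn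
  rw [hqq, inner_add_right, inner_add_right, real_inner_smul_right, real_inner_smul_right,
    Frame.inner_snd_snd, Frame.inner_fst_snd, mul_zero, zero_add]
  exact ⟨by linarith [neg_le_of_abs_le h1], h0⟩

lemma neg_abs_le_of_sheets (h : IsFold Ω Ωs u K x₀ p p' e e' ε r) (hκ : 0 < κ)
    (hf : ∀ q ∈ ball p ε, ∀ q' ∈ ball p' ε, κ ≤ ⟪f 1, q - q'⟫ ∧ |⟪f 0, q - q'⟫| ≤ κ)
    {x y q q' : E2} (hx : x ∈ ball x₀ r) (hy : y ∈ ball x₀ r) (hq : Sheet Ωs u p e x q)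
    (hq' : Sheet Ωs u p' e' y q') : -|⟪f 0, x - y⟫| ≤ ⟪f 1, x - y⟫ := by
  obtain ⟨h1, h2⟩ := hf q (h.mem_ball_of_sheet hx hq) q' (h.symm.mem_ball_of_sheet hy hq')
  have h3 := subdiff_monotone hq.1.1 hq'.1.1
  rw [f.inner_eq] at h3
  by_contra! hcon
  have h4 : ⟪f 0, x - y⟫ * ⟪f 0, q - q'⟫ ≤ |⟪f 0, x - y⟫| * κ :=
    (le_abs_self _).trans ((abs_mul _ _).le.trans (by gcongr))
  have h5 : ⟪f 1, x - y⟫ < 0 := hcon.trans_le (by simp)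
  nlinarith

lemma left_sheet_center (h : IsFold Ω Ωs u K x₀ p p' e e' ε r) : Sheet Ωs u p e x₀ p :=
  ⟨h.left_mem, by simp⟩

lemma exists_sheets_of_coord (h : IsFold Ω Ωs u K x₀ p p' e e' ε r) (hκ : 0 < κ)
    (hf : ∀ q ∈ ball p ε, ∀ q' ∈ ball p' ε, κ ≤ ⟪f 1, q - q'⟫ ∧ |⟪f 0, q - q'⟫| ≤ κ)
    {s : ℝ} (hs : |s| ≤ r / 8) :
    ∃ (t : ℝ) (q q' : E2), x₀ + s • f 0 + t • f 1 ∈ closedBall x₀ (r / 2) ∧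
      Sheet Ωs u p e (x₀ + s • f 0 + t • f 1) q ∧ Sheet Ωs u p' e' (x₀ + s • f 0 + t • f 1) q' := by
  have hr := h.r_pos
  have hx₀ : x₀ ∈ ball x₀ r := mem_ball_self hr
  have hmem : ∀ t ∈ Icc (-(r / 4)) (r / 4), x₀ + s • f 0 + t • f 1 ∈ closedBall x₀ (r / 2) := by
    intro t ht
    rw [mem_closedBall_iff_norm]
    have h1 : x₀ + s • f 0 + t • f 1 - x₀ = s • f 0 + t • f 1 := by abel
    have h2 : |t| ≤ r / 4 := abs_le.2 ht
    rw [h1]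
    refine (norm_add_le _ _).trans ?_
    rw [norm_smul, norm_smul]
    simp only [Real.norm_eq_abs, OrthonormalBasis.norm_eq_one, mul_one]
    linarith
  have hball : ∀ t ∈ Icc (-(r / 4)) (r / 4), x₀ + s • f 0 + t • f 1 ∈ ball x₀ r := fun t ht =>
    closedBall_subset_ball (by linarith) (hmem t ht)
  have hcoord : ∀ t : ℝ, ⟪f 0, x₀ + s • f 0 + t • f 1 - x₀⟫ = s ∧
      ⟪f 1, x₀ + s • f 0 + t • f 1 - x₀⟫ = t := by
    intro t
    have h1 : x₀ + s • f 0 + t • f 1 - x₀ = s • f 0 + t • f 1 := by abel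
    rw [h1]
    constructor <;> simp [inner_add_right, real_inner_smul_right]
  have hcont : Continuous fun t : ℝ => x₀ + s • f 0 + t • f 1 := by fun_prop
  have hcover : ∀ t ∈ Icc (-(r / 4)) (r / 4),
      (∃ q, Sheet Ωs u p e (x₀ + s • f 0 + t • f 1) q) ∨
        ∃ q', Sheet Ωs u p' e' (x₀ + s • f 0 + t • f 1) q' := by
    intro t ht
    obtain ⟨q, hq⟩ := h.targetSubdiff_nonempty (x₀ + s • f 0 + t • f 1)
    exact (h.sheet_or_sheet (hball t ht) hq).imp (fun h => ⟨q, h⟩) fun h => ⟨q, h⟩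
  have htop : r / 4 ∈ Icc (-(r / 4)) (r / 4) := ⟨by linarith, le_rfl⟩
  have hbot : -(r / 4) ∈ Icc (-(r / 4)) (r / 4) := ⟨le_rfl, by linarith⟩
  have hleft : ∃ q, Sheet Ωs u p e (x₀ + s • f 0 + (r / 4) • f 1) q := by
    refine (hcover _ htop).resolve_right ?_
    rintro ⟨q', hq'⟩
    have h1 := h.neg_abs_le_of_sheets hκ hf hx₀ (hball _ htop) h.left_sheet_center hq'
    rw [← neg_sub, inner_neg_right, inner_neg_right, (hcoord _).1, (hcoord _).2, abs_neg] at h1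
    linarith
  have hright : ∃ q', Sheet Ωs u p' e' (x₀ + s • f 0 + (-(r / 4)) • f 1) q' := by
    refine (hcover _ hbot).resolve_left ?_
    rintro ⟨q, hq⟩
    have h1 := h.neg_abs_le_of_sheets hκ hf (hball _ hbot) hx₀ hq h.symm.left_sheet_center
    rw [(hcoord _).1, (hcoord _).2] at h1
    linarith
  obtain ⟨t, ht, ⟨q, hq⟩, q', hq'⟩ := isPreconnected_closed_iff.1
    (isPreconnected_Icc (a := -(r / 4)) (b := r / 4)) _ _
    ((h.isClosed_exists_sheet p e).preimage hcont) ((h.isClosed_exists_sheet p' e').preimage hcont)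
    hcover ⟨_, htop, hleft⟩ ⟨_, hbot, hright⟩
  exact ⟨t, q, q', hmem t ht, hq, hq'⟩

lemma exists_isCurve (h : IsFold Ω Ωs u K x₀ p p' e e' ε r) :
    ∃ f κ η g q q', IsCurve Ω Ωs u K x₀ p p' e e' ε r f κ η g q q' := by
  obtain ⟨f, κ, hκ, hf⟩ := h.exists_frame
  have hr := h.r_pos
  have hex : ∀ s : ℝ, ∃ (t : ℝ) (q q' : E2), |s| ≤ r / 8 → x₀ + s • f 0 + t • f 1 ∈ closedBall x₀ (r / 2) ∧
      Sheet Ωs u p e (x₀ + s • f 0 + t • f 1) q ∧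
      Sheet Ωs u p' e' (x₀ + s • f 0 + t • f 1) q' := by
    intro s
    by_cases hs : |s| ≤ r / 8
    · obtain ⟨t, q, q', h⟩ := h.exists_sheets_of_coord hκ hf hs
      exact ⟨t, q, q', fun _ => h⟩
    · exact ⟨0, 0, 0, fun hs' => absurd hs' hs⟩
  choose g q q' hgq using hex
  exact ⟨f, κ, r / 8, g, q, q', h, hκ, by positivity, by linarith, hf, fun s hs => (hgq s hs).1,
    fun s hs => (hgq s hs).2.1, fun s hs => (hgq s hs).2.2⟩

end IsFold

lemma hasDerivAt_of_le_of_le {g A B : ℝ → ℝ} {s m : ℝ} (hA : Filter.Tendsto A (nhds s) (nhds m))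
    (hB : Filter.Tendsto B (nhds s) (nhds m)) (h1 : ∀ᶠ t in nhds s, A t * (t - s) ≤ g t - g s)
    (h2 : ∀ᶠ t in nhds s, g t - g s ≤ B t * (t - s)) : HasDerivAt g m s := by
  rw [hasDerivAt_iff_isLittleO, Asymptotics.isLittleO_iff]
  intro c hc
  filter_upwards [h1, h2, Metric.tendsto_nhds.1 hA c hc, Metric.tendsto_nhds.1 hB c hc]
    with t h1 h2 h3 h4
  rw [Real.dist_eq] at h3 h4
  rw [smul_eq_mul, Real.norm_eq_abs, Real.norm_eq_abs]
  have h5 : |(A t - m) * (t - s)| ≤ c * |t - s| := by rw [abs_mul]; gcongr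
  have h6 : |(B t - m) * (t - s)| ≤ c * |t - s| := by rw [abs_mul]; gcongr
  rw [abs_le] at h5 h6 ⊢
  constructor <;> linarith [h5.1, h6.2]

namespace IsCurve

variable {Ω Ωs : Set E2} {u : E2 → ℝ} {K : ℝ≥0} {x₀ p p' : E2} {e e' f : Frame} {ε r κ η : ℝ}
  {g : ℝ → ℝ} {q q' : ℝ → E2}

lemma mem_ball (h : IsCurve Ω Ωs u K x₀ p p' e e' ε r f κ η g q q') {s : ℝ} (hs : |s| ≤ η) :
    curvePt x₀ f g s ∈ ball x₀ r :=
  closedBall_subset_ball (by linarith [h.r_pos]) (h.mem s hs)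

lemma abs_sub_le (h : IsCurve Ω Ωs u K x₀ p p' e e' ε r f κ η g q q') {s t : ℝ} (hs : |s| ≤ η)
    (ht : |t| ≤ η) : |g s - g t| ≤ |s - t| := by
  have h1 := h.neg_abs_le_of_sheets h.kappa_pos h.bound (h.mem_ball hs) (h.mem_ball ht)
    (h.left_sheet s hs) (h.right_sheet t ht)
  have h2 := h.neg_abs_le_of_sheets h.kappa_pos h.bound (h.mem_ball ht) (h.mem_ball hs)
    (h.left_sheet t ht) (h.right_sheet s hs)
  simp only [inner_curvePt_sub, Frame.inner_fst_fst, Frame.inner_fst_snd, Frame.inner_snd_fst,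
    Frame.inner_snd_snd, zero_mul, one_mul, add_zero, zero_add] at h1 h2
  rw [abs_sub_comm t s] at h2
  rw [abs_le]
  constructor <;> linarith

/-- Near `x₀` the singular set is the graph of `g`. -/
lemma not_differentiableAt_iff_eq (h : IsCurve Ω Ωs u K x₀ p p' e e' ε r f κ η g q q') {x : E2}
    (hx : x ∈ ball x₀ η) : ¬ DifferentiableAt ℝ u x ↔ ⟪f 1, x - x₀⟫ = g ⟪f 0, x - x₀⟫ := by
  have hxr : x ∈ ball x₀ r := ball_subset_ball (by linarith [h.r_pos, h.eta_le]) hx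
  have hs : |⟪f 0, x - x₀⟫| ≤ η :=
    (f.abs_inner_le 0 _).trans (mem_ball_iff_norm.1 hx).le
  generalize hσ : ⟪f 0, x - x₀⟫ = s at hs
  constructor
  · intro hd
    obtain ⟨⟨a, ha⟩, b, hb⟩ := (h.not_differentiableAt_iff hxr).1 hd
    have h1 := h.neg_abs_le_of_sheets h.kappa_pos h.bound (h.mem_ball hs) hxr
      (h.left_sheet s hs) hb
    have h2 := h.neg_abs_le_of_sheets h.kappa_pos h.bound hxr (h.mem_ball hs) ha
      (h.right_sheet s hs)
    have h3 : ∀ v : E2, ⟪v, curvePt x₀ f g s - x⟫ =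
        ⟪v, f 0⟫ * s + ⟪v, f 1⟫ * g s - ⟪v, x - x₀⟫ := fun v => by
      rw [← inner_curvePt, ← inner_sub_right, sub_sub_sub_cancel_right]
    rw [← neg_sub, inner_neg_right, inner_neg_right] at h2
    simp only [h3, Frame.inner_fst_fst, Frame.inner_fst_snd, Frame.inner_snd_fst,
      Frame.inner_snd_snd, zero_mul, one_mul, add_zero, zero_add, hσ, sub_self, neg_zero,
      abs_zero] at h1 h2
    linarith
  · intro heq
    have hxc : x = curvePt x₀ f g s := by
      rw [← sub_left_inj (a := x₀)]
      refine f.ext_inner ?_ ?_ <;> rw [inner_curvePt] <;> simp [hσ, heq]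
    rw [h.not_differentiableAt_iff hxr, hxc]
    exact ⟨⟨_, h.left_sheet s hs⟩, _, h.right_sheet s hs⟩

lemma apply_zero (h : IsCurve Ω Ωs u K x₀ p p' e e' ε r f κ η g q q') : g 0 = 0 := by
  have h0 := (h.not_differentiableAt_iff_eq (mem_ball_self h.eta_pos)).1
    ((h.not_differentiableAt_iff (mem_ball_self h.r_pos)).2
      ⟨⟨_, h.left_sheet_center⟩, _, h.symm.left_sheet_center⟩)
  simpa using h0.symm

lemma abs_inner_le (h : IsCurve Ω Ωs u K x₀ p p' e e' ε r f κ η g q q') {s : ℝ} (hs : |s| ≤ η)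
    (a : Frame) (i : Fin 2) : |⟪a i, curvePt x₀ f g s - x₀⟫| ≤ 2 * |s| := by
  refine (a.abs_inner_le i _).trans ((f.norm_le_add_abs _).trans ?_)
  have h1 := h.abs_sub_le hs (t := 0) (by simpa using h.eta_pos.le)
  rw [h.apply_zero, sub_zero, sub_zero] at h1
  rw [inner_curvePt, inner_curvePt]
  simpa using (by linarith : |s| + |g s| ≤ 2 * |s|)

lemma continuousAt (h : IsCurve Ω Ωs u K x₀ p p' e e' ε r f κ η g q q') {s : ℝ} (hs : |s| < η) :
    ContinuousAt g s := by
  have hev : ∀ᶠ t : ℝ in nhds s, |t| < η := continuousAt_id.abs.eventually (gt_mem_nhds hs)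
  have h1 : Filter.Tendsto (fun t : ℝ => |t - s|) (nhds s) (nhds 0) := by
    have : Continuous fun t : ℝ => |t - s| := by fun_prop
    simpa using this.tendsto s
  rw [ContinuousAt, tendsto_iff_norm_sub_tendsto_zero]
  refine squeeze_zero' (Filter.Eventually.of_forall fun _ => norm_nonneg _) ?_ h1
  filter_upwards [hev] with t ht
  exact h.abs_sub_le ht.le hs.le

/-- The slope of the curve, determined by the jump of the gradient. -/
lemma hasDerivAt (h : IsCurve Ω Ωs u K x₀ p p' e e' ε r f κ η g q q') {s : ℝ} (hs : |s| < η)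
    (hq : ContinuousAt q s) (hq' : ContinuousAt q' s) :
    HasDerivAt g (-⟪f 0, q s - q' s⟫ / ⟪f 1, q s - q' s⟫) s := by
  have hev : ∀ᶠ t : ℝ in nhds s, |t| ≤ η :=
    (continuousAt_id.abs.eventually (gt_mem_nhds hs)).mono fun _ h => h.le
  have hpos : ∀ t t', |t| ≤ η → |t'| ≤ η → 0 < ⟪f 1, q t - q' t'⟫ := fun t t' ht ht' =>
    h.kappa_pos.trans_le (h.bound _ (h.mem_ball_of_sheet (h.mem_ball ht) (h.left_sheet t ht)) _
      (h.symm.mem_ball_of_sheet (h.mem_ball ht') (h.right_sheet t' ht'))).1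
  have hmono : ∀ t t', |t| ≤ η → |t'| ≤ η →
      0 ≤ (t - t') * ⟪f 0, q t - q' t'⟫ + (g t - g t') * ⟪f 1, q t - q' t'⟫ := by
    intro t t' ht ht'
    have h1 := subdiff_monotone (h.left_sheet t ht).1.1 (h.right_sheet t' ht').1.1
    rw [f.inner_eq, inner_curvePt_sub, inner_curvePt_sub] at h1
    simpa using h1
  have h0 := (hpos s s hs.le hs.le).ne'
  refine hasDerivAt_of_le_of_le
    (A := fun t => -⟪f 0, q t - q' s⟫ / ⟪f 1, q t - q' s⟫)
    (B := fun t => -⟪f 0, q s - q' t⟫ / ⟪f 1, q s - q' t⟫) ?_ ?_ ?_ ?_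
  · have h1 : ContinuousAt (fun t => -⟪f 0, q t - q' s⟫ / ⟪f 1, q t - q' s⟫) s :=
      ContinuousAt.div (by fun_prop) (by fun_prop) h0
    exact h1
  · have h1 : ContinuousAt (fun t => -⟪f 0, q s - q' t⟫ / ⟪f 1, q s - q' t⟫) s :=
      ContinuousAt.div (by fun_prop) (by fun_prop) h0
    exact h1
  · filter_upwards [hev] with t ht
    rw [div_mul_eq_mul_div, div_le_iff₀ (hpos t s ht hs.le)]
    linarith [hmono t s ht hs.le]
  · filter_upwards [hev] with t ht
    rw [div_mul_eq_mul_div, le_div_iff₀ (hpos s t hs.le ht)]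
    linarith [hmono s t hs.le ht]

end IsCurve

namespace IsChart

variable {Ω Ωs : Set E2} {u : E2 → ℝ} {K : ℝ≥0} {x₀ p : E2} {e f : Frame} {F : ℂ → ℂ} {r δ : ℝ}
  {g : ℝ → ℝ} {q : ℝ → E2} {s : ℝ}

lemma boundary_eq (h : IsChart Ω Ωs u K x₀ p e F r δ) {x y : E2} (hx : x ∈ closedBall x₀ (r / 2))
    (hy : Sheet Ωs u p e x y) (h0 : ⟪e 1, y - p⟫ = 0) :
    (F (⟪e 0, x - x₀⟫ : ℝ)).im = ⟪e 1, x - x₀⟫ ∧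
      ∀ v : E2, ⟪v, y⟫ = ⟪v, p⟫ + ⟪v, e 0⟫ * (F (⟪e 0, x - x₀⟫ : ℝ)).re := by
  have h1 := h.apply_eq x hx y hy
  rw [h0] at h1
  have h2 : (⟨⟪e 0, x - x₀⟫, 0⟩ : ℂ) = (⟪e 0, x - x₀⟫ : ℝ) := rfl
  rw [h2] at h1
  rw [h1]
  refine ⟨rfl, fun v => ?_⟩
  have h3 := e.eq_smul_add_smul (y - p)
  rw [h0, zero_smul, add_zero] at h3
  rw [mul_comm, ← real_inner_smul_right, ← inner_add_right]
  congr 1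
  rw [← h3]; abel

lemma continuousAt_real (h : IsChart Ω Ωs u K x₀ p e F r δ) {c : ℝ} (hc : |c| < δ) :
    ContinuousAt (fun t : ℝ => F t) c := by
  have hev : ∀ᶠ t : ℝ in nhds c, |t| < δ := continuousAt_id.abs.eventually (gt_mem_nhds hc)
  have h1 : ContinuousOn (fun t : ℝ => F t) {t | |t| < δ} :=
    h.continuousOn.comp (by fun_prop) fun t ht => ⟨by simpa using le_of_lt ht, by simp,
      by simpa using h.pos.le⟩
  exact h1.continuousAt hev

end IsChart

namespace IsChart

variable {Ω Ωs : Set E2} {u : E2 → ℝ} {K : ℝ≥0} {x₀ p : E2} {e f : Frame} {F : ℂ → ℂ} {r δ : ℝ}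
  {g : ℝ → ℝ} {q : ℝ → E2} {s : ℝ} {k : ℕ}

lemma eventually_boundary_eq (h : IsChart Ω Ωs u K x₀ p e F r δ)
    (hev : ∀ᶠ t in nhds s, curvePt x₀ f g t ∈ closedBall x₀ (r / 2) ∧
      Sheet Ωs u p e (curvePt x₀ f g t) (q t) ∧ ⟪e 1, q t - p⟫ = 0) :
    ∀ᶠ t in nhds s,
      (F (⟪e 0, f 0⟫ * t + ⟪e 0, f 1⟫ * g t : ℝ)).im = ⟪e 1, f 0⟫ * t + ⟪e 1, f 1⟫ * g t ∧
      ∀ v : E2, ⟪v, q t⟫ = ⟪v, p⟫ + ⟪v, e 0⟫ * (F (⟪e 0, f 0⟫ * t + ⟪e 0, f 1⟫ * g t : ℝ)).re := by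
  filter_upwards [hev] with t ht
  have := h.boundary_eq ht.1 ht.2.1 ht.2.2
  rwa [inner_curvePt, inner_curvePt] at this

lemma continuousAt_gradient (h : IsChart Ω Ωs u K x₀ p e F r δ)
    (hev : ∀ᶠ t in nhds s, curvePt x₀ f g t ∈ closedBall x₀ (r / 2) ∧
      Sheet Ωs u p e (curvePt x₀ f g t) (q t) ∧ ⟪e 1, q t - p⟫ = 0)
    (hδ : |⟪e 0, curvePt x₀ f g s - x₀⟫| < δ) (hg : ContinuousAt g s) : ContinuousAt q s := by
  rw [inner_curvePt] at hδ
  have h1 : ContinuousAt (fun t => F (⟪e 0, f 0⟫ * t + ⟪e 0, f 1⟫ * g t : ℝ)) s :=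
    ContinuousAt.comp (g := fun t : ℝ => F t) (f := fun t => ⟪e 0, f 0⟫ * t + ⟪e 0, f 1⟫ * g t)
      (h.continuousAt_real hδ) (by fun_prop)
  have h2 : ContinuousAt (fun t => (F (⟪e 0, f 0⟫ * t + ⟪e 0, f 1⟫ * g t : ℝ)).re) s :=
    Complex.continuous_re.continuousAt.comp h1
  have h3 : ∀ v : E2, ContinuousAt (fun t => ⟪v, q t⟫) s := fun v => by
    refine ContinuousAt.congr (f := fun t => ⟪v, p⟫ +
      ⟪v, e 0⟫ * (F (⟪e 0, f 0⟫ * t + ⟪e 0, f 1⟫ * g t : ℝ)).re) (by fun_prop) ?_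
    filter_upwards [h.eventually_boundary_eq hev] with t ht using (ht.2 v).symm
  have h4 : q = fun t => ⟪e 0, q t⟫ • e 0 + ⟪e 1, q t⟫ • e 1 := by
    funext t; exact e.eq_smul_add_smul _
  rw [h4]
  exact ((h3 _).smul continuousAt_const).add ((h3 _).smul continuousAt_const)

lemma holAt_inner_zero (h : IsChart Ω Ωs u K x₀ p e F r δ)
    (hev : ∀ᶠ t in nhds s, curvePt x₀ f g t ∈ closedBall x₀ (r / 2) ∧
      Sheet Ωs u p e (curvePt x₀ f g t) (q t) ∧ ⟪e 1, q t - p⟫ = 0)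
    (hδ : |⟪e 0, curvePt x₀ f g s - x₀⟫| < δ) (hg : ∀ᶠ t in nhds s, DifferentiableAt ℝ g t)
    (hgc : ContinuousAt (deriv g) s) (h0 : ⟪e 0, f 0⟫ + ⟪e 0, f 1⟫ * deriv g s ≠ 0) (v : E2) :
    HolAt 0 (fun t => ⟪v, q t⟫) s := by
  rw [inner_curvePt] at hδ
  have hbd := h.eventually_boundary_eq hev
  have h1 := HolAt.comp_linear_zero (I := fun t : ℝ => (F t).im) (R := fun t : ℝ => (F t).re)
    hg hgc h0 (hbd.mono fun t ht => ht.1) (h.holAt_re hδ)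
  exact ((HolAt.const 0 ⟪v, p⟫ s).add (h1.const_mul ⟪v, e 0⟫)).congr
    (hbd.mono fun t ht => (ht.2 v).symm)

lemma holAt_inner_succ (h : IsChart Ω Ωs u K x₀ p e F r δ)
    (hev : ∀ᶠ t in nhds s, curvePt x₀ f g t ∈ closedBall x₀ (r / 2) ∧
      Sheet Ωs u p e (curvePt x₀ f g t) (q t) ∧ ⟪e 1, q t - p⟫ = 0)
    (hδ : |⟪e 0, curvePt x₀ f g s - x₀⟫| < δ) (hg : HolAt (k + 1) g s)
    (h0 : ⟪e 0, f 0⟫ + ⟪e 0, f 1⟫ * deriv g s ≠ 0) (v : E2) :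
    HolAt (k + 1) (fun t => ⟪v, q t⟫) s := by
  rw [inner_curvePt] at hδ
  have hbd := h.eventually_boundary_eq hev
  have h1 := HolAt.comp_linear_succ (I := fun t : ℝ => (F t).im) (R := fun t : ℝ => (F t).re)
    hg h0 (hbd.mono fun t ht => ht.1) (h.holAt_re hδ)
  exact ((HolAt.const _ ⟪v, p⟫ s).add (h1.const_mul ⟪v, e 0⟫)).congr
    (hbd.mono fun t ht => (ht.2 v).symm)

end IsChart

namespace IsCurve

variable {Ω Ωs : Set E2} {u : E2 → ℝ} {K : ℝ≥0} {x₀ p p' : E2} {e e' f : Frame}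
  {ε r κ η δ δ' : ℝ} {F F' : ℂ → ℂ} {g : ℝ → ℝ} {q q' : ℝ → E2}

lemma eventually_left (h : IsCurve Ω Ωs u K x₀ p p' e e' ε r f κ η g q q') {s : ℝ} (hs : |s| < η) :
    ∀ᶠ t in nhds s, curvePt x₀ f g t ∈ closedBall x₀ (r / 2) ∧
      Sheet Ωs u p e (curvePt x₀ f g t) (q t) ∧ ⟪e 1, q t - p⟫ = 0 := by
  have hev : ∀ᶠ t : ℝ in nhds s, |t| ≤ η :=
    (continuousAt_id.abs.eventually (gt_mem_nhds hs)).mono fun _ h => h.le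
  exact hev.mono fun t ht => ⟨h.mem t ht, h.left_sheet t ht,
    h.inner_eq_zero_of_sheets (h.mem_ball ht) (h.left_sheet t ht) (h.right_sheet t ht)⟩

lemma eventually_right (h : IsCurve Ω Ωs u K x₀ p p' e e' ε r f κ η g q q') {s : ℝ}
    (hs : |s| < η) : ∀ᶠ t in nhds s, curvePt x₀ f g t ∈ closedBall x₀ (r / 2) ∧
      Sheet Ωs u p' e' (curvePt x₀ f g t) (q' t) ∧ ⟪e' 1, q' t - p'⟫ = 0 := by
  have hev : ∀ᶠ t : ℝ in nhds s, |t| ≤ η :=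
    (continuousAt_id.abs.eventually (gt_mem_nhds hs)).mono fun _ h => h.le
  exact hev.mono fun t ht => ⟨h.mem t ht, h.right_sheet t ht,
    h.symm.inner_eq_zero_of_sheets (h.mem_ball ht) (h.right_sheet t ht) (h.left_sheet t ht)⟩

/-- The curve is transversal to the normals of the two edges. -/
lemma transversal (h : IsCurve Ω Ωs u K x₀ p p' e e' ε r f κ η g q q') {s m : ℝ} (hs : |s| ≤ η)
    (hm : ⟪f 0, q s - q' s⟫ + m * ⟪f 1, q s - q' s⟫ = 0) :
    ⟪e 0, f 0⟫ + ⟪e 0, f 1⟫ * m ≠ 0 ∧ ⟪e' 0, f 0⟫ + ⟪e' 0, f 1⟫ * m ≠ 0 := by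
  have key : ∀ a : Frame, ⟪a 1, q s - q' s⟫ ≠ 0 → ⟪a 0, f 0⟫ + ⟪a 0, f 1⟫ * m ≠ 0 := by
    intro a ha h0
    have h1 : ⟪f 0 + m • f 1, q s - q' s⟫ = 0 := by
      rw [inner_add_left, real_inner_smul_left]; exact hm
    have h2 : ⟪a 0, f 0 + m • f 1⟫ = 0 := by
      rw [inner_add_right, real_inner_smul_right]; linarith
    rw [a.inner_eq, h2, zero_mul, zero_add] at h1
    have h3 : ⟪a 1, f 0 + m • f 1⟫ = 0 := (mul_eq_zero.1 h1).resolve_right ha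
    have h4 : f 0 + m • f 1 = 0 := a.ext_inner (by simpa using h2) (by simpa using h3)
    have h5 : ⟪f 0, f 0 + m • f 1⟫ = 1 := by
      rw [inner_add_right, real_inner_smul_right]; simp
    rw [h4, inner_zero_right] at h5
    exact zero_ne_one h5
  have hq := h.mem_ball_of_sheet (h.mem_ball hs) (h.left_sheet s hs)
  have hq' := h.symm.mem_ball_of_sheet (h.mem_ball hs) (h.right_sheet s hs)
  constructor
  · refine key e fun h0 => ?_
    have h1 := h.inner_eq_zero_of_sheets (h.mem_ball hs) (h.left_sheet s hs) (h.right_sheet s hs)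
    have h2 := h.left_far _ hq'
    rw [← sub_sub_sub_cancel_right _ _ p, inner_sub_right] at h0
    linarith
  · refine key e' fun h0 => ?_
    have h1 := h.symm.inner_eq_zero_of_sheets (h.mem_ball hs) (h.right_sheet s hs)
      (h.left_sheet s hs)
    have h2 := h.right_far _ hq
    rw [← sub_sub_sub_cancel_right _ _ p', inner_sub_right] at h0
    linarith

lemma holAt (h : IsCurve Ω Ωs u K x₀ p p' e e' ε r f κ η g q q')
    (hF : IsChart Ω Ωs u K x₀ p e F r δ) (hF' : IsChart Ω Ωs u K x₀ p' e' F' r δ') (k : ℕ) {s : ℝ}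
    (hs : |s| < η) (hsδ : 2 * |s| < δ) (hsδ' : 2 * |s| < δ') : HolAt (k + 1) g s := by
  obtain ⟨J, hJ⟩ : ∃ J : Set ℝ, ∀ t, t ∈ J ↔ |t| < η ∧ 2 * |t| < δ ∧ 2 * |t| < δ' :=
    ⟨{t | |t| < η ∧ 2 * |t| < δ ∧ 2 * |t| < δ'}, fun _ => Iff.rfl⟩
  have hJo : ∀ t ∈ J, ∀ᶠ t' in nhds t, t' ∈ J := by
    intro t ht
    obtain ⟨h1, h2, h3⟩ := (hJ t).1 ht
    have hc : ContinuousAt (fun t : ℝ => 2 * |t|) t := by fun_prop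
    filter_upwards [continuousAt_id.abs.eventually (gt_mem_nhds h1),
      hc.eventually (gt_mem_nhds h2), hc.eventually (gt_mem_nhds h3)] with t' h1 h2 h3
    exact (hJ t').2 ⟨h1, h2, h3⟩
  have hδ : ∀ t ∈ J, |⟪e 0, curvePt x₀ f g t - x₀⟫| < δ := fun t ht =>
    (h.abs_inner_le ((hJ t).1 ht).1.le e 0).trans_lt ((hJ t).1 ht).2.1
  have hδ' : ∀ t ∈ J, |⟪e' 0, curvePt x₀ f g t - x₀⟫| < δ' := fun t ht =>
    (h.abs_inner_le ((hJ t).1 ht).1.le e' 0).trans_lt ((hJ t).1 ht).2.2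
  have hq : ∀ t ∈ J, ContinuousAt q t := fun t ht => hF.continuousAt_gradient
    (h.eventually_left ((hJ t).1 ht).1) (hδ t ht) (h.continuousAt ((hJ t).1 ht).1)
  have hq' : ∀ t ∈ J, ContinuousAt q' t := fun t ht => hF'.continuousAt_gradient
    (h.eventually_right ((hJ t).1 ht).1) (hδ' t ht) (h.continuousAt ((hJ t).1 ht).1)
  have hder : ∀ t ∈ J, HasDerivAt g (-⟪f 0, q t - q' t⟫ / ⟪f 1, q t - q' t⟫) t := fun t ht =>
    h.hasDerivAt ((hJ t).1 ht).1 (hq t ht) (hq' t ht)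
  have hne : ∀ t ∈ J, ⟪f 1, q t - q' t⟫ ≠ 0 := fun t ht =>
    (h.kappa_pos.trans_le (h.bound _
      (h.mem_ball_of_sheet (h.mem_ball ((hJ t).1 ht).1.le) (h.left_sheet t ((hJ t).1 ht).1.le)) _
      (h.symm.mem_ball_of_sheet (h.mem_ball ((hJ t).1 ht).1.le)
        (h.right_sheet t ((hJ t).1 ht).1.le))).1).ne'
  have hgd : ∀ t ∈ J, ∀ᶠ t' in nhds t, DifferentiableAt ℝ g t' := fun t ht =>
    (hJo t ht).mono fun t' ht' => (hder t' ht').differentiableAt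
  have hgc : ∀ t ∈ J, ContinuousAt (deriv g) t := by
    intro t ht
    have h1 := hq t ht
    have h2 := hq' t ht
    refine ContinuousAt.congr (f := fun t => -⟪f 0, q t - q' t⟫ / ⟪f 1, q t - q' t⟫)
      (ContinuousAt.div (by fun_prop) (by fun_prop) (hne t ht)) ?_
    exact (hJo t ht).mono fun t' ht' => (hder t' ht').deriv.symm
  have htr : ∀ t ∈ J, ⟪e 0, f 0⟫ + ⟪e 0, f 1⟫ * deriv g t ≠ 0 ∧
      ⟪e' 0, f 0⟫ + ⟪e' 0, f 1⟫ * deriv g t ≠ 0 := fun t ht =>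
    h.transversal ((hJ t).1 ht).1.le (by
      rw [(hder t ht).deriv, div_mul_cancel₀ _ (hne t ht)]; ring)
  have hstep : ∀ (k : ℕ), ∀ t ∈ J, (∀ v, HolAt k (fun t => ⟪v, q t⟫) t) →
      (∀ v, HolAt k (fun t => ⟪v, q' t⟫) t) → HolAt (k + 1) g t := by
    intro k t ht h1 h2
    have h3 : ∀ v : E2, HolAt k (fun t => ⟪v, q t - q' t⟫) t := fun v => by
      refine ((h1 v).add ((h2 v).const_mul (-1))).congr (Filter.Eventually.of_forall fun t => ?_)
      change ⟪v, q t⟫ + -1 * ⟪v, q' t⟫ = ⟪v, q t - q' t⟫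
      rw [inner_sub_right]; ring
    refine ⟨hgd t ht, (((h3 (f 0)).const_mul (-1)).mul ((h3 (f 1)).inv (hne t ht))).congr ?_⟩
    filter_upwards [hJo t ht] with t' ht'
    rw [(hder t' ht').deriv]
    ring
  have hall : ∀ k : ℕ, ∀ t ∈ J, HolAt (k + 1) g t := by
    intro k
    induction k with
    | zero =>
      exact fun t ht => hstep 0 t ht
        (hF.holAt_inner_zero (h.eventually_left ((hJ t).1 ht).1) (hδ t ht) (hgd t ht) (hgc t ht)
          (htr t ht).1)
        (hF'.holAt_inner_zero (h.eventually_right ((hJ t).1 ht).1) (hδ' t ht) (hgd t ht) (hgc t ht)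
          (htr t ht).2)
    | succ k ih =>
      exact fun t ht => hstep (k + 1) t ht
        (hF.holAt_inner_succ (h.eventually_left ((hJ t).1 ht).1) (hδ t ht) (ih t ht) (htr t ht).1)
        (hF'.holAt_inner_succ (h.eventually_right ((hJ t).1 ht).1) (hδ' t ht) (ih t ht)
          (htr t ht).2)
  exact hall k s ((hJ s).2 ⟨hs, hsδ, hsδ'⟩)

end IsCurve

/-- A function smooth on a neighbourhood of `0` agrees near `0` with a globally smooth function. -/
lemma exists_contDiff_extension {g : ℝ → ℝ} {η : ℝ} (hη : 0 < η)
    (hg : ∀ k : ℕ, ContDiffOn ℝ k g (ball 0 η)) :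
    ∃ G : ℝ → ℝ, ContDiff ℝ (⊤ : ℕ∞) G ∧ ∀ t, |t| ≤ η / 3 → G t = g t := by
  let b : ContDiffBump (0 : ℝ) := ⟨η / 3, η / 2, by positivity, by linarith⟩
  refine ⟨fun t => b t * g t, contDiff_infty.2 fun k => contDiff_iff_contDiffAt.2 fun t => ?_, ?_⟩
  · by_cases ht : t ∈ ball (0 : ℝ) η
    · exact b.contDiff.contDiffAt.mul ((hg k).contDiffAt (isOpen_ball.mem_nhds ht))
    · have h1 : ∀ᶠ t' in nhds t, b t' * g t' = 0 := by
        have h2 : η / 2 < dist t 0 := by rw [Metric.mem_ball, not_lt] at ht; linarith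
        have hc : ContinuousAt (fun t : ℝ => dist t 0) t := by fun_prop
        filter_upwards [hc.eventually (lt_mem_nhds h2)] with t' ht'
        rw [b.zero_of_le_dist ht'.le, zero_mul]
      exact contDiffAt_const.congr_of_eventuallyEq h1
  · intro t ht
    change b t * g t = g t
    rw [b.one_of_mem_closedBall (by simpa [b] using ht), one_mul]

/-- near each point of `S₂'` the singular set `A` is a smooth curve. -/
theorem sigma_two_prime_smooth_curve
    (Ω Ωs : Set E2)
    (hΩo : IsOpen Ω) (hΩb : Bornology.IsBounded Ω) (hΩc : IsConnected Ω)
    (hΩso : IsOpen Ωs) (hΩsb : Bornology.IsBounded Ωs) (hΩsc : IsConnected Ωs)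
    (hΩsnc : ¬ Convex ℝ Ωs)
    (m : ℕ) [NeZero m] (b : Fin m → E2) (hbinj : Function.Injective b)
    (hpoly : frontier Ωs = ⋃ i : Fin m, segment ℝ (b i) (b (i + 1)))
    (hvol : volume Ω = volume Ωs)
    (u : E2 → ℝ) (hconv : ConvexOn ℝ Set.univ u)
    (K : ℝ≥0) (hLip : LipschitzWith K u)
    (hae : ∀ᵐ x : E2, DifferentiableAt ℝ u x ∧ gradient u x ∈ closure Ωs)
    (hpush : ∀ E : Set E2, MeasurableSet E →
      volume {x ∈ Ω | DifferentiableAt ℝ u x ∧ gradient u x ∈ E} = volume (E ∩ Ωs))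
    (A : Set E2) (hA : A = {x ∈ Ω | ¬ DifferentiableAt ℝ u x})
    (S₁ S₂ S₂' S₂'' : Set E2)
    (hS₁ : S₁ = {x ∈ A | ∃ i : Fin m, b i ∈ subdiff u x})
    (hS₂ : S₂ = A \ S₁)
    (hS₂' : S₂' = {x ∈ S₂ |
      {i : Fin m | (subdiff u x ∩ openSegment ℝ (b i) (b (i + 1))).Nonempty}.ncard = 2})
    (hS₂'' : S₂'' = S₂ \ S₂')
 :
    ∀ x ∈ S₂',
      ∃ (r : ℝ) (e₁ e₂ : E2) (g : ℝ → ℝ), 0 < r ∧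
        ‖e₁‖ = 1 ∧ ‖e₂‖ = 1 ∧ ⟪e₁, e₂⟫ = 0 ∧ ContDiff ℝ (⊤ : ℕ∞) g ∧
        A ∩ ball x r = {y : E2 | ∃ t : ℝ, y = x + t • e₁ + g t • e₂} ∩ ball x r := by
  intro x hx
  subst hS₂' hS₂ hS₁ hA
  obtain ⟨⟨⟨hxΩ, hd⟩, hxS₁⟩, htwo⟩ := hx
  have hvert : ∀ k, b k ∉ subdiff u x := fun k hk => hxS₁ ⟨⟨hxΩ, hd⟩, k, hk⟩
  have hT : Transport Ω Ωs u K := ⟨hΩo, hΩb, hΩso, hconv, hLip, hae, hpush⟩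
  obtain ⟨p, p', e, e', ε, r, hF⟩ := hT.exists_isFold hpoly hxΩ hd hvert htwo
  obtain ⟨F, δ, hchart⟩ := hF.exists_isChart
  obtain ⟨F', δ', hchart'⟩ := hF.symm.exists_isChart
  obtain ⟨f, κ, η, g, q, q', hcurve⟩ := hF.exists_isCurve
  have hδ := hchart.pos
  have hδ' := hchart'.pos
  have hη := hcurve.eta_pos
  obtain ⟨ρ, hρ, hρη, hρδ, hρδ'⟩ : ∃ ρ, 0 < ρ ∧ ρ ≤ η ∧ 2 * ρ ≤ δ ∧ 2 * ρ ≤ δ' := by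
    refine ⟨min η (min (δ / 2) (δ' / 2)), by positivity, min_le_left _ _, ?_, ?_⟩
    · linarith [(min_le_right η (min (δ / 2) (δ' / 2))).trans (min_le_left _ _)]
    · linarith [(min_le_right η (min (δ / 2) (δ' / 2))).trans (min_le_right _ _)]
  obtain ⟨G, hG, hGg⟩ := exists_contDiff_extension hρ (g := g) fun k =>
    HolAt.contDiffOn isOpen_ball fun s hs => by
      rw [mem_ball_zero_iff, Real.norm_eq_abs] at hs
      exact (hcurve.holAt hchart hchart' k (by linarith) (by linarith) (by linarith)).of_succ
  refine ⟨ρ / 3, f 0, f 1, G, by positivity, f.norm_eq_one 0, f.norm_eq_one 1,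
    f.inner_eq_zero (by decide), hG, ?_⟩
  ext y
  refine and_congr_left fun hy => ?_
  have hyd : ‖y - x‖ < ρ / 3 := by rwa [mem_ball, dist_eq_norm] at hy
  have hyη : y ∈ ball x η := by rw [mem_ball, dist_eq_norm]; linarith
  have hyr : y ∈ ball x r := ball_subset_ball (by linarith [hcurve.eta_le]) hyη
  have hGy : G ⟪f 0, y - x⟫ = g ⟪f 0, y - x⟫ :=
    hGg _ ((f.abs_inner_le 0 (y - x)).trans hyd.le)
  have hiff := hcurve.not_differentiableAt_iff_eq hyη
  constructor
  · rintro ⟨-, hyn⟩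
    refine ⟨⟪f 0, y - x⟫, ?_⟩
    rw [hGy, ← hiff.1 hyn, add_assoc, ← f.eq_smul_add_smul, add_sub_cancel]
  · rintro ⟨t, ht⟩
    have hsub : y - x = t • f 0 + G t • f 1 := by rw [ht]; abel
    have h0 : ⟪f 0, y - x⟫ = t := by rw [hsub]; simp [inner_add_right, inner_smul_right]
    have h1 : ⟪f 1, y - x⟫ = G t := by rw [hsub]; simp [inner_add_right, inner_smul_right]
    exact ⟨hcurve.mem_source y hyr, hiff.2 (by rw [h1, ← hGy, h0])⟩
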